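/- Let g be the finite-dimensional simple Lie algebra of type E₈ over ℂ, and let (h,e,f) be an sl₂-triple in g. Then e lies in the derived subalgebra [g_e,g_e] of the centralizer g_e of e if and only if the Lie subalgebra of g generated by g(1)_e contains g(k)_e for every integer k ≥ 1. -/

import Mathlib

/-- The centralizer `g_e` of `e`, i.e. the kernel of `ad e`. -/
noncomputable def centralizer (e : LieAlgebra.e₈ ℂ) : Submodule ℂ (LieAlgebra.e₈ ℂ) :=
  LinearMap.ker (LieAlgebra.ad ℂ (LieAlgebra.e₈ ℂ) e)

/-- The derived subalgebra `[g_e, g_e]` of the centralizer, as the linear span of all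
brackets of pairs of elements of `g_e`. -/
noncomputable def derived (e : LieAlgebra.e₈ ℂ) : Submodule ℂ (LieAlgebra.e₈ ℂ) :=
  Submodule.span ℂ
    {z : LieAlgebra.e₈ ℂ | ∃ x ∈ centralizer e, ∃ y ∈ centralizer e, ⁅x, y⁆ = z}

namespace E8

/-! ### The root lattice -/

/-- The root lattice of type `E₈`, in the basis of simple roots. -/
abbrev Lat := Fin 8 → ℤ

/-- The invariant bilinear form on the root lattice. -/
def ip (v w : Lat) : ℤ := ∑ i, ∑ j, CartanMatrix.E₈ i j * (v i * w j)

/-- The coefficients of the bilinear form `bil`. -/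
def cocycleMatrix (i j : Fin 8) : ℤ :=
  if i = j then 1 else if j < i then CartanMatrix.E₈ i j else 0

/-- A bilinear form whose symmetrization is `ip`. -/
def bil (v w : Lat) : ℤ := ∑ i, ∑ j, cocycleMatrix i j * (v i * w j)

theorem ip_add_left (u v w : Lat) : ip (u + v) w = ip u w + ip v w := by
  simp [ip, add_mul, mul_add, Finset.sum_add_distrib]

theorem ip_add_right (u v w : Lat) : ip u (v + w) = ip u v + ip u w := by
  simp [ip, mul_add, Finset.sum_add_distrib]

theorem ip_neg_left (u v : Lat) : ip (-u) v = -ip u v := by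
  simp [ip]

theorem ip_neg_right (u v : Lat) : ip u (-v) = -ip u v := by
  simp [ip]

theorem ip_sub_left (u v w : Lat) : ip (u - v) w = ip u w - ip v w := by
  rw [sub_eq_add_neg, ip_add_left, ip_neg_left, sub_eq_add_neg]

theorem ip_sub_right (u v w : Lat) : ip u (v - w) = ip u v - ip u w := by
  rw [sub_eq_add_neg, ip_add_right, ip_neg_right, sub_eq_add_neg]

theorem bil_add_left (u v w : Lat) : bil (u + v) w = bil u w + bil v w := by
  simp [bil, add_mul, mul_add, Finset.sum_add_distrib]

theorem bil_add_right (u v w : Lat) : bil u (v + w) = bil u v + bil u w := by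
  simp [bil, mul_add, Finset.sum_add_distrib]

theorem bil_neg_left (u v : Lat) : bil (-u) v = -bil u v := by
  simp [bil]

theorem bil_neg_right (u v : Lat) : bil u (-v) = -bil u v := by
  simp [bil]

theorem ip_comm (v w : Lat) : ip v w = ip w v := by
  rw [ip, ip, Finset.sum_comm]
  refine Finset.sum_congr rfl fun i _ => Finset.sum_congr rfl fun j _ => ?_
  rw [← CartanMatrix.E₈_isSymm.apply i j]
  ring

theorem bil_add_bil (v w : Lat) : bil v w + bil w v = ip v w := by
  have h : bil w v = ∑ i, ∑ j, cocycleMatrix j i * (v i * w j) := by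
    rw [bil, Finset.sum_comm]
    refine Finset.sum_congr rfl fun i _ => Finset.sum_congr rfl fun j _ => by ring
  have key : ∀ i j : Fin 8, cocycleMatrix i j + cocycleMatrix j i = CartanMatrix.E₈ i j := by
    intro i j
    fin_cases i <;> fin_cases j <;> simp [cocycleMatrix, CartanMatrix.E₈]
  rw [h, bil, ip]
  simp only [← Finset.sum_add_distrib, ← add_mul, key]

theorem ip_self_eq (v : Lat) : ip v v = 2 * bil v v := by
  rw [← bil_add_bil]; ring

theorem ip_eq (v w : Lat) : ip v w =
    v 0 * (2 * w 0 - w 2) + v 1 * (2 * w 1 - w 3) + v 2 * (2 * w 2 - w 0 - w 3)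
    + v 3 * (2 * w 3 - w 1 - w 2 - w 4) + v 4 * (2 * w 4 - w 3 - w 5)
    + v 5 * (2 * w 5 - w 4 - w 6) + v 6 * (2 * w 6 - w 5 - w 7) + v 7 * (2 * w 7 - w 6) := by
  simp [ip, Fin.sum_univ_eight, CartanMatrix.E₈]
  ring

theorem ip_single (v : Lat) (i : Fin 8) :
    ip v (Pi.single i 1) = ∑ j, v j * CartanMatrix.E₈ j i := by
  simp [ip, Pi.single_apply, mul_comm]

theorem ip_single_single (i j : Fin 8) :
    ip (Pi.single i 1) (Pi.single j 1) = CartanMatrix.E₈ i j := by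
  simp [ip_single, Pi.single_apply]

theorem ip_eq_sum (v w : Lat) : ip v w = ∑ i, v i * ip w (Pi.single i 1) := by
  rw [ip]
  refine Finset.sum_congr rfl fun i _ => ?_
  rw [ip_single, Finset.mul_sum]
  refine Finset.sum_congr rfl fun j _ => ?_
  rw [← CartanMatrix.E₈_isSymm.apply i j]
  ring

theorem sixty_ip_self (v : Lat) : 60 * ip v v =
    30 * (2 * v 0 - v 2) ^ 2 + 30 * (2 * v 1 - v 3) ^ 2 + 10 * (3 * v 2 - 2 * v 3) ^ 2
    + 2 * (5 * v 3 - 6 * v 4) ^ 2 + 3 * (4 * v 4 - 5 * v 5) ^ 2 + 5 * (3 * v 5 - 4 * v 6) ^ 2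
    + 10 * (2 * v 6 - 3 * v 7) ^ 2 + 30 * v 7 ^ 2 := by
  rw [ip_eq]; ring

theorem ip_self_nonneg (v : Lat) : 0 ≤ ip v v := by
  have := sixty_ip_self v
  have : 0 ≤ 60 * ip v v := by rw [this]; positivity
  linarith

theorem eq_zero_of_ip_self (v : Lat) (h : ip v v = 0) : v = 0 := by
  have h0 := sixty_ip_self v
  rw [h, mul_zero] at h0
  have h1 := sq_nonneg (2 * v 0 - v 2)
  have h2 := sq_nonneg (2 * v 1 - v 3)
  have h3 := sq_nonneg (3 * v 2 - 2 * v 3)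
  have h4 := sq_nonneg (5 * v 3 - 6 * v 4)
  have h5 := sq_nonneg (4 * v 4 - 5 * v 5)
  have h6 := sq_nonneg (3 * v 5 - 4 * v 6)
  have h7 := sq_nonneg (2 * v 6 - 3 * v 7)
  have h8 := sq_nonneg (v 7)
  have e8 : v 7 = 0 := pow_eq_zero_iff (two_ne_zero) |>.1 (by linarith)
  have e7 : 2 * v 6 - 3 * v 7 = 0 := pow_eq_zero_iff (two_ne_zero) |>.1 (by linarith)
  have e6 : 3 * v 5 - 4 * v 6 = 0 := pow_eq_zero_iff (two_ne_zero) |>.1 (by linarith)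
  have e5 : 4 * v 4 - 5 * v 5 = 0 := pow_eq_zero_iff (two_ne_zero) |>.1 (by linarith)
  have e4 : 5 * v 3 - 6 * v 4 = 0 := pow_eq_zero_iff (two_ne_zero) |>.1 (by linarith)
  have e3 : 3 * v 2 - 2 * v 3 = 0 := pow_eq_zero_iff (two_ne_zero) |>.1 (by linarith)
  have e2 : 2 * v 1 - v 3 = 0 := pow_eq_zero_iff (two_ne_zero) |>.1 (by linarith)
  have e1 : 2 * v 0 - v 2 = 0 := pow_eq_zero_iff (two_ne_zero) |>.1 (by linarith)
  funext i
  fin_cases i <;> simp <;> omega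

/-- A root is a lattice vector of norm two. -/
def IsRoot (v : Lat) : Prop := ip v v = 2

instance : DecidablePred IsRoot := fun _ => inferInstanceAs (Decidable (_ = _))

theorem IsRoot.neg {v : Lat} (h : IsRoot v) : IsRoot (-v) := by
  simpa [IsRoot, ip_neg_left, ip_neg_right] using h

theorem isRoot_single (i : Fin 8) : IsRoot (Pi.single i 1) := by
  rw [IsRoot, ip_single_single]; simp

theorem IsRoot.bil_self {v : Lat} (h : IsRoot v) : bil v v = 1 := by
  have := ip_self_eq v
  rw [IsRoot] at h
  omega

theorem ip_add_self (v w : Lat) : ip (v + w) (v + w) = ip v v + 2 * ip v w + ip w w := by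
  rw [ip_add_left, ip_add_right, ip_add_right, ip_comm w v]; ring

theorem ip_sub_self (v w : Lat) : ip (v - w) (v - w) = ip v v - 2 * ip v w + ip w w := by
  rw [ip_sub_left, ip_sub_right, ip_sub_right, ip_comm w v]; ring

theorem IsRoot.neg_two_le {v w : Lat} (hv : IsRoot v) (hw : IsRoot w) : -2 ≤ ip v w := by
  have := ip_self_nonneg (v + w)
  rw [ip_add_self, hv, hw] at this
  omega

theorem IsRoot.le_two {v w : Lat} (hv : IsRoot v) (hw : IsRoot w) : ip v w ≤ 2 := by
  have := ip_self_nonneg (v - w)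
  rw [ip_sub_self, hv, hw] at this
  omega

theorem IsRoot.eq_neg {v w : Lat} (hv : IsRoot v) (hw : IsRoot w) (h : ip v w = -2) : w = -v := by
  have : ip (v + w) (v + w) = 0 := by rw [ip_add_self, hv, hw, h]; norm_num
  exact (neg_eq_of_add_eq_zero_right (eq_zero_of_ip_self _ this)).symm

theorem IsRoot.eq {v w : Lat} (hv : IsRoot v) (hw : IsRoot w) (h : ip v w = 2) : w = v := by
  have : ip (v - w) (v - w) = 0 := by rw [ip_sub_self, hv, hw, h]; norm_num
  exact (sub_eq_zero.1 (eq_zero_of_ip_self _ this)).symm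

theorem IsRoot.add {v w : Lat} (hv : IsRoot v) (hw : IsRoot w) (h : ip v w = -1) :
    IsRoot (v + w) := by
  rw [IsRoot, ip_add_self, hv, hw, h]; norm_num

theorem IsRoot.sub {v w : Lat} (hv : IsRoot v) (hw : IsRoot w) (h : ip v w = 1) :
    IsRoot (v - w) := by
  rw [IsRoot, ip_sub_self, hv, hw, h]; norm_num

theorem IsRoot.ne_zero {v : Lat} (hv : IsRoot v) : v ≠ 0 := by
  rintro rfl
  simp [IsRoot, ip] at hv

/-- The sign cocycle. -/
def eps (v w : Lat) : ℂ := ((Int.negOnePow (bil v w) : ℤˣ) : ℤ)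

theorem eps_add_left (u v w : Lat) : eps (u + v) w = eps u w * eps v w := by
  simp [eps, bil_add_left, Int.negOnePow_add]

theorem eps_add_right (u v w : Lat) : eps u (v + w) = eps u v * eps u w := by
  simp [eps, bil_add_right, Int.negOnePow_add]

theorem eps_neg_left (v w : Lat) : eps (-v) w = eps v w := by
  simp [eps, bil_neg_left, Int.negOnePow_neg]

theorem eps_neg_right (v w : Lat) : eps v (-w) = eps v w := by
  simp [eps, bil_neg_right, Int.negOnePow_neg]

theorem eps_mul_self (v w : Lat) : eps v w * eps v w = 1 := by
  rw [eps, ← Int.cast_mul, ← Units.val_mul, ← Int.negOnePow_add, ← two_mul,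
    Int.negOnePow_two_mul]
  simp

theorem eps_ne_zero (v w : Lat) : eps v w ≠ 0 := fun h => by
  have := eps_mul_self v w
  simp [h] at this

theorem eps_mul_eps (v w : Lat) : eps v w * eps w v = ((Int.negOnePow (ip v w) : ℤˣ) : ℤ) := by
  rw [eps, eps, ← Int.cast_mul, ← Units.val_mul, ← Int.negOnePow_add, bil_add_bil]

theorem eps_self {v : Lat} (h : IsRoot v) : eps v v = -1 := by
  simp [eps, h.bil_self]

theorem eps_swap_of_even {v w : Lat} (h : Even (ip v w)) : eps v w = eps w v := by
  have h1 := eps_mul_eps v w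
  rw [Int.negOnePow_even _ h] at h1
  have h2 := eps_mul_self w v
  have : (eps v w - eps w v) * eps w v = 0 := by rw [sub_mul, h1, h2]; simp
  rcases mul_eq_zero.1 this with h3 | h3
  · exact sub_eq_zero.1 h3
  · exact absurd h3 (eps_ne_zero _ _)

theorem eps_swap_of_odd {v w : Lat} (h : Odd (ip v w)) : eps v w = -eps w v := by
  have h1 := eps_mul_eps v w
  rw [Int.negOnePow_odd _ h] at h1
  have h2 := eps_mul_self w v
  have : (eps v w + eps w v) * eps w v = 0 := by rw [add_mul, h1, h2]; simp
  rcases mul_eq_zero.1 this with h3 | h3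
  · exact eq_neg_of_add_eq_zero_left h3
  · exact absurd h3 (eps_ne_zero _ _)

end E8

namespace E8

/-! ### The list of roots -/

/-- The decimal digits of the positive roots. -/
def posRootDigits : List ℕ := [
  1, 10, 11, 100, 110, 111, 1000, 1100, 1110, 1111, 10000, 11000, 11100, 11110, 11111, 100000,
  110000, 111000, 111100, 111110, 111111, 1000000, 1010000, 1011000, 1011100, 1011110, 1011111,
  1110000, 1111000, 1111100, 1111110, 1111111, 1121000, 1121100, 1121110, 1121111, 1122100,
  1122110, 1122111, 1122210, 1122211, 1122221, 10000000, 10100000, 10110000, 10111000, 10111100,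
  10111110, 10111111, 11110000, 11111000, 11111100, 11111110, 11111111, 11121000, 11121100,
  11121110, 11121111, 11122100, 11122110, 11122111, 11122210, 11122211, 11122221, 11221000,
  11221100, 11221110, 11221111, 11222100, 11222110, 11222111, 11222210, 11222211, 11222221,
  11232100, 11232110, 11232111, 11232210, 11232211, 11232221, 11233210, 11233211, 11233221,
  11233321, 12232100, 12232110, 12232111, 12232210, 12232211, 12232221, 12233210, 12233211,
  12233221, 12233321, 12243210, 12243211, 12243221, 12243321, 12244321, 12343210, 12343211,
  12343221, 12343321, 12344321, 12354321, 13354321, 22343210, 22343211, 22343221, 22343321,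
  22344321, 22354321, 22454321, 23354321, 23454321, 23464321, 23465321, 23465421, 23465431,
  23465432]

/-- A computationally convenient copy of the root lattice. -/
structure Vec8 where
  (c0 c1 c2 c3 c4 c5 c6 c7 : ℤ)
deriving DecidableEq

namespace Vec8

/-- The lattice vector with the given coordinates. -/
def toLat (v : Vec8) : Lat := ![v.c0, v.c1, v.c2, v.c3, v.c4, v.c5, v.c6, v.c7]

/-- Coordinatewise addition. -/
protected def add (v w : Vec8) : Vec8 :=
  ⟨v.c0 + w.c0, v.c1 + w.c1, v.c2 + w.c2, v.c3 + w.c3, v.c4 + w.c4, v.c5 + w.c5, v.c6 + w.c6,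
    v.c7 + w.c7⟩

/-- Coordinatewise negation. -/
protected def neg (v : Vec8) : Vec8 :=
  ⟨-v.c0, -v.c1, -v.c2, -v.c3, -v.c4, -v.c5, -v.c6, -v.c7⟩

/-- The bilinear form `E8.ip`. -/
protected def ip (v w : Vec8) : ℤ :=
  v.c0 * (2 * w.c0 - w.c2) + v.c1 * (2 * w.c1 - w.c3) + v.c2 * (2 * w.c2 - w.c0 - w.c3)
    + v.c3 * (2 * w.c3 - w.c1 - w.c2 - w.c4) + v.c4 * (2 * w.c4 - w.c3 - w.c5)
    + v.c5 * (2 * w.c5 - w.c4 - w.c6) + v.c6 * (2 * w.c6 - w.c5 - w.c7)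
    + v.c7 * (2 * w.c7 - w.c6)

theorem toLat_add (v w : Vec8) : (v.add w).toLat = v.toLat + w.toLat := by
  simp [toLat, Vec8.add]

theorem toLat_neg (v : Vec8) : v.neg.toLat = -v.toLat := by
  simp [toLat, Vec8.neg]

theorem ip_toLat (v w : Vec8) : E8.ip v.toLat w.toLat = v.ip w := by
  rw [ip_eq]
  simp [toLat, Vec8.ip]

theorem toLat_injective : Function.Injective toLat := by
  rintro ⟨a0, a1, a2, a3, a4, a5, a6, a7⟩ ⟨b0, b1, b2, b3, b4, b5, b6, b7⟩ h
  have := congrFun h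
  have h0 := this 0
  have h1 := this 1
  have h2 := this 2
  have h3 := this 3
  have h4 := this 4
  have h5 := this 5
  have h6 := this 6
  have h7 := this 7
  simp only [toLat] at h0 h1 h2 h3 h4 h5 h6 h7
  simp at h0 h1 h2 h3 h4 h5 h6 h7
  simp [*]

/-- The `i`-th simple root. -/
def simple : Fin 8 → Vec8
  | 0 => ⟨1, 0, 0, 0, 0, 0, 0, 0⟩
  | 1 => ⟨0, 1, 0, 0, 0, 0, 0, 0⟩
  | 2 => ⟨0, 0, 1, 0, 0, 0, 0, 0⟩
  | 3 => ⟨0, 0, 0, 1, 0, 0, 0, 0⟩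
  | 4 => ⟨0, 0, 0, 0, 1, 0, 0, 0⟩
  | 5 => ⟨0, 0, 0, 0, 0, 1, 0, 0⟩
  | 6 => ⟨0, 0, 0, 0, 0, 0, 1, 0⟩
  | 7 => ⟨0, 0, 0, 0, 0, 0, 0, 1⟩

theorem toLat_simple (i : Fin 8) : (simple i).toLat = Pi.single i 1 := by
  funext j
  fin_cases i <;> fin_cases j <;> rfl

/-- The vector whose coordinates are the decimal digits of a natural number. -/
def ofDigits (n : ℕ) : Vec8 :=
  ⟨.ofNat (n / 10000000), .ofNat (n / 1000000 % 10), .ofNat (n / 100000 % 10),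
    .ofNat (n / 10000 % 10), .ofNat (n / 1000 % 10), .ofNat (n / 100 % 10), .ofNat (n / 10 % 10),
    .ofNat (n % 10)⟩

end Vec8

/-- The list of positive roots. -/
def posRoots : List Vec8 := posRootDigits.map Vec8.ofDigits

/-- The list of all roots. -/
def roots : List Vec8 := posRoots ++ posRoots.map Vec8.neg

theorem roots_ip : ∀ v ∈ roots, v.ip v = 2 := by decide +kernel

theorem roots_nodup : roots.Nodup := by decide +kernel

theorem simple_mem_roots : ∀ i, Vec8.simple i ∈ roots := by decide +kernel

theorem posRoots_add : ∀ v ∈ posRoots, ∀ i, v.ip (Vec8.simple i) = -1 →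
    v.add (Vec8.simple i) ∈ posRoots := by decide +kernel

theorem posRoots_sub : ∀ v ∈ posRoots, ∀ i, v.ip (Vec8.simple i) = 1 →
    v.add (Vec8.simple i).neg ∈ posRoots := by decide +kernel
end E8

namespace E8

theorem mem_roots_neg {v : Vec8} (h : v ∈ roots) : v.neg ∈ roots := by
  have hn : ∀ w : Vec8, w.neg.neg = w := fun w => by simp [Vec8.neg]
  simp only [roots, List.mem_append, List.mem_map] at h ⊢
  rcases h with h | ⟨w, hw, rfl⟩
  · exact Or.inr ⟨v, h, rfl⟩
  · exact Or.inl (by rwa [hn])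

theorem mem_roots_add {v : Vec8} (h : v ∈ roots) {i : Fin 8} (hi : v.ip (Vec8.simple i) = -1) :
    v.add (Vec8.simple i) ∈ roots := by
  have h' := h
  simp only [roots, List.mem_append, List.mem_map] at h
  rcases h with h | ⟨w, hw, rfl⟩
  · exact List.mem_append_left _ (posRoots_add v h i hi)
  · have h1 : w.ip (Vec8.simple i) = 1 := by
      rw [← Vec8.ip_toLat, Vec8.toLat_neg, ip_neg_left, Vec8.ip_toLat] at hi
      omega
    have h2 := mem_roots_neg (List.mem_append_left (posRoots.map Vec8.neg) (posRoots_sub w hw i h1))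
    have h3 : (w.add (Vec8.simple i).neg).neg = w.neg.add (Vec8.simple i) := by
      simp [Vec8.neg, Vec8.add, neg_add_rev, add_comm]
    rwa [h3] at h2

theorem exists_pos_coord {v : Lat} (hv : IsRoot v) : ∃ i, 0 < v i * ip v (Pi.single i 1) := by
  by_contra! h
  have h1 := ip_eq_sum v v
  have h2 := Finset.sum_nonpos fun i (_ : i ∈ Finset.univ) => h i
  rw [← h1, hv] at h2
  omega

/-- Induction on roots. -/
theorem root_induction {P : Lat → Prop} (h1 : ∀ i, P (Pi.single i 1))
    (h2 : ∀ i, P (-Pi.single i 1))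
    (h3 : ∀ v i, IsRoot v → ip v (Pi.single i 1) = -1 → P v → P (v + Pi.single i 1))
    (h4 : ∀ v i, IsRoot v → ip v (Pi.single i 1) = 1 → P v → P (v - Pi.single i 1)) :
    ∀ v, IsRoot v → P v := by
  suffices H : ∀ n : ℕ, ∀ v, IsRoot v → ∑ i, (v i).natAbs < n → P v from
    fun v hv => H _ v hv (Nat.lt_succ_self _)
  intro n
  induction n with
  | zero => intro v _ h; omega
  | succ n ih =>
    intro v hv hn
    obtain ⟨i, hi⟩ := exists_pos_coord hv
    have hle := hv.le_two (isRoot_single i)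
    have hge := hv.neg_two_le (isRoot_single i)
    have key : ∀ w : Lat, (∀ j, j ≠ i → w j = v j) → (w i).natAbs < (v i).natAbs →
        ∑ j, (w j).natAbs < n := by
      intro w hw hwi
      refine lt_of_lt_of_le (Finset.sum_lt_sum (fun j _ => ?_) ⟨i, Finset.mem_univ i, hwi⟩)
        (Nat.le_of_lt_succ hn)
      by_cases hj : j = i
      · subst hj; exact hwi.le
      · rw [hw j hj]
    rcases pos_and_pos_or_neg_and_neg_of_mul_pos hi with ⟨hp, hq⟩ | ⟨hp, hq⟩
    · by_cases h : ip v (Pi.single i 1) = 2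
      · rw [(isRoot_single i).eq hv (by rw [ip_comm]; exact h)]; exact h1 i
      · have h' : ip v (Pi.single i 1) = 1 := by omega
        have hr := hv.sub (isRoot_single i) h'
        have := h3 (v - Pi.single i 1) i hr
          (by rw [ip_sub_left, h', isRoot_single i]; norm_num)
          (ih _ hr (key _ (fun j hj => by simp [hj]) (by simp; omega)))
        rwa [sub_add_cancel] at this
    · by_cases h : ip v (Pi.single i 1) = -2
      · rw [(isRoot_single i).eq_neg hv (by rw [ip_comm]; exact h)]; exact h2 i
      · have h' : ip v (Pi.single i 1) = -1 := by omega
        have hr := hv.add (isRoot_single i) h'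
        have := h4 (v + Pi.single i 1) i hr
          (by rw [ip_add_left, h', isRoot_single i]; norm_num)
          (ih _ hr (key _ (fun j hj => by simp [hj]) (by simp; omega)))
        rwa [add_sub_cancel_right] at this

theorem exists_mem_roots {v : Lat} (hv : IsRoot v) : ∃ w ∈ roots, w.toLat = v := by
  refine root_induction (P := fun v => ∃ w ∈ roots, w.toLat = v) (fun i => ?_) (fun i => ?_)
    ?_ ?_ v hv
  · exact ⟨_, simple_mem_roots i, Vec8.toLat_simple i⟩
  · exact ⟨_, mem_roots_neg (simple_mem_roots i), by rw [Vec8.toLat_neg, Vec8.toLat_simple]⟩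
  · rintro _ i - hi ⟨w, hw, rfl⟩
    rw [← Vec8.toLat_simple, Vec8.ip_toLat] at hi
    exact ⟨_, mem_roots_add hw hi, by rw [Vec8.toLat_add, Vec8.toLat_simple]⟩
  · rintro _ i - hi ⟨w, hw, rfl⟩
    rw [← Vec8.toLat_simple, ← neg_inj, ← ip_neg_left, ← Vec8.toLat_neg, Vec8.ip_toLat] at hi
    refine ⟨_, mem_roots_neg (mem_roots_add (mem_roots_neg hw) hi), ?_⟩
    rw [Vec8.toLat_neg, Vec8.toLat_add, Vec8.toLat_neg, Vec8.toLat_simple, neg_add, neg_neg,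
      sub_eq_add_neg]

theorem isRoot_of_mem_roots {v : Vec8} (h : v ∈ roots) : IsRoot v.toLat := by
  rw [IsRoot, Vec8.ip_toLat]; exact roots_ip v h

/-- The type of roots. -/
abbrev Root := {v : Lat // IsRoot v}

instance : Finite Root := by
  have : Finite {w : Vec8 // w ∈ roots} := inferInstance
  refine Finite.of_surjective
    (fun w : {w : Vec8 // w ∈ roots} => (⟨w.1.toLat, isRoot_of_mem_roots w.2⟩ : Root)) ?_
  rintro ⟨v, hv⟩
  obtain ⟨w, hw, h⟩ := exists_mem_roots hv
  exact ⟨⟨w, hw⟩, Subtype.ext h⟩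

noncomputable instance : Fintype Root := Fintype.ofFinite _

/-- The index type of the Chevalley basis. -/
abbrev Idx := Fin 8 ⊕ Root

/-- The underlying space of the model of the Lie algebra of type `E₈`. -/
def Model := Idx → ℂ

noncomputable instance : NormedAddCommGroup Model := inferInstanceAs (NormedAddCommGroup (Idx → ℂ))

noncomputable instance : NormedSpace ℂ Model := inferInstanceAs (NormedSpace ℂ (Idx → ℂ))

instance : FiniteDimensional ℂ Model := inferInstanceAs (FiniteDimensional ℂ (Idx → ℂ))

/-- The Chevalley basis. -/
noncomputable def bas : Module.Basis Idx ℂ Model := Pi.basisFun ℂ Idx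

/-- The simple coroot `Hᵢ`. -/
noncomputable def H (i : Fin 8) : Model := bas (Sum.inl i)

/-- The root vector attached to `v` (zero if `v` is not a root). -/
noncomputable def E (v : Lat) : Model := if h : IsRoot v then bas (Sum.inr ⟨v, h⟩) else 0

/-- The coroot attached to `v`. -/
noncomputable def coroot (v : Lat) : Model := ∑ i, (v i : ℂ) • H i

theorem E_coe (r : Root) : E r = bas (Sum.inr r) := by
  simp [E, r.2]

theorem coroot_neg (v : Lat) : coroot (-v) = -coroot v := by
  simp [coroot]

theorem coroot_add (v w : Lat) : coroot (v + w) = coroot v + coroot w := by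
  simp [coroot, add_smul, Finset.sum_add_distrib]

theorem coroot_single (i : Fin 8) : coroot (Pi.single i 1) = H i := by
  simp [coroot, Pi.single_apply, ite_smul]

/-- The bracket on basis vectors. -/
noncomputable def brBasis : Idx → Idx → Model
  | .inl _, .inl _ => 0
  | .inl i, .inr r => (ip (Pi.single i 1) r : ℂ) • E r
  | .inr r, .inl i => -((ip (Pi.single i 1) r : ℂ) • E r)
  | .inr r, .inr s =>
    if ip r s = -1 then eps r s • E (r + s) else if ip r s = -2 then -coroot r else 0

/-- The bracket as a bilinear map. -/
noncomputable def br : Model →ₗ[ℂ] Model →ₗ[ℂ] Model :=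
  bas.constr ℂ fun a => bas.constr ℂ fun b => brBasis a b

theorem br_bas (a b : Idx) : br (bas a) (bas b) = brBasis a b := by
  simp [br]

theorem br_H_H (i j : Fin 8) : br (H i) (H j) = 0 := by
  rw [H, H, br_bas, brBasis]

theorem br_H_E (i : Fin 8) (v : Lat) : br (H i) (E v) = (ip (Pi.single i 1) v : ℂ) • E v := by
  by_cases h : IsRoot v
  · rw [H, show v = ((⟨v, h⟩ : Root) : Lat) from rfl, E_coe, br_bas, brBasis, E_coe]
  · simp [E, h]

theorem br_E_H (i : Fin 8) (v : Lat) : br (E v) (H i) = -((ip (Pi.single i 1) v : ℂ) • E v) := by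
  by_cases h : IsRoot v
  · rw [H, show v = ((⟨v, h⟩ : Root) : Lat) from rfl, E_coe, br_bas, brBasis, E_coe]
  · simp [E, h]

theorem br_E_E {v w : Lat} (hv : IsRoot v) (hw : IsRoot w) : br (E v) (E w) =
    if ip v w = -1 then eps v w • E (v + w) else if ip v w = -2 then -coroot v else 0 := by
  rw [show v = ((⟨v, hv⟩ : Root) : Lat) from rfl, show w = ((⟨w, hw⟩ : Root) : Lat) from rfl,
    E_coe, E_coe, br_bas, brBasis]

theorem br_coroot_E (u v : Lat) : br (coroot u) (E v) = (ip u v : ℂ) • E v := by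
  simp only [coroot, map_sum, map_smul, LinearMap.sum_apply, LinearMap.smul_apply, br_H_E,
    smul_smul, ← Finset.sum_smul]
  rw [ip_eq_sum u v]
  push_cast
  simp [ip_comm v]

theorem br_E_coroot (u v : Lat) : br (E v) (coroot u) = -((ip u v : ℂ) • E v) := by
  rw [← br_coroot_E]
  simp [coroot, br_E_H, br_H_E]

theorem br_H_coroot (u : Lat) (i : Fin 8) : br (H i) (coroot u) = 0 := by
  simp [coroot, br_H_H]

theorem model_induction {P : Model → Prop} (hH : ∀ i, P (H i)) (hE : ∀ v, IsRoot v → P (E v))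
    (h0 : P 0) (ha : ∀ x y, P x → P y → P (x + y)) (hs : ∀ (c : ℂ) x, P x → P (c • x)) (x : Model) :
    P x := by
  have hx := bas.mem_span x
  induction hx using Submodule.span_induction with
  | mem x hx =>
    obtain ⟨i | r, rfl⟩ := hx
    · exact hH i
    · rw [← E_coe]; exact hE r r.2
  | zero => exact h0
  | add x y _ _ h1 h2 => exact ha x y h1 h2
  | smul c x _ h => exact hs c x h

theorem br_skew (x y : Model) : br x y = -br y x := by
  induction x using model_induction with
  | hH i =>
    induction y using model_induction with
    | hH j => simp [br_H_H]
    | hE v hv => rw [br_H_E, br_E_H, neg_neg]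
    | h0 => simp
    | ha x y h1 h2 => simp only [map_add, LinearMap.add_apply, h1, h2, neg_add]
    | hs c x h => simp [h]
  | hE v hv =>
    induction y using model_induction with
    | hH j => rw [br_H_E, br_E_H]
    | hE w hw =>
      rw [br_E_E hv hw, br_E_E hw hv, ip_comm w v]
      split_ifs with h1 h2
      · rw [eps_swap_of_odd (by rw [h1]; decide), add_comm w v, neg_smul]
      · rw [hv.eq_neg hw h2, coroot_neg, neg_neg]
      · simp
    | h0 => simp
    | ha x y h1 h2 => simp only [map_add, LinearMap.add_apply, h1, h2, neg_add]
    | hs c x h => simp [h]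
  | h0 => simp
  | ha x y h1 h2 => simp only [map_add, LinearMap.add_apply, h1, h2, neg_add]
  | hs c x h => simp [h]

end E8

namespace E8

/-- The Jacobi expression. -/
noncomputable def jac (x y z : Model) : Model := br x (br y z) + br y (br z x) + br z (br x y)

theorem jac_rot (x y z : Model) : jac x y z = jac y z x := by
  simp only [jac]; abel

theorem jac_H_H_E (i j : Fin 8) (v : Lat) : jac (H i) (H j) (E v) = 0 := by
  simp only [jac, br_H_E, br_E_H, br_H_H, map_smul, map_neg, map_zero, smul_smul]
  rw [mul_comm]
  abel

theorem jac_H_E_E (i : Fin 8) {v w : Lat} (hv : IsRoot v) (hw : IsRoot w) :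
    jac (H i) (E v) (E w) = 0 := by
  simp only [jac, br_H_E, br_E_H, map_smul, map_neg]
  rw [br_skew (E w) (E v), br_E_E hv hw]
  split_ifs with h1 h2
  · simp only [map_smul, br_H_E, ip_add_right, smul_smul, ← neg_smul, ← add_smul]
    push_cast
    convert zero_smul ℂ _ using 2
    ring
  · rw [hv.eq_neg hw h2, ip_neg_right]
    simp [br_H_coroot]
  · simp

/-- Bracket of three root vectors. -/
theorem br_E_br_E_E {u v w : Lat} (hu : IsRoot u) (hv : IsRoot v) (hw : IsRoot w) :
    br (E u) (br (E v) (E w)) =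
      if ip v w = -1 then
        if ip u v + ip u w = -1 then (eps v w * eps u v * eps u w) • E (u + v + w)
        else if ip u v + ip u w = -2 then -(eps v w • coroot u) else 0
      else if ip v w = -2 then (ip u v : ℂ) • E u else 0 := by
  rw [br_E_E hv hw]
  split_ifs with h1 h2 h3 h4
  · rw [map_smul, br_E_E hu (hv.add hw h1), ip_add_right, if_pos h2, eps_add_right, smul_smul,
      mul_assoc, add_assoc]
  · rw [map_smul, br_E_E hu (hv.add hw h1), ip_add_right, if_neg h2, if_pos h3, smul_neg]
  · rw [map_smul, br_E_E hu (hv.add hw h1), ip_add_right, if_neg h2, if_neg h3, smul_zero]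
  · rw [map_neg, br_E_coroot, neg_neg, ip_comm]
  · simp

theorem jac_opp {u w : Lat} (hu : IsRoot u) (hw : IsRoot w) :
    jac (E u) (E (-u)) (E w) = 0 := by
  have h1 := hu.neg_two_le hw
  have h2 := hu.le_two hw
  have huu : ip u u = 2 := hu
  have hc := ip_comm u w
  rw [jac, br_E_br_E_E hu hu.neg hw, br_E_br_E_E hu.neg hw hu, br_E_br_E_E hw hu hu.neg]
  simp only [ip_neg_left, ip_neg_right, huu, ip_comm w u, eps_neg_left, eps_neg_right]
  have hcase : ip u w = -2 ∨ ip u w = -1 ∨ ip u w = 0 ∨ ip u w = 1 ∨ ip u w = 2 := by omega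
  rcases hcase with h | h | h | h | h
  · simp [hu.eq_neg hw h, huu, ip_neg_right]
  · have hs := eps_swap_of_odd (v := u) (w := w) (by rw [h]; decide)
    have h1 : eps w u * eps u w * eps u u = 1 := by
      rw [eps_self hu, hs]
      linear_combination eps_mul_self w u
    simp [h, h1]
  · simp [h]
  · have hs := eps_swap_of_odd (v := u) (w := w) (by rw [h]; decide)
    have h1 : eps u w * eps u u * eps u w = -1 := by
      rw [eps_self hu, mul_neg_one, neg_mul, eps_mul_self]
    simp [h, h1]
  · simp [hu.eq hw h, huu]

theorem jac_E_E_E {u v w : Lat} (hu : IsRoot u) (hv : IsRoot v) (hw : IsRoot w) :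
    jac (E u) (E v) (E w) = 0 := by
  by_cases huv : ip u v = -2
  · rw [hu.eq_neg hv huv]; exact jac_opp hu hw
  by_cases hvw : ip v w = -2
  · rw [hv.eq_neg hw hvw, jac_rot]; exact jac_opp hv hu
  by_cases huw : ip w u = -2
  · rw [hw.eq_neg hu huw, jac_rot, jac_rot]; exact jac_opp hw hv
  have l1 := hu.neg_two_le hv
  have l2 := hv.neg_two_le hw
  have l3 := hw.neg_two_le hu
  rw [jac, br_E_br_E_E hu hv hw, br_E_br_E_E hv hw hu, br_E_br_E_E hw hu hv]
  rw [ip_comm u w, ip_comm w v, ip_comm v u, if_neg hvw, if_neg huw, if_neg huv,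
    show v + w + u = u + v + w by abel, show w + u + v = u + v + w by abel]
  by_cases a1 : ip u v = -1 <;> by_cases b1 : ip v w = -1 <;> by_cases c1 : ip w u = -1
  · -- all equal to `-1`
    have s1 : v + w = -u := hu.eq_neg (hv.add hw b1) (by
      rw [ip_add_right, a1, ip_comm, c1]; norm_num)
    have s2 : w = -(u + v) := by rw [← sub_eq_zero]; rw [← sub_eq_zero] at s1; rw [← s1]; abel
    have e1 : eps v w = eps u v := by
      rw [s2, eps_neg_right, eps_add_right, eps_self hv, eps_swap_of_odd (v := v) (w := u)
        (by rw [ip_comm, a1]; decide)]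
      ring
    have e2 : eps w u = eps u v := by
      rw [s2, eps_neg_left, eps_add_left, eps_self hu, eps_swap_of_odd (v := v) (w := u)
        (by rw [ip_comm, a1]; decide)]
      ring
    simp only [a1, b1, c1, e1, e2]
    norm_num
    rw [← neg_add, ← neg_add, ← smul_add, ← smul_add, ← coroot_add, ← coroot_add,
      show u + v + w = 0 by rw [s2]; abel]
    simp [coroot]
  · rw [if_pos b1, if_neg (show ¬ ip u v + ip w u = -2 by omega), if_neg c1, if_pos a1,
      if_neg (show ¬ ip w u + ip v w = -2 by omega)]
    by_cases c0 : ip w u = 0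
    · rw [if_pos (by omega), if_pos (by omega), add_zero, ← add_smul]
      convert zero_smul ℂ _ using 2
      rw [eps_swap_of_even (v := w) (w := u) (by rw [c0]; decide),
        eps_swap_of_odd (v := v) (w := w) (by rw [b1]; decide)]
      ring
    · rw [if_neg (by omega), if_neg (by omega)]
      simp
  · rw [if_pos c1, if_neg (show ¬ ip v w + ip u v = -2 by omega), if_neg b1, if_pos a1,
      if_neg (show ¬ ip w u + ip v w = -2 by omega)]
    by_cases c0 : ip v w = 0
    · rw [if_pos (by omega), if_pos (by omega), zero_add, ← add_smul]
      convert zero_smul ℂ _ using 2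
      rw [eps_swap_of_even (v := w) (w := v) (by rw [ip_comm, c0]; decide),
        eps_swap_of_odd (v := u) (w := v) (by rw [a1]; decide)]
      ring
    · rw [if_neg (by omega), if_neg (by omega)]
      simp
  · rw [if_neg b1, if_neg c1, if_pos a1, if_neg (by omega), if_neg (by omega)]
    simp
  · rw [if_pos b1, if_neg (show ¬ ip u v + ip w u = -2 by omega), if_neg a1, if_pos c1,
      if_neg (show ¬ ip v w + ip u v = -2 by omega)]
    by_cases c0 : ip u v = 0
    · rw [if_pos (by omega), if_pos (by omega), add_zero, ← add_smul]
      convert zero_smul ℂ _ using 2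
      rw [eps_swap_of_even (v := v) (w := u) (by rw [ip_comm, c0]; decide),
        eps_swap_of_odd (v := w) (w := u) (by rw [c1]; decide)]
      ring
    · rw [if_neg (by omega), if_neg (by omega)]
      simp
  · rw [if_pos b1, if_neg c1, if_neg a1, if_neg (by omega), if_neg (by omega)]
    simp
  · rw [if_neg b1, if_pos c1, if_neg a1, if_neg (by omega), if_neg (by omega)]
    simp
  · rw [if_neg b1, if_neg c1, if_neg a1]
    simp

theorem jac_induction (y z : Model) (h1 : ∀ i, jac (H i) y z = 0)
    (h2 : ∀ v, IsRoot v → jac (E v) y z = 0) (x : Model) : jac x y z = 0 := by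
  induction x using model_induction with
  | hH i => exact h1 i
  | hE v hv => exact h2 v hv
  | h0 => simp [jac]
  | ha x x' h h' =>
    have : jac (x + x') y z = jac x y z + jac x' y z := by
      simp only [jac, map_add, LinearMap.add_apply]; abel
    rw [this, h, h', add_zero]
  | hs c x h =>
    have : jac (c • x) y z = c • jac x y z := by
      simp only [jac, map_smul, LinearMap.smul_apply, smul_add]
    rw [this, h, smul_zero]

theorem jac_H_H (i j : Fin 8) (z : Model) : jac z (H i) (H j) = 0 :=
  jac_induction _ _ (fun k => by simp [jac, br_H_H])
    (fun v _ => by rw [jac_rot]; exact jac_H_H_E i j v) z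

theorem jac_H_E (i : Fin 8) {v : Lat} (hv : IsRoot v) (z : Model) : jac z (H i) (E v) = 0 :=
  jac_induction _ _ (fun k => jac_H_H_E k i v)
    (fun w hw => by rw [jac_rot]; exact jac_H_E_E i hv hw) z

theorem jac_H (i : Fin 8) (y z : Model) : jac y z (H i) = 0 :=
  jac_induction _ _ (fun k => by rw [jac_rot]; exact jac_H_H i k z)
    (fun v hv => by rw [jac_rot]; exact jac_H_E i hv z) y

theorem jac_E {v : Lat} (hv : IsRoot v) (y z : Model) : jac y z (E v) = 0 :=
  jac_induction _ _ (fun k => by rw [jac_rot]; exact jac_H k z _)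
    (fun w hw => by
      rw [jac_rot]
      exact jac_induction _ _ (fun k => by rw [jac_rot]; exact jac_H k _ _)
        (fun u hu => jac_E_E_E hu hv hw) z) y

theorem jac_eq_zero (x y z : Model) : jac x y z = 0 :=
  jac_induction _ _ (fun i => by rw [jac_rot]; exact jac_H i y z)
    (fun v hv => by rw [jac_rot]; exact jac_E hv y z) x

theorem br_self (x : Model) : br x x = 0 := by
  have h : (2 : ℂ) • br x x = 0 := by
    rw [two_smul]
    nth_rewrite 1 [br_skew x x]
    exact neg_add_cancel _
  exact (smul_eq_zero.1 h).resolve_left two_ne_zero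

noncomputable instance : Bracket Model Model := ⟨fun x y => br x y⟩

theorem lie_def (x y : Model) : ⁅x, y⁆ = br x y := rfl

noncomputable instance : LieRing Model where
  add_lie x y z := by simp [lie_def]
  lie_add x y z := by simp [lie_def]
  lie_self x := br_self x
  leibniz_lie x y z := by
    have h := jac_eq_zero x y z
    simp only [jac] at h
    simp only [lie_def]
    rw [br_skew z x, map_neg, br_skew z] at h
    rw [← sub_eq_zero, ← h]
    abel

noncomputable instance : LieAlgebra ℂ Model where
  lie_smul c x y := by simp [lie_def]

theorem lie_H_H (i j : Fin 8) : ⁅H i, H j⁆ = 0 := br_H_H i j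

theorem lie_H_E (i : Fin 8) (v : Lat) : ⁅H i, E v⁆ = (ip (Pi.single i 1) v : ℂ) • E v := br_H_E i v

theorem lie_coroot_E (u v : Lat) : ⁅coroot u, E v⁆ = (ip u v : ℂ) • E v := br_coroot_E u v

theorem lie_E_E {v w : Lat} (hv : IsRoot v) (hw : IsRoot w) : ⁅E v, E w⁆ =
    if ip v w = -1 then eps v w • E (v + w) else if ip v w = -2 then -coroot v else 0 :=
  br_E_E hv hw

end E8

namespace E8

/-- Elements of a Lie algebra generating it and satisfying the Serre relations of type `E₈`. -/
structure IsSerre {g : Type*} [LieRing g] [LieAlgebra ℂ g] (h e f : Fin 8 → g) : Prop where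
  hh : ∀ i j, ⁅h i, h j⁆ = 0
  ef : ∀ i, ⁅e i, f i⁆ = h i
  ef_ne : ∀ i j, i ≠ j → ⁅e i, f j⁆ = 0
  he : ∀ i j, ⁅h i, e j⁆ = (CartanMatrix.E₈ i j : ℂ) • e j
  hf : ∀ i j, ⁅h i, f j⁆ = -(CartanMatrix.E₈ i j : ℂ) • f j
  adE : ∀ i j, ∃ n, (LieAlgebra.ad ℂ g (e i) ^ n) (e j) = 0
  adF : ∀ i j, ∃ n, (LieAlgebra.ad ℂ g (f i) ^ n) (f j) = 0
  gen : ∀ S : LieSubalgebra ℂ g, (∀ i, h i ∈ S) → (∀ i, e i ∈ S) → (∀ i, f i ∈ S) → S = ⊤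

/-- Words in the `eᵢ` applied to some `hⱼ`, with their degrees. -/
inductive IsWord {g : Type*} [LieRing g] (h e : Fin 8 → g) : Lat → g → Prop
  | base (i : Fin 8) : IsWord h e 0 (h i)
  | step {v : Lat} {x : g} (i : Fin 8) : IsWord h e v x → IsWord h e (v + Pi.single i 1) ⁅e i, x⁆

section
variable {g : Type*} [LieRing g] [LieAlgebra ℂ g] {h e f : Fin 8 → g}

theorem E₈_diag (i : Fin 8) : CartanMatrix.E₈ i i = 2 := by decide +revert

theorem IsSerre.symm (s : IsSerre h e f) : IsSerre (-h) f e where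
  hh i j := by simp [s.hh]
  ef i := by rw [← lie_skew, s.ef]; rfl
  ef_ne i j hij := by rw [← lie_skew, s.ef_ne j i hij.symm, neg_zero]
  he i j := by simp [s.hf]
  hf i j := by simp [s.he]
  adE := s.adF
  adF := s.adE
  gen S h1 h2 h3 := s.gen S (fun i => by simpa using h1 i) h3 h2

/-- The homogeneous components of the Borel subalgebra. -/
def wordSpan (h e : Fin 8 → g) (v : Lat) : Submodule ℂ g := Submodule.span ℂ {x | IsWord h e v x}

omit [LieAlgebra ℂ g] in
theorem IsWord.nonneg {v : Lat} {x : g} (w : IsWord h e v x) (i : Fin 8) : 0 ≤ v i := by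
  induction w with
  | base => simp
  | step j w ih =>
    have : (0 : ℤ) ≤ (Pi.single j 1 : Lat) i := by by_cases hj : i = j <;> simp [hj]
    simpa using add_nonneg ih this

omit [LieAlgebra ℂ g] in
theorem IsWord.zero {v : Lat} {x : g} (w : IsWord h e v x) (hv : v = 0) : ∃ i, x = h i := by
  cases w with
  | base i => exact ⟨i, rfl⟩
  | step j w =>
    have h1 := w.nonneg j
    have h2 := congrFun hv j
    simp at h2
    omega

theorem IsWord.lie_h (s : IsSerre h e f) {v : Lat} {x : g} (w : IsWord h e v x) (i : Fin 8) :
    ⁅h i, x⁆ = (ip (Pi.single i 1) v : ℂ) • x := by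
  induction w with
  | base j => simp [s.hh, ip]
  | step j w ih =>
    rw [leibniz_lie, ih, s.he, ip_add_right, ip_single_single]
    simp only [smul_lie, lie_smul, ← add_smul]
    push_cast
    rw [add_comm]

theorem eq_zero_of_mem_wordSpan_of_neg {v : Lat} {i : Fin 8} (hi : v i < 0) {x : g}
    (hx : x ∈ wordSpan h e v) : x = 0 := by
  have : {x | IsWord h e v x} = ∅ := by
    ext y
    simp only [Set.mem_ofPred_eq, Set.mem_empty_iff_false, iff_false]
    exact fun hy => absurd (hy.nonneg i) (by omega)
  rw [wordSpan, this] at hx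
  simpa using hx

theorem wordSpan_zero_le : wordSpan h e 0 ≤ Submodule.span ℂ (Set.range h) := by
  refine Submodule.span_le.mpr ?_
  rintro y hy
  obtain ⟨i, rfl⟩ := IsWord.zero hy rfl
  exact Submodule.subset_span ⟨i, rfl⟩

theorem lie_h_wordSpan (s : IsSerre h e f) {v : Lat} {x : g} (w : x ∈ wordSpan h e v) (i : Fin 8) :
    ⁅h i, x⁆ = (ip (Pi.single i 1) v : ℂ) • x := by
  induction w using Submodule.span_induction with
  | mem x hx => exact IsWord.lie_h s hx i
  | zero => simp
  | add x y _ _ h1 h2 => simp [h1, h2]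
  | smul c x _ h1 => simp [h1, smul_comm c]

theorem lie_e_wordSpan {v : Lat} {x : g} (w : x ∈ wordSpan h e v) (i : Fin 8) :
    ⁅e i, x⁆ ∈ wordSpan h e (v + Pi.single i 1) := by
  induction w using Submodule.span_induction with
  | mem x hx => exact Submodule.subset_span (IsWord.step i hx)
  | zero => simp
  | add x y _ _ h1 h2 => rw [lie_add]; exact add_mem h1 h2
  | smul c x _ h1 => rw [lie_smul]; exact Submodule.smul_mem _ _ h1

theorem IsWord.lie_f (s : IsSerre h e f) {v : Lat} {x : g} (w : IsWord h e v x) (i k : Fin 8) :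
    ⁅f i, ⁅e k, x⁆⁆ ∈ wordSpan h e (v + Pi.single k 1 - Pi.single i 1) := by
  have hfe : ∀ i k, ⁅f i, e k⁆ = if i = k then - h i else 0 := by
    intro i k
    rw [← lie_skew]
    split_ifs with hik
    · rw [← hik, s.ef]
    · rw [s.ef_ne _ _ (Ne.symm hik), neg_zero]
  induction w generalizing k with
  | base j =>
    rw [show ⁅e k, h j⁆ = -((CartanMatrix.E₈ j k : ℂ) • e k) by rw [← s.he, lie_skew]]
    simp only [lie_neg, lie_smul, hfe]
    split_ifs with hik
    · subst hik
      simp only [zero_add, sub_self]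
      exact neg_mem (Submodule.smul_mem _ _ (neg_mem (Submodule.subset_span (.base i))))
    · simp
  | @step v x m w ih =>
    rw [leibniz_lie, hfe]
    refine add_mem ?_ ?_
    · split_ifs with hik
      · subst hik
        rw [neg_lie, IsWord.lie_h s (w.step m)]
        simp only [add_sub_cancel_right]
        exact neg_mem (Submodule.smul_mem _ _ (Submodule.subset_span (w.step m)))
      · simp
    · have := lie_e_wordSpan (ih m) k
      rwa [sub_add_eq_add_sub] at this

theorem lie_f_wordSpan (s : IsSerre h e f) {v : Lat} (hv : v ≠ 0) {x : g} (w : x ∈ wordSpan h e v)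
    (i : Fin 8) : ⁅f i, x⁆ ∈ wordSpan h e (v - Pi.single i 1) := by
  induction w using Submodule.span_induction with
  | mem x hx =>
    cases hx with
    | base j => exact absurd rfl hv
    | step k w => exact w.lie_f s i k
  | zero => simp
  | add x y _ _ h1 h2 => rw [lie_add]; exact add_mem h1 h2
  | smul c x _ h1 => rw [lie_smul]; exact Submodule.smul_mem _ _ h1

theorem IsSerre.engel_eq_top (s : IsSerre h e f) (i : Fin 8) : LieSubalgebra.engel ℂ (e i) = ⊤ := by
  refine s.gen _ (fun j => ?_) (fun j => ?_) (fun j => ?_) <;> rw [LieSubalgebra.mem_engel_iff]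
  · refine ⟨2, ?_⟩
    have : ⁅e i, h j⁆ = -((CartanMatrix.E₈ j i : ℂ) • e i) := by rw [← s.he, lie_skew]
    simp [pow_two, this]
  · exact s.adE i j
  · by_cases hij : i = j
    · subst hij
      refine ⟨3, ?_⟩
      have : ⁅e i, h i⁆ = -((CartanMatrix.E₈ i i : ℂ) • e i) := by rw [← s.he, lie_skew]
      simp [pow_succ, s.ef, this]
    · exact ⟨1, by simpa using s.ef_ne i j hij⟩

theorem IsSerre.isSl2Triple (s : IsSerre h e f) (i : Fin 8) (hi : h i ≠ 0) :
    IsSl2Triple (h i) (e i) (f i) where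
  h_ne_zero := hi
  lie_e_f := s.ef i
  lie_h_e_nsmul := by rw [s.he, E₈_diag]; simp [← Nat.cast_smul_eq_nsmul ℂ]
  lie_h_f_nsmul := by rw [s.hf, E₈_diag]; simp [← Nat.cast_smul_eq_nsmul ℂ]

theorem IsSerre.eq_zero_of_mem (s : IsSerre h e f) (K : LieIdeal ℂ g) (hh : ∀ i, h i ≠ 0)
    (hK : ∀ x ∈ K, x ∈ Submodule.span ℂ (Set.range h) → x = 0) (n : ℕ) :
    ∀ v : Lat, ∑ i, v i = n → ∀ x ∈ K, x ∈ wordSpan h e v → x = 0 := by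
  induction n with
  | zero =>
    intro v hv x hx hxv
    by_cases hnn : ∀ i, 0 ≤ v i
    · have hv0 : v = 0 := by
        funext i
        exact (Finset.sum_eq_zero_iff_of_nonneg fun i _ => hnn i).mp hv i (Finset.mem_univ i)
      subst hv0
      exact hK x hx (wordSpan_zero_le hxv)
    · push Not at hnn
      obtain ⟨i, hi⟩ := hnn
      exact eq_zero_of_mem_wordSpan_of_neg hi hxv
  | succ n ih =>
    intro v hv x hx hxv
    by_cases hnn : ∀ i, 0 ≤ v i
    · have hv0 : v ≠ 0 := by
        rintro rfl
        simp at hv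
        omega
      have hf : ∀ i, ⁅f i, x⁆ = 0 := fun i =>
        ih (v - Pi.single i 1) (by simp [hv]) _ (lie_mem_right ℂ g K _ _ hx)
          (lie_f_wordSpan s hv0 hxv i)
      obtain ⟨i, hi⟩ : ∃ i, 0 < ip (Pi.single i 1) v := by
        by_contra! hcon
        have h1 := ip_eq_sum v v
        have h2 : ip v v ≤ 0 := by
          rw [h1]
          refine Finset.sum_nonpos fun i _ => ?_
          rw [ip_comm]
          exact mul_nonpos_of_nonneg_of_nonpos (hnn i) (hcon i)
        exact hv0 (eq_zero_of_ip_self v (le_antisymm h2 (ip_self_nonneg v)))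
      by_contra hx0
      have t := (s.isSl2Triple i (hh i)).symm
      have P : t.HasPrimitiveVectorWith x (-(ip (Pi.single i 1) v : ℂ)) := 
        ⟨hx0, by rw [neg_lie, lie_h_wordSpan s hxv, neg_smul], hf i⟩
      have key : ∀ k : ℕ, (LieModule.toEnd ℂ g g (e i) ^ k) x ≠ 0 := by
        intro k
        induction k with
        | zero => simpa using hx0
        | succ k ihk =>
          intro h0
          have := P.lie_e_pow_succ_toEnd_f k
          rw [h0, lie_zero] at this
          have h2 := (smul_eq_zero.mp this.symm).resolve_right ihk
          have h3 : ((k + 1 : ℤ) * (-(ip (Pi.single i 1) v) - k : ℤ) : ℂ) = 0 := by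
            push_cast; exact h2
          norm_cast at h3
          rcases mul_eq_zero.mp h3 with h4 | h4 <;> omega
      have hx' : x ∈ LieSubalgebra.engel ℂ (e i) := by rw [s.engel_eq_top]; trivial
      obtain ⟨k, hk⟩ := (LieSubalgebra.mem_engel_iff ..).mp hx'
      exact key k hk
    · push Not at hnn
      obtain ⟨i, hi⟩ := hnn
      exact eq_zero_of_mem_wordSpan_of_neg hi hxv

/-- The component of degree `v`. -/
def component (h e f : Fin 8 → g) (v : Lat) : Submodule ℂ g :=
  wordSpan h e v ⊔ wordSpan (-h) f (-v)

theorem lie_h_component (s : IsSerre h e f) {v : Lat} {x : g} (hx : x ∈ component h e f v)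
    (i : Fin 8) : ⁅h i, x⁆ = (ip (Pi.single i 1) v : ℂ) • x := by
  obtain ⟨y, hy, z, hz, rfl⟩ := Submodule.mem_sup.mp hx
  have h2 := lie_h_wordSpan s.symm hz i
  rw [Pi.neg_apply, neg_lie, ip_neg_right, neg_eq_iff_eq_neg] at h2
  rw [lie_add, lie_h_wordSpan s hy, h2]
  simp

theorem IsSerre.eq_zero_of_mem_component (s : IsSerre h e f) (K : LieIdeal ℂ g)
    (hh : ∀ i, h i ≠ 0) (hK : ∀ x ∈ K, x ∈ Submodule.span ℂ (Set.range h) → x = 0) (v : Lat) (x : g)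
    (hx : x ∈ K) (hxv : x ∈ component h e f v) : x = 0 := by
  have hr : Submodule.span ℂ (Set.range (-h)) ≤ Submodule.span ℂ (Set.range h) := by
    refine Submodule.span_le.mpr ?_
    rintro _ ⟨i, rfl⟩
    exact neg_mem (Submodule.subset_span ⟨i, rfl⟩)
  obtain ⟨y, hy, z, hz, rfl⟩ := Submodule.mem_sup.mp hxv
  by_cases hv : v = 0
  · subst hv
    rw [neg_zero] at hz
    exact hK _ hx (add_mem (wordSpan_zero_le hy) (hr (wordSpan_zero_le hz)))
  · by_cases h1 : ∀ i, 0 ≤ v i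
    · obtain ⟨i, hi⟩ : ∃ i, v i ≠ 0 := by
        by_contra! h2
        exact hv (funext h2)
      have hz0 : z = 0 := eq_zero_of_mem_wordSpan_of_neg (i := i)
        (by have := h1 i; simp only [Pi.neg_apply]; omega) hz
      subst hz0
      rw [add_zero] at hx ⊢
      exact s.eq_zero_of_mem K hh hK (∑ i, v i).toNat v
        (Int.toNat_of_nonneg (Finset.sum_nonneg fun i _ => h1 i)).symm y hx hy
    · push Not at h1
      obtain ⟨i, hi⟩ := h1
      have hy0 : y = 0 := eq_zero_of_mem_wordSpan_of_neg hi hy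
      subst hy0
      rw [zero_add] at hx ⊢
      by_cases h2 : ∀ i, 0 ≤ (-v) i
      · exact s.symm.eq_zero_of_mem K (fun i => neg_ne_zero.mpr (hh i))
          (fun x hx hx2 => hK x hx (hr hx2)) (∑ i, (-v) i).toNat (-v)
          (Int.toNat_of_nonneg (Finset.sum_nonneg fun i _ => h2 i)).symm z hx hz
      · push Not at h2
        obtain ⟨j, hj⟩ := h2
        exact eq_zero_of_mem_wordSpan_of_neg hj hz

theorem wordSpan_le_iSup (v : Lat) : wordSpan h e v ≤ ⨆ v, component h e f v :=
  le_sup_left.trans (le_iSup (component h e f) v)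

theorem wordSpan_le_iSup' (v : Lat) : wordSpan (-h) f v ≤ ⨆ v, component h e f v := by
  refine le_trans ?_ (le_iSup (component h e f) (-v))
  rw [component, neg_neg]
  exact le_sup_right

theorem IsSerre.h_mem (i : Fin 8) : h i ∈ ⨆ v, component h e f v :=
  wordSpan_le_iSup 0 (Submodule.subset_span (.base i))

theorem IsSerre.e_mem (s : IsSerre h e f) (i : Fin 8) : e i ∈ ⨆ v, component h e f v := by
  have h1 := lie_e_wordSpan (Submodule.subset_span (.base i) : h i ∈ wordSpan h e 0) i
  rw [← lie_skew, s.he, E₈_diag, ← neg_smul] at h1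
  refine wordSpan_le_iSup _ ((Submodule.smul_mem_iff _ ?_).mp h1)
  norm_num

theorem IsSerre.f_mem (s : IsSerre h e f) (i : Fin 8) : f i ∈ ⨆ v, component h e f v := by
  have h1 := lie_e_wordSpan (Submodule.subset_span (.base i) : (-h) i ∈ wordSpan (-h) f 0) i
  rw [← lie_skew, s.symm.he, E₈_diag, ← neg_smul] at h1
  refine wordSpan_le_iSup' _ ((Submodule.smul_mem_iff _ ?_).mp h1)
  norm_num

theorem IsSerre.lie_e_mem (s : IsSerre h e f) (i : Fin 8) {x : g}
    (hx : x ∈ ⨆ v, component h e f v) : ⁅e i, x⁆ ∈ ⨆ v, component h e f v := by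
  induction hx using Submodule.iSup_induction' with
  | mem v x hx =>
    obtain ⟨y, hy, z, hz, rfl⟩ := Submodule.mem_sup.mp hx
    rw [lie_add]
    refine add_mem (wordSpan_le_iSup _ (lie_e_wordSpan hy i)) ?_
    by_cases hv : v = 0
    · subst hv
      rw [neg_zero] at hz
      have hz' := wordSpan_zero_le hz
      clear hz hx
      induction hz' using Submodule.span_induction with
      | mem x hx =>
        obtain ⟨j, rfl⟩ := hx
        rw [← lie_skew, s.symm.hf, neg_smul, neg_neg]
        exact Submodule.smul_mem _ _ (s.e_mem i)
      | zero => simp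
      | add x y _ _ h1 h2 => rw [lie_add]; exact add_mem h1 h2
      | smul c x _ h1 => rw [lie_smul]; exact Submodule.smul_mem _ _ h1
    · exact wordSpan_le_iSup' _ (lie_f_wordSpan s.symm (neg_ne_zero.mpr hv) hz i)
  | zero => simp
  | add x y _ _ h1 h2 => rw [lie_add]; exact add_mem h1 h2

theorem IsSerre.iSup_eq_top (s : IsSerre h e f) : ⨆ v, component h e f v = ⊤ := by
  have hsymm : ⨆ v, component (-h) f e v = ⨆ v, component h e f v := by
    apply le_antisymm <;> refine iSup_le fun v => ?_
    · refine sup_le (wordSpan_le_iSup' v) ?_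
      rw [neg_neg]
      exact wordSpan_le_iSup _
    · refine sup_le ?_ (wordSpan_le_iSup _)
      have := wordSpan_le_iSup' (h := -h) (e := f) (f := e) v
      rwa [neg_neg] at this
  let S : LieSubalgebra ℂ g :=
    { carrier := {x | ∀ y ∈ ⨆ v, component h e f v, ⁅x, y⁆ ∈ ⨆ v, component h e f v}
      add_mem' := fun ha hb y hy => by rw [add_lie]; exact add_mem (ha y hy) (hb y hy)
      zero_mem' := fun y _ => by simp
      smul_mem' := fun c x hx y hy => by rw [smul_lie]; exact Submodule.smul_mem _ _ (hx y hy)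
      lie_mem' := fun {a b} ha hb y hy => by
        rw [lie_lie]
        exact sub_mem (ha _ (hb y hy)) (hb _ (ha y hy)) }
  have he : ∀ i, e i ∈ S := fun i y hy => s.lie_e_mem i hy
  have hf : ∀ i, f i ∈ S := fun i y hy => by
    rw [← hsymm] at hy ⊢
    exact s.symm.lie_e_mem i hy
  have hS := s.gen S (fun i => by rw [← s.ef]; exact S.lie_mem (he i) (hf i)) he hf
  let T : LieSubalgebra ℂ g :=
    { (⨆ v, component h e f v : Submodule ℂ g) with
      lie_mem' := fun {a b} _ hb => by
        have : a ∈ S := by rw [hS]; trivial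
        exact this b hb }
  have hT : T = ⊤ := s.gen T IsSerre.h_mem s.e_mem s.f_mem
  rw [eq_top_iff]
  rintro x -
  have : x ∈ T := by rw [hT]; trivial
  exact this

end

/-- The degree of a basis vector. -/
def wt : Idx → Lat
  | .inl _ => 0
  | .inr r => r

theorem coord_br_H (i : Fin 8) (x : Model) (a : Idx) :
    bas.coord a (br (H i) x) = (ip (Pi.single i 1) (wt a) : ℂ) * bas.coord a x := by
  have : bas.coord a ∘ₗ (br (H i)) = (ip (Pi.single i 1) (wt a) : ℂ) • bas.coord a := by
    refine bas.ext fun b => ?_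
    rcases b with j | r
    · have h0 : br (H i) (bas (.inl j)) = 0 := br_H_H i j
      rw [LinearMap.comp_apply, h0, map_zero, LinearMap.smul_apply]
      rcases a with k | t
      · simp [wt, ip]
      · simp
    · rw [LinearMap.comp_apply, ← E_coe, br_H_E, map_smul, LinearMap.smul_apply, E_coe]
      by_cases hb : a = .inr r
      · subst hb; rfl
      · simp [Ne.symm hb]
  exact LinearMap.congr_fun this x

theorem IsSerre.injective {g : Type*} [LieRing g] [LieAlgebra ℂ g] {h e f : Fin 8 → g}
    (s : IsSerre h e f) (Φ : g →ₗ⁅ℂ⁆ Model) (hΦ : ∀ i, Φ (h i) = H i) : Function.Injective Φ := by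
  have hwt : ∀ v, ∀ x ∈ component h e f v, ∀ a, wt a ≠ v → bas.coord a (Φ x) = 0 := by
    intro v x hx a ha
    by_contra hne
    refine ha (sub_eq_zero.mp (eq_zero_of_ip_self _ ?_))
    rw [ip_eq_sum]
    refine Finset.sum_eq_zero fun i _ => mul_eq_zero_of_right _ ?_
    have h1 := congrArg (fun y => bas.coord a (Φ y)) (lie_h_component s hx i)
    simp only [LieHom.map_lie, hΦ, lie_def, map_smul] at h1
    rw [coord_br_H, smul_eq_mul] at h1
    have h2 := mul_right_cancel₀ hne h1
    rw [ip_sub_left, ip_comm, ip_comm v, sub_eq_zero]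
    exact_mod_cast h2
  have hh : ∀ i, h i ≠ 0 := fun i hi => by
    have := hΦ i
    rw [hi, map_zero] at this
    exact bas.ne_zero _ this.symm
  have hK : ∀ x ∈ Φ.ker, x ∈ Submodule.span ℂ (Set.range h) → x = 0 := by
    intro x hx hxs
    obtain ⟨c, rfl⟩ := (Submodule.mem_span_range_iff_exists_fun ℂ).mp hxs
    rw [LieHom.mem_ker, map_sum] at hx
    simp only [map_smul, hΦ] at hx
    have hli := (bas.linearIndependent.comp _ Sum.inl_injective)
    have := Fintype.linearIndependent_iff.mp hli c hx
    simp [this]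
  rw [injective_iff_map_eq_zero]
  intro x hx
  have hxt : x ∈ ⨆ v, component h e f v := by rw [s.iSup_eq_top]; trivial
  obtain ⟨u, hu, rfl⟩ := (Submodule.mem_iSup_iff_exists_finsupp _ _).mp hxt
  rw [Finsupp.sum]
  refine Finset.sum_eq_zero fun v hv => ?_
  refine s.eq_zero_of_mem_component Φ.ker hh hK v _ ?_ (hu v)
  rw [LieHom.mem_ker]
  refine bas.ext_elem fun a => ?_
  rw [map_zero, Finsupp.zero_apply, ← Module.Basis.coord_apply]
  by_cases ha : wt a = v
  · have h1 := congrArg (bas.coord a) hx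
    rw [Finsupp.sum, map_sum, map_sum, map_zero, Finset.sum_eq_single v] at h1
    · exact h1
    · exact fun w _ hw => hwt w _ (hu w) a (by rw [ha]; exact hw.symm)
    · exact fun h3 => absurd hv h3
  · exact hwt v _ (hu v) a ha

end E8

namespace E8

theorem eq_top_of_simple_mem (S : LieSubalgebra ℂ Model) (he : ∀ i, E (Pi.single i 1) ∈ S)
    (hf : ∀ i, E (-Pi.single i 1) ∈ S) : S = ⊤ := by
  have hE : ∀ v, IsRoot v → E v ∈ S := by
    refine root_induction (P := fun v => E v ∈ S) he hf (fun v i hv hi h => ?_)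
      (fun v i hv hi h => ?_)
    · have h1 := S.lie_mem h (he i)
      rw [lie_E_E hv (isRoot_single i), if_pos hi] at h1
      exact (Submodule.smul_mem_iff S.toSubmodule (eps_ne_zero _ _)).mp h1
    · have h1 := S.lie_mem h (hf i)
      rw [lie_E_E hv (isRoot_single i).neg, if_pos (by rw [ip_neg_right, hi]),
        ← sub_eq_add_neg] at h1
      exact (Submodule.smul_mem_iff S.toSubmodule (eps_ne_zero _ _)).mp h1
  rw [eq_top_iff]
  rintro x -
  induction x using model_induction with
  | hH i =>
    have h1 := S.lie_mem (he i) (hf i)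
    rw [lie_E_E (isRoot_single i) (isRoot_single i).neg, ip_neg_right, isRoot_single i,
      if_neg (by decide),
      if_pos rfl, coroot_single] at h1
    exact neg_mem_iff.mp h1
  | hE v hv => exact hE v hv
  | h0 => exact zero_mem _
  | ha x y h1 h2 => exact add_mem (h1) h2
  | hs c x h => exact S.smul_mem c h

open CartanMatrix in
/-- The quotient map presenting the Serre Lie algebra. -/
noncomputable def serreMk : FreeLieAlgebra ℂ (Generators (Fin 8)) →ₗ⁅ℂ⁆ LieAlgebra.e₈ ℂ where
  toFun x := (LieSubmodule.Quotient.mk x :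
    FreeLieAlgebra ℂ (Generators (Fin 8)) ⧸ Relations.toIdeal ℂ CartanMatrix.E₈)
  map_add' _ _ := rfl
  map_smul' _ _ := rfl
  map_lie' := rfl

open CartanMatrix

theorem serreMk_surjective : Function.Surjective serreMk :=
  LieSubmodule.Quotient.surjective_mk' (Relations.toIdeal ℂ CartanMatrix.E₈)

theorem serreMk_eq_zero {x : FreeLieAlgebra ℂ (Generators (Fin 8))} :
    serreMk x = 0 ↔ x ∈ Relations.toIdeal ℂ CartanMatrix.E₈ :=
  LieSubmodule.Quotient.mk_eq_zero' (N := Relations.toIdeal ℂ CartanMatrix.E₈)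

theorem serreMk_eq_zero_of_mem {x : FreeLieAlgebra ℂ (Generators (Fin 8))}
    (hx : x ∈ Relations.toSet ℂ CartanMatrix.E₈) : serreMk x = 0 :=
  serreMk_eq_zero.mpr (LieSubmodule.subset_lieSpan hx)

/-- The image of a generator in the Serre Lie algebra. -/
noncomputable def gen (a : Generators (Fin 8)) : LieAlgebra.e₈ ℂ := serreMk (FreeLieAlgebra.of ℂ a)

theorem map_ad_pow {L M : Type*} [LieRing L] [LieAlgebra ℂ L] [LieRing M] [LieAlgebra ℂ M]
    (φ : L →ₗ⁅ℂ⁆ M) (x y : L) (n : ℕ) :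
    φ ((LieAlgebra.ad ℂ L x ^ n) y) = (LieAlgebra.ad ℂ M (φ x) ^ n) (φ y) := by
  induction n generalizing y with
  | zero => simp
  | succ n ih => rw [pow_succ, pow_succ, Module.End.mul_apply, Module.End.mul_apply, ih]; simp

theorem isSerre_gen :
    IsSerre (fun i => gen (.H i)) (fun i => gen (.E i)) (fun i => gen (.F i)) where
  hh i j := by
    have := serreMk_eq_zero_of_mem (x := Relations.HH ℂ (i, j)) (by simp [Relations.toSet])
    simpa [gen, Relations.HH] using this
  ef i := by
    have := serreMk_eq_zero_of_mem (x := Relations.EF ℂ (i, i)) (by simp [Relations.toSet])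
    simpa [gen, Relations.EF, sub_eq_zero] using this
  ef_ne i j hij := by
    have := serreMk_eq_zero_of_mem (x := Relations.EF ℂ (i, j)) (by simp [Relations.toSet])
    simpa [gen, Relations.EF, hij] using this
  he i j := by
    have := serreMk_eq_zero_of_mem (x := Relations.HE ℂ CartanMatrix.E₈ (i, j))
      (by simp [Relations.toSet])
    simpa [gen, Relations.HE, sub_eq_zero, ← Int.cast_smul_eq_zsmul ℂ] using this
  hf i j := by
    have := serreMk_eq_zero_of_mem (x := Relations.HF ℂ CartanMatrix.E₈ (i, j))
      (by simp [Relations.toSet])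
    rw [neg_smul, eq_neg_iff_add_eq_zero]
    simpa [gen, Relations.HF, ← Int.cast_smul_eq_zsmul ℂ] using this
  adE i j := by
    have := serreMk_eq_zero_of_mem (x := Relations.adE ℂ CartanMatrix.E₈ (i, j))
      (by simp [Relations.toSet])
    refine ⟨(-CartanMatrix.E₈ i j).toNat + 1, ?_⟩
    rw [pow_succ, Module.End.mul_apply]
    simpa [gen, Relations.adE, map_ad_pow] using this
  adF i j := by
    have := serreMk_eq_zero_of_mem (x := Relations.adF ℂ CartanMatrix.E₈ (i, j))
      (by simp [Relations.toSet])
    refine ⟨(-CartanMatrix.E₈ i j).toNat + 1, ?_⟩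
    rw [pow_succ, Module.End.mul_apply]
    simpa [gen, Relations.adF, map_ad_pow] using this
  gen S hh he hf := by
    have hS : ∀ a, gen a ∈ S := by
      rintro (i | i | i)
      exacts [hh i, he i, hf i]
    let ψ : FreeLieAlgebra ℂ (Generators (Fin 8)) →ₗ⁅ℂ⁆ S :=
      FreeLieAlgebra.lift ℂ fun a => ⟨gen a, hS a⟩
    have hψ : S.incl.comp ψ = serreMk := by
      refine FreeLieAlgebra.hom_ext fun a => ?_
      simp [ψ, gen]
    rw [eq_top_iff]
    rintro x -
    obtain ⟨y, rfl⟩ := serreMk_surjective x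
    rw [← hψ]
    exact (ψ y).2

/-- The images of the Serre generators in the model. -/
noncomputable def modelGen : Generators (Fin 8) → Model
  | .H i => H i
  | .E i => E (Pi.single i 1)
  | .F i => -E (-Pi.single i 1)

theorem lift_relation_eq_zero {x : FreeLieAlgebra ℂ (Generators (Fin 8))}
    (hx : x ∈ Relations.toSet ℂ CartanMatrix.E₈) : FreeLieAlgebra.lift ℂ modelGen x = 0 := by
  have hE :
      ∀ i j, CartanMatrix.E₈ i j = 2 ∨ CartanMatrix.E₈ i j = 0 ∨ CartanMatrix.E₈ i j = -1 := by
    intro i j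
    fin_cases i <;> fin_cases j <;> simp [CartanMatrix.E₈]
  have hne : ∀ i j, i ≠ j → CartanMatrix.E₈ i j ≠ 2 := by
    intro i j
    fin_cases i <;> fin_cases j <;> simp [CartanMatrix.E₈]
  rw [Relations.toSet] at hx
  rcases hx with
    ((((⟨⟨i, j⟩, rfl⟩ | ⟨⟨i, j⟩, rfl⟩) | ⟨⟨i, j⟩, rfl⟩) | ⟨⟨i, j⟩, rfl⟩) | ⟨⟨i, j⟩, rfl⟩) |
    ⟨⟨i, j⟩, rfl⟩
  · simp [Relations.HH, modelGen, lie_H_H]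
  · simp only [Relations.EF, Function.uncurry]
    by_cases hij : i = j
    · subst hij
      simp [modelGen, lie_E_E (isRoot_single i) (isRoot_single i).neg, ip_neg_right,
        ip_single_single, coroot_single]
    · have := hE i j
      have := hne i j hij
      rw [if_neg hij]
      simp [modelGen, lie_E_E (isRoot_single i) (isRoot_single j).neg, ip_neg_right,
        ip_single_single]
      rw [if_neg (by omega), if_neg (by omega)]
  · simp [Relations.HE, modelGen, lie_H_E, ip_single_single, ← Int.cast_smul_eq_zsmul ℂ]
  · simp [Relations.HF, modelGen, lie_H_E, ip_single_single, ip_neg_right,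
      ← Int.cast_smul_eq_zsmul ℂ]
  · simp only [Relations.adE, Function.uncurry, map_ad_pow]
    simp only [Function.comp_apply, LieHom.map_lie, FreeLieAlgebra.lift_of_apply, modelGen]
    rw [lie_E_E (isRoot_single i) (isRoot_single j), ip_single_single]
    rcases hE i j with h | h | h <;> simp only [h]
    · simp
    · simp
    · have hr := (isRoot_single i).add (isRoot_single j) (by rw [ip_single_single, h])
      rw [if_pos trivial, show (- -1 : ℤ).toNat = 1 from rfl, pow_one, LieAlgebra.ad_apply,
        lie_smul,
        lie_E_E (isRoot_single i) hr, ip_add_right, ip_single_single, ip_single_single, h, E₈_diag]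
      simp
  · simp only [Relations.adF, Function.uncurry, map_ad_pow]
    simp only [Function.comp_apply, LieHom.map_lie, FreeLieAlgebra.lift_of_apply, modelGen, neg_lie,
      lie_neg, neg_neg]
    rw [lie_E_E (isRoot_single i).neg (isRoot_single j).neg, ip_neg_right, ip_neg_left,
      ip_single_single]
    rcases hE i j with h | h | h <;> simp only [h]
    · simp
    · simp
    · have hr := (isRoot_single i).neg.add (isRoot_single j).neg
        (by rw [ip_neg_right, ip_neg_left, ip_single_single, h]; rfl)
      rw [if_pos (by norm_num), show (- -1 : ℤ).toNat = 1 from rfl, pow_one, map_neg,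
        LinearMap.neg_apply,
        LieAlgebra.ad_apply, lie_smul, lie_E_E (isRoot_single i).neg hr, ip_add_right,
        ip_neg_left, ip_neg_right, ip_neg_left,
        ip_neg_right, ip_single_single, ip_single_single, h, E₈_diag]
      simp

/-- The map from the Serre Lie algebra to the model. -/
noncomputable def toModel : LieAlgebra.e₈ ℂ →ₗ⁅ℂ⁆ Model :=
  have hker : Relations.toIdeal ℂ CartanMatrix.E₈ ≤ (FreeLieAlgebra.lift ℂ modelGen).ker :=
    LieSubmodule.lieSpan_le.mpr fun _ hx => lift_relation_eq_zero hx
  { (Submodule.liftQ (Relations.toIdeal ℂ CartanMatrix.E₈).toSubmodule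
      (FreeLieAlgebra.lift ℂ modelGen : FreeLieAlgebra ℂ (Generators (Fin 8)) →ₗ[ℂ] Model) hker :
        LieAlgebra.e₈ ℂ →ₗ[ℂ] Model) with
    map_lie' := by
      intro x y
      obtain ⟨x, rfl⟩ := serreMk_surjective x
      obtain ⟨y, rfl⟩ := serreMk_surjective y
      exact LieHom.map_lie (FreeLieAlgebra.lift ℂ modelGen) x y }

theorem toModel_gen (a : Generators (Fin 8)) : toModel (gen a) = modelGen a :=
  FreeLieAlgebra.lift_of_apply modelGen a

theorem toModel_bijective : Function.Bijective toModel := by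
  refine ⟨isSerre_gen.injective toModel fun i => toModel_gen _, ?_⟩
  have : toModel.range = ⊤ := eq_top_of_simple_mem _
    (fun i => ⟨gen (.E i), toModel_gen _⟩)
    (fun i => ⟨-gen (.F i), by simp [toModel_gen, modelGen]⟩)
  exact fun x => by simpa using (this ▸ LieSubalgebra.mem_top x : x ∈ toModel.range)

/-- The Serre Lie algebra of type `E₈` is isomorphic to the model. -/
noncomputable def equivModel : LieAlgebra.e₈ ℂ ≃ₗ⁅ℂ⁆ Model :=
    LieEquiv.ofBijective toModel toModel_bijective

end E8

namespace E8

/-- Operators satisfying the `sl₂`-relations. -/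
structure IsSl2Rep {V : Type*} [AddCommGroup V] [Module ℂ V] (h e f : Module.End ℂ V) : Prop where
  he : ∀ x, h (e x) = e (h x) + (2 : ℂ) • e x
  hf : ∀ x, h (f x) = f (h x) - (2 : ℂ) • f x
  ef : ∀ x, e (f x) = f (e x) + h x

namespace IsSl2Rep
variable {V : Type*} [AddCommGroup V] [Module ℂ V] {h e f : Module.End ℂ V}

theorem symm (s : IsSl2Rep h e f) : IsSl2Rep (-h) f e where
  he x := by simp [s.hf]; abel
  hf x := by simp [s.he]; abel
  ef x := by simp [s.ef]

theorem h_pow_e (s : IsSl2Rep h e f) (k : ℕ) (x : V) :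
    h ((e ^ k) x) = (e ^ k) (h x) + (2 * k : ℂ) • (e ^ k) x := by
  induction k generalizing x with
  | zero => simp
  | succ k ih =>
    rw [pow_succ, Module.End.mul_apply, ih, s.he, map_add, map_smul]
    simp only [Module.End.mul_apply]
    push_cast
    module

theorem h_pow_f (s : IsSl2Rep h e f) (k : ℕ) (x : V) :
    h ((f ^ k) x) = (f ^ k) (h x) - (2 * k : ℂ) • (f ^ k) x := by
  have := s.symm.h_pow_e k x
  simp only [LinearMap.neg_apply, map_neg] at this
  rw [neg_eq_iff_eq_neg] at this
  rw [this]
  abel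

theorem e_h_eq_zero (s : IsSl2Rep h e f) {x : V} (hx : e x = 0) : e (h x) = 0 := by
  have := s.he x
  rw [hx] at this
  simpa using this.symm

theorem e_pow_f_succ (s : IsSl2Rep h e f) {x : V} (hx : e x = 0) (k : ℕ) :
    e ((f ^ (k + 1)) x) = (k + 1 : ℂ) • (f ^ k) (h x - (k : ℂ) • x) := by
  induction k with
  | zero => simp [s.ef, hx]
  | succ k ih =>
    rw [pow_succ', Module.End.mul_apply, s.ef, ih, s.h_pow_f, map_smul, ← Module.End.mul_apply,
      ← pow_succ', map_sub, map_sub, map_smul, map_smul]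
    push_cast
    module

variable [FiniteDimensional ℂ V]

theorem isNilpotent (s : IsSl2Rep h e f) : IsNilpotent e := by
  by_contra hn
  have hn : ∀ k : ℕ, e ^ k ≠ 0 := fun k hk => hn ⟨k, hk⟩
  let D : Module.End ℂ (Module.End ℂ V) := LinearMap.mulLeft ℂ h - LinearMap.mulRight ℂ h
  have hD : ∀ k : ℕ, D.HasEigenvalue (2 * k : ℂ) := by
    intro k
    refine Module.End.hasEigenvalue_of_hasEigenvector (x := e ^ k)
      ⟨Module.End.mem_eigenspace_iff.mpr ?_, hn k⟩
    refine LinearMap.ext fun x => ?_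
    simp [D, s.h_pow_e]
  have hfin : Set.Finite {μ | D.HasEigenvalue μ} := Module.End.finite_hasEigenvalue D
  refine Set.infinite_of_injective_forall_mem (f := fun k : ℕ => (2 * k : ℂ)) ?_ hD hfin
  intro a b hab
  simpa using hab

theorem exists_e_pow_eq_zero (s : IsSl2Rep h e f) : ∃ k, e ^ k = 0 := s.isNilpotent

theorem exists_f_pow_eq_zero (s : IsSl2Rep h e f) : ∃ k, f ^ k = 0 := s.symm.isNilpotent

omit [FiniteDimensional ℂ V] in
theorem mem_maxGen_of_eq {μ : ℂ} {x : V} (hx : h x = μ • x) : x ∈ h.maxGenEigenspace μ :=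
  Module.End.mem_maxGenEigenspace .. |>.mpr ⟨1, by simp [hx]⟩

omit [FiniteDimensional ℂ V] in
theorem sub_mem_maxGen {μ : ℂ} {x : V} (hx : x ∈ h.maxGenEigenspace μ) (c : ℂ) :
    h x - c • x ∈ h.maxGenEigenspace μ :=
  sub_mem (Module.End.mapsTo_maxGenEigenspace_of_comm rfl μ hx) (Submodule.smul_mem _ _ hx)

omit [FiniteDimensional ℂ V] in
theorem eq_zero_of_maxGen {μ c : ℂ} (hc : μ ≠ c) {x : V} (hx : x ∈ h.maxGenEigenspace μ)
    (h0 : h x - c • x = 0) : x = 0 := by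
  have h1 : x ∈ h.maxGenEigenspace c :=
    Module.End.mem_maxGenEigenspace .. |>.mpr ⟨1, by simpa using h0⟩
  have := (Module.End.independent_maxGenEigenspace h).pairwiseDisjoint hc
  exact Submodule.disjoint_def.mp this x hx h1

omit [FiniteDimensional ℂ V] in
theorem eq_zero_of_primitive (s : IsSl2Rep h e f) {μ : ℂ} (k : ℕ) (hμ : ∀ i < k, μ ≠ i) {x : V}
    (hx : x ∈ h.maxGenEigenspace μ) (hex : e x = 0) (hk : (f ^ k) x = 0) : x = 0 := by
  induction k generalizing x with
  | zero => simpa using hk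
  | succ k ih =>
    have h1 := s.e_pow_f_succ hex k
    rw [hk, map_zero] at h1
    have h2 := (smul_eq_zero.mp h1.symm).resolve_left (by norm_cast)
    exact eq_zero_of_maxGen (hμ k (Nat.lt_succ_self k)) hx
      (ih (fun i hi => hμ i (by omega)) (sub_mem_maxGen hx _)
        (by rw [map_sub, s.e_h_eq_zero hex, map_smul, hex]; simp) h2)

theorem eq_nat_of_primitive (s : IsSl2Rep h e f) {μ : ℂ} {x : V} (hx : x ∈ h.maxGenEigenspace μ)
    (hex : e x = 0) (hx0 : x ≠ 0) : ∃ n : ℕ, μ = n := by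
  obtain ⟨k, hk⟩ := s.exists_f_pow_eq_zero
  by_contra! hn
  exact hx0 (s.eq_zero_of_primitive k (fun i _ => hn i) hx hex (by simp [hk]))

theorem h_of_primitive (s : IsSl2Rep h e f) {μ : ℂ} {x : V} (hx : x ∈ h.maxGenEigenspace μ)
    (hex : e x = 0) : h x = μ • x := by
  obtain ⟨K, hK⟩ := s.exists_f_pow_eq_zero
  suffices H : ∀ k : ℕ, ∀ x ∈ h.maxGenEigenspace μ, e x = 0 → (f ^ k) x = 0 → h x = μ • x from
    H K x hx hex (by simp [hK])
  intro k
  induction k with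
  | zero => intro x _ _ hk; simp_all
  | succ k ih =>
    intro x hx hex hk
    have h1 := s.e_pow_f_succ hex k
    rw [hk, map_zero] at h1
    have h2 := (smul_eq_zero.mp h1.symm).resolve_left (by norm_cast)
    have h3 : ∀ c : ℂ, e (h x - c • x) = 0 := fun c => by
      rw [map_sub, s.e_h_eq_zero hex, map_smul, hex]; simp
    by_cases hμ : μ = k
    · subst hμ
      exact sub_eq_zero.mp (s.eq_zero_of_primitive k (fun i hi => by norm_cast; omega)
        (sub_mem_maxGen hx _) (h3 _) h2)
    · have h4 := ih _ (sub_mem_maxGen hx _) (h3 _) h2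
      refine sub_eq_zero.mp (eq_zero_of_maxGen hμ (sub_mem_maxGen hx μ) ?_)
      simp only [map_sub, map_smul] at h4 ⊢
      rw [sub_eq_iff_eq_add] at h4
      rw [h4]
      module

omit [FiniteDimensional ℂ V] in
theorem pos_of_ef_eq (s : IsSl2Rep h e f) (k : ℕ) : ∀ m : ℝ, 0 < m → ∀ y : V, y ≠ 0 →
    h y = (m : ℂ) • y → ∀ c : ℂ, e (f y) = c • y → (e ^ k) y = 0 → 0 < c.re := by
  induction k with
  | zero => intro m _ y hy _ c _ hk; simp_all
  | succ k ih =>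
    intro m hm y hy hh c hc hk
    have h1 : f (e y) = (c - m) • y := by
      have := s.ef y
      rw [hc, hh] at this
      rw [sub_smul, this]
      abel
    by_cases hey : e y = 0
    · rw [hey, map_zero] at h1
      rw [sub_eq_zero.mp ((smul_eq_zero.mp h1.symm).resolve_right hy)]
      simpa using hm
    · have := ih (m + 2) (by linarith) (e y) hey (by rw [s.he, hh, map_smul]; push_cast; module)
        (c - m) (by rw [h1, map_smul]) (by rwa [pow_succ, Module.End.mul_apply] at hk)
      simp at this
      linarith

theorem exists_ef_eq (s : IsSl2Rep h e f) {m : ℝ} (hm : 0 < m) {y : V} (hy : h y = (m : ℂ) • y) :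
    ∃ z, h z = (m : ℂ) • z ∧ e (f z) = y := by
  have hmap : ∀ y ∈ h.eigenspace (m : ℂ), (e * f) y ∈ h.eigenspace (m : ℂ) := by
    intro y hy
    rw [Module.End.mem_eigenspace_iff] at hy ⊢
    rw [Module.End.mul_apply, s.he, s.hf, hy]
    simp
  have hinj : Function.Injective ((e * f).restrict hmap) := by
    rw [injective_iff_map_eq_zero]
    rintro ⟨y, hy⟩ h0
    by_contra hne
    have hy0 : y ≠ 0 := fun h => hne (Subtype.ext h)
    obtain ⟨k, hk⟩ := s.exists_e_pow_eq_zero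
    have := s.pos_of_ef_eq k m hm y hy0 (Module.End.mem_eigenspace_iff.mp hy) 0
      (by rw [zero_smul]; exact congrArg Subtype.val h0) (by simp [hk])
    simp at this
  obtain ⟨⟨z, hz⟩, hzy⟩ := LinearMap.injective_iff_surjective.mp hinj
    ⟨y, Module.End.mem_eigenspace_iff.mpr hy⟩
  exact ⟨z, Module.End.mem_eigenspace_iff.mp hz, congrArg Subtype.val hzy⟩

omit [FiniteDimensional ℂ V] in
theorem e_mem_maxGen (s : IsSl2Rep h e f) {μ : ℂ} {x : V} (hx : x ∈ h.maxGenEigenspace μ) :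
    e x ∈ h.maxGenEigenspace (μ + 2) := by
  obtain ⟨k, hk⟩ := Module.End.mem_maxGenEigenspace .. |>.mp hx
  refine Module.End.mem_maxGenEigenspace .. |>.mpr ⟨k, ?_⟩
  have : ∀ k : ℕ, ∀ x, ((h - (μ + 2) • 1) ^ k) (e x) = e (((h - μ • 1) ^ k) x) := by
    intro k
    induction k with
    | zero => simp
    | succ k ih =>
      intro x
      rw [pow_succ, pow_succ, Module.End.mul_apply, Module.End.mul_apply, ← ih]
      congr 1
      simp [s.he]
      module
  rw [this, hk, map_zero]

theorem h_of_mem_maxGen (s : IsSl2Rep h e f) {μ : ℂ} {x : V} (hx : x ∈ h.maxGenEigenspace μ) :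
    h x = μ • x := by
  obtain ⟨K, hK⟩ := s.exists_e_pow_eq_zero
  suffices H : ∀ k : ℕ, ∀ μ : ℂ, ∀ x ∈ h.maxGenEigenspace μ, (e ^ k) x = 0 → h x = μ • x from
    H K μ x hx (by simp [hK])
  intro k
  induction k with
  | zero => intro μ x _ hk; simp_all
  | succ k ih =>
    intro μ x hx hk
    have h1 : h (e x) = (μ + 2) • e x :=
      ih (μ + 2) (e x) (s.e_mem_maxGen hx) (by rwa [pow_succ, Module.End.mul_apply] at hk)
    have h2 : e (h x - μ • x) = 0 := by
      rw [s.he] at h1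
      rw [map_sub, map_smul, sub_eq_zero]
      refine add_right_cancel (h1.trans ?_)
      module
    by_contra hne
    obtain ⟨n, rfl⟩ := s.eq_nat_of_primitive (sub_mem_maxGen hx μ) h2 (sub_ne_zero.mpr hne)
    have hpos : (0 : ℝ) < n + 2 := by positivity
    obtain ⟨z, hz, hzx⟩ := s.exists_ef_eq hpos (y := e x) (by rw [h1]; push_cast; rfl)
    have hfz : h (f z) = (n : ℂ) • f z := by
      rw [s.hf, hz, map_smul]; push_cast; module
    have h3 : h (x - f z) = (n : ℂ) • (x - f z) := by
      refine s.h_of_primitive (sub_mem hx ?_) (by rw [map_sub, hzx, sub_self])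
      exact mem_maxGen_of_eq hfz
    rw [map_sub, hfz, smul_sub] at h3
    exact hne (sub_left_injective h3)

theorem iSup_eigenspace (s : IsSl2Rep h e f) : ⨆ μ, h.eigenspace μ = ⊤ := by
  rw [eq_top_iff, ← Module.End.iSup_maxGenEigenspace_eq_top h]
  exact iSup_mono fun μ x hx => Module.End.mem_eigenspace_iff.mpr (s.h_of_mem_maxGen hx)

theorem eq_int_of_eigen (s : IsSl2Rep h e f) {μ : ℂ} {x : V} (hx0 : x ≠ 0) (hx : h x = μ • x) :
    ∃ n : ℤ, μ = n := by
  obtain ⟨K, hK⟩ := s.exists_e_pow_eq_zero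
  suffices H : ∀ k : ℕ, ∀ μ : ℂ, ∀ x, h x = μ • x → x ≠ 0 → (e ^ k) x = 0 → ∃ n : ℤ, μ = n from
    H K μ x hx hx0 (by simp [hK])
  intro k
  induction k with
  | zero => intro μ x _ hx0 hk; simp_all
  | succ k ih =>
    intro μ x hx hx0 hk
    by_cases hex : e x = 0
    · obtain ⟨n, hn⟩ := s.eq_nat_of_primitive
        (mem_maxGen_of_eq hx) hex hx0
      exact ⟨n, by simpa using hn⟩
    · obtain ⟨n, hn⟩ := ih (μ + 2) (e x) (by rw [s.he, hx, map_smul]; module) hex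
        (by rwa [pow_succ, Module.End.mul_apply] at hk)
      exact ⟨n - 2, by push_cast; rw [← hn]; ring⟩

/-- `e` is injective on the negative weight spaces. -/
theorem eq_zero_of_neg (s : IsSl2Rep h e f) {k : ℤ} (hk : k < 0) {x : V} (hx : h x = (k : ℂ) • x)
    (hex : e x = 0) : x = 0 := by
  by_contra hx0
  obtain ⟨n, hn⟩ := s.eq_nat_of_primitive
    (mem_maxGen_of_eq hx) hex hx0
  have : k = (n : ℤ) := by exact_mod_cast hn
  omega

/-- `e` maps onto the positive weight spaces. -/
theorem exists_e_eq (s : IsSl2Rep h e f) {k : ℤ} (hk : 0 < k) {x : V} (hx : h x = (k : ℂ) • x) :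
    ∃ y, h y = ((k - 2 : ℤ) : ℂ) • y ∧ e y = x := by
  obtain ⟨z, hz, hzx⟩ := s.exists_ef_eq (m := k) (by exact_mod_cast hk) (by simpa using hx)
  refine ⟨f z, ?_, hzx⟩
  rw [s.hf, hz, map_smul]
  push_cast
  module

theorem f_eq_zero_of_weight_zero (s : IsSl2Rep h e f) {x : V} (hx : h x = 0) (hex : e x = 0) :
    f x = 0 := by
  refine s.eq_zero_of_neg (k := -2) (by norm_num) ?_ ?_
  · rw [s.hf, hx]; simp
  · rw [s.ef, hex, hx]; simp

end IsSl2Rep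
end E8

namespace E8

open Filter Topology

/-- The adjoint representation, as a continuous map. -/
noncomputable def adC : Model →L[ℂ] Model →L[ℂ] Model :=
  LinearMap.toContinuousLinearMap
    ((LinearMap.toContinuousLinearMap : (Model →ₗ[ℂ] Model) ≃ₗ[ℂ] _).toLinearMap ∘ₗ br)

theorem adC_apply (x y : Model) : adC x y = ⁅x, y⁆ := rfl

/-- The exponential of an endomorphism. -/
noncomputable def expC (D : Model →L[ℂ] Model) : Model →L[ℂ] Model := NormedSpace.exp D

theorem expC_zero : expC 0 = 1 := NormedSpace.exp_zero

theorem expC_neg_apply_expC (D : Model →L[ℂ] Model) (x : Model) : expC (-D) (expC D x) = x := by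
  let _ : NormedAlgebra ℚ (Model →L[ℂ] Model) := NormedAlgebra.restrictScalars ℚ ℂ _
  have : expC (-D) * expC D = 1 := by
    rw [expC, expC, ← NormedSpace.exp_add_of_commute (Commute.neg_left (Commute.refl D)),
      neg_add_cancel, NormedSpace.exp_zero]
  exact DFunLike.congr_fun this x

theorem hasDerivAt_expC_smul (D : Model →L[ℂ] Model) (t : ℂ) :
    HasDerivAt (fun t : ℂ => expC (t • D)) (D * expC (t • D)) t :=
  hasDerivAt_exp_smul_const' (𝕂 := ℂ) D t

theorem hasDerivAt_expC_smul' (D : Model →L[ℂ] Model) (t : ℂ) :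
    HasDerivAt (fun t : ℂ => expC (t • D)) (expC (t • D) * D) t :=
  hasDerivAt_exp_smul_const (𝕂 := ℂ) D t

theorem hasDerivAt_expC_smul_apply (D : Model →L[ℂ] Model) (x : Model) (t : ℂ) :
    HasDerivAt (fun t : ℂ => expC (t • D) x) (D (expC (t • D) x)) t := by
  have h := (hasDerivAt_expC_smul D t).clm_apply (hasDerivAt_const t x)
  simpa using h

theorem expC_adC_lie (z x y : Model) :
    expC (adC z) ⁅x, y⁆ = ⁅expC (adC z) x, expC (adC z) y⁆ := by
  set D := adC z with hD
  have hder : ∀ a b, D (adC a b) = adC (D a) b + adC a (D b) := fun a b => leibniz_lie z a b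
  let c : ℂ → Model := fun t => expC (t • (-D)) (adC (expC (t • D) x) (expC (t • D) y))
  have hc : ∀ t, HasDerivAt c 0 t := by
    intro t
    have h1 : HasDerivAt (fun t : ℂ => adC (expC (t • D) x) (expC (t • D) y))
        (adC (D (expC (t • D) x)) (expC (t • D) y) + adC (expC (t • D) x) (D (expC (t • D) y))) t :=
      (adC.hasFDerivAt.comp_hasDerivAt t (hasDerivAt_expC_smul_apply D x t)).clm_apply
        (hasDerivAt_expC_smul_apply D y t)
    have h2 := (hasDerivAt_expC_smul' (-D) t).clm_apply h1
    have h0 : (expC (t • -D) * -D) (adC (expC (t • D) x) (expC (t • D) y)) +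
        expC (t • -D) (adC (D (expC (t • D) x)) (expC (t • D) y) +
          adC (expC (t • D) x) (D (expC (t • D) y))) = 0 := by
      rw [← hder, mul_neg, neg_apply, mul_apply_eq_comp,
        neg_add_cancel]
    rw [h0] at h2
    exact h2
  have hconst : c 1 = c 0 :=
    is_const_of_deriv_eq_zero (fun t => (hc t).differentiableAt) (fun t => (hc t).deriv) 1 0
  simp only [c, one_smul, zero_smul, expC_zero] at hconst
  have h2 := congrArg (expC D) hconst
  have h3 := expC_neg_apply_expC (-D) (adC (expC D x) (expC D y))
  rw [neg_neg] at h3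
  rw [h3] at h2
  exact h2.symm

/-- The automorphism `exp (ad z)`. -/
noncomputable def expAd (z : Model) : Model ≃ₗ⁅ℂ⁆ Model where
  toFun := expC (adC z)
  invFun := expC (-adC z)
  map_add' := map_add _
  map_smul' := map_smul _
  map_lie' := expC_adC_lie z _ _
  left_inv := expC_neg_apply_expC _
  right_inv x := by
    have := expC_neg_apply_expC (-adC z) x
    rwa [neg_neg] at this

theorem expAd_apply (z x : Model) : expAd z x = expC (adC z) x := rfl

theorem expAd_mem {z : Model} {W : Submodule ℂ Model} (h : ∀ w ∈ W, ⁅z, w⁆ ∈ W) {w : Model}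
    (hw : w ∈ W) : expAd z w ∈ W := by
  let _ : NormedAlgebra ℚ (Model →L[ℂ] Model) := NormedAlgebra.restrictScalars ℚ ℂ _
  have h1 := (NormedSpace.exp_series_hasSum_exp' (𝕂 := ℂ) (adC z)).mapL
    (ContinuousLinearMap.apply ℂ Model w)
  refine (Submodule.closed_of_finiteDimensional W).mem_of_tendsto h1 (Eventually.of_forall ?_)
  intro s
  refine Submodule.sum_mem _ fun n _ => Submodule.smul_mem _ _ ?_
  clear * - hw h
  induction n with
  | zero => exact hw
  | succ n ih =>
    rw [pow_succ']
    exact h _ ih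

theorem expAd_of_lie_eq_zero {z w : Model} (h : ⁅z, w⁆ = 0) : expAd z w = w := by
  have hc : ∀ t, HasDerivAt (fun t : ℂ => expC (t • adC z) w) 0 t := by
    intro t
    have := (hasDerivAt_expC_smul' (adC z) t).clm_apply (hasDerivAt_const t w)
    simpa [adC_apply, h] using this
  have := is_const_of_deriv_eq_zero (fun t => (hc t).differentiableAt) (fun t => (hc t).deriv) 1 0
  simpa [expC_zero, expAd_apply] using this

theorem hasStrictFDerivAt_expC_zero : HasStrictFDerivAt expC
    (1 : (Model →L[ℂ] Model) →L[ℂ] (Model →L[ℂ] Model)) 0 :=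
  hasStrictFDerivAt_exp_zero (𝕂 := ℂ)

/-- The elements near `y` are conjugate to elements of `y + L` when `L` is transverse to the
orbit. -/
theorem eventually_exists_expAd {L Z W : Submodule ℂ Model}
    (hZ : ∀ z ∈ Z, ∀ w ∈ W, ⁅z, w⁆ ∈ W) (hLW : L ≤ W) {y : Model} (hy : y ∈ W)
    (h : ∀ w ∈ W, ∃ z ∈ Z, ∃ l ∈ L, w = l + ⁅z, y⁆) :
    ∀ᶠ x in 𝓝 y, x ∈ W → ∃ z ∈ Z, ∃ l ∈ L, expAd z (y + l) = x := by
  obtain ⟨C, hC⟩ := Submodule.exists_isCompl W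
  let Φ : Z × L × C → Model := fun p => expC (adC p.1) (y + p.2.1) + p.2.2
  let A : (Z × L × C) →L[ℂ] Model := Z.subtypeL ∘L ContinuousLinearMap.fst ℂ _ _
  let B : (Z × L × C) →L[ℂ] Model := L.subtypeL ∘L (ContinuousLinearMap.fst ℂ _ _ ∘L
    ContinuousLinearMap.snd ℂ _ _)
  let D : (Z × L × C) →L[ℂ] Model := C.subtypeL ∘L (ContinuousLinearMap.snd ℂ _ _ ∘L
    ContinuousLinearMap.snd ℂ _ _)
  let Φ' : (Z × L × C) →L[ℂ] Model := adC.flip y ∘L A + B + D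
  have hΦ : HasStrictFDerivAt Φ Φ' 0 := by
    have h1 : HasStrictFDerivAt (fun p : Z × L × C => expC (adC (A p)))
        ((1 : (Model →L[ℂ] Model) →L[ℂ] (Model →L[ℂ] Model)) ∘L (adC ∘L A)) 0 := by
      have h2 := hasStrictFDerivAt_expC_zero
      have h3 : (adC ∘L A) 0 = 0 := map_zero _
      rw [← h3] at h2
      exact h2.comp (0 : Z × L × C) (adC ∘L A).hasStrictFDerivAt
    have h4 := (h1.clm_apply (B.hasStrictFDerivAt.const_add y)).add D.hasStrictFDerivAt
    refine h4.congr_fderiv ?_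
    ext p
    · simp [Φ', A, B, D, expC_zero]
    · simp [Φ', A, B, D, expC_zero]
    · simp [Φ', A, B, D, expC_zero]
  have hs : Φ'.range = ⊤ := by
    rw [LinearMap.range_eq_top]
    intro x
    obtain ⟨w, hw, c, hc, rfl⟩ := Submodule.mem_sup.1
      (show x ∈ W ⊔ C by rw [hC.sup_eq_top]; trivial)
    obtain ⟨z, hz, l, hl, rfl⟩ := h w hw
    refine ⟨(⟨z, hz⟩, ⟨l, hl⟩, ⟨c, hc⟩), ?_⟩
    simp [Φ', A, B, D, adC_apply]
    abel
  have hm := hΦ.map_nhds_eq_of_surj hs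
  have h0 : Φ 0 = y := by simp [Φ, expC_zero]
  rw [h0] at hm
  rw [← hm, eventually_map]
  refine Eventually.of_forall ?_
  rintro ⟨⟨z, hz⟩, ⟨l, hl⟩, ⟨c, hc⟩⟩ hx
  refine ⟨z, hz, l, hl, ?_⟩
  have hx' : expAd z (y + l) + c ∈ W := hx
  have h5 := expAd_mem (hZ z hz) (W.add_mem hy (hLW hl))
  have h6 : c ∈ W := by simpa using W.sub_mem hx' h5
  have h7 : c = 0 := by simpa using hC.disjoint.le_bot ⟨h6, hc⟩
  simp [Φ, h7, expAd_apply]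

/-- A relation that is locally total on a subset of a complex vector space meeting lines in
co-countable sets is total. -/
theorem rel_of_locally {V : Type*} [NormedAddCommGroup V] [NormedSpace ℂ V] {S : Set V}
    {P : V → V → Prop} (symm : ∀ a b, P a b → P b a) (trans : ∀ a b c, P a b → P b c → P a c)
    (hloc : ∀ x ∈ S, ∀ᶠ y in 𝓝 x, y ∈ S → P x y) {a b : V} (ha : a ∈ S) (hb : b ∈ S)
    (hline : {s : ℂ | a + s • (b - a) ∉ S}.Countable) : P a b := by
  set T : Set ℂ := {s : ℂ | a + s • (b - a) ∉ S}ᶜ with hT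
  have hconn : IsPreconnected T :=
    (hline.isPathConnected_compl_of_one_lt_rank (by
      rw [Complex.rank_real_complex]; norm_num)).isConnected.isPreconnected
  have hmem : ∀ s, s ∈ T ↔ a + s • (b - a) ∈ S := fun s => by simp [hT]
  have h0 : (0 : ℂ) ∈ T := by rw [hmem]; simpa using ha
  have h1 : (1 : ℂ) ∈ T := by rw [hmem]; simpa using hb
  have key := hconn.induction₂ (fun s t => P (a + s • (b - a)) (a + t • (b - a))) ?_
    (fun x y z _ _ _ => trans _ _ _) (fun x y _ _ => symm _ _) h0 h1
  · simpa using key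
  · intro x hx
    have hcont : ContinuousAt (fun s : ℂ => a + s • (b - a)) x := by fun_prop
    have := hcont.eventually (hloc _ ((hmem x).1 hx))
    filter_upwards [mem_nhdsWithin_of_mem_nhds this, self_mem_nhdsWithin] with s hs hsT
    exact hs ((hmem s).1 hsT)

end E8

namespace E8

open Filter Topology

open LieAlgebra LieSubalgebra in
theorem mem_engel_equiv (φ : Model ≃ₗ⁅ℂ⁆ Model) (x z : Model) :
    φ z ∈ engel ℂ (φ x) ↔ z ∈ engel ℂ x := by
  have h : ∀ n : ℕ, ((ad ℂ Model (φ x)) ^ n) (φ z) = φ (((ad ℂ Model x) ^ n) z) := by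
    intro n
    induction n with
    | zero => rfl
    | succ n ih => rw [pow_succ', pow_succ', Module.End.mul_apply, ih, Module.End.mul_apply,
      ad_apply, ad_apply, LieEquiv.map_lie]
  simp only [mem_engel_iff, h, EmbeddingLike.map_eq_zero_iff]

open LieSubalgebra in
theorem finrank_engel_le {x x' : Model} (φ : Model ≃ₗ⁅ℂ⁆ Model)
    (h : ∀ z, z ∈ engel ℂ x → φ z ∈ engel ℂ x') :
    Module.finrank ℂ (engel ℂ x) ≤ Module.finrank ℂ (engel ℂ x') := by
  have hle : (engel ℂ x).toSubmodule.map (φ.toLinearEquiv : Model →ₗ[ℂ] Model) ≤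
      (engel ℂ x').toSubmodule := by
    rintro _ ⟨z, hz, rfl⟩
    exact h z hz
  have h1 := Submodule.finrank_mono hle
  have h2 := LinearEquiv.finrank_map_eq φ.toLinearEquiv (engel ℂ x).toSubmodule
  exact h2.symm.le.trans h1

open LieAlgebra in
theorem IsRegular.equiv (φ : Model ≃ₗ⁅ℂ⁆ Model) {x : Model} (h : IsRegular ℂ (φ x)) :
    IsRegular ℂ x := by
  rw [isRegular_iff_finrank_engel_eq_rank] at h ⊢
  refine le_antisymm ?_ (rank_le_finrank_engel ℂ x)
  rw [← h]
  exact finrank_engel_le φ fun z => (mem_engel_equiv φ x z).2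

open LieAlgebra in
theorem exists_isRegular_iff_eval_ne_zero :
    ∃ F : MvPolynomial Idx ℂ, ∀ x : Model,
      IsRegular ℂ x ↔ MvPolynomial.eval (bas.repr x) F ≠ 0 := by
  classical
  exact ⟨_, fun x => isRegular_iff_coeff_polyCharpoly_rank_ne_zero ℂ bas x⟩

open LieAlgebra in
theorem finite_not_isRegular (a b : Model) (hb : IsRegular ℂ b) :
    {s : ℂ | ¬ IsRegular ℂ (a + s • (b - a))}.Finite := by
  classical
  obtain ⟨F, hF⟩ := exists_isRegular_iff_eval_ne_zero
  let G : Polynomial ℂ := MvPolynomial.aeval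
    (fun i => Polynomial.C (bas.repr a i) + Polynomial.X * Polynomial.C (bas.repr (b - a) i)) F
  have hG : ∀ s, G.eval s = MvPolynomial.eval (bas.repr (a + s • (b - a))) F := by
    intro s
    have h := MvPolynomial.comp_aeval_apply (R := ℂ)
      (fun i => Polynomial.C (bas.repr a i) + Polynomial.X * Polynomial.C (bas.repr (b - a) i))
      (Polynomial.aeval s) F
    rw [Polynomial.aeval_def, Polynomial.eval₂_eq_eval_map, Algebra.algebraMap_self,
      Polynomial.map_id] at h
    rw [h, ← MvPolynomial.coe_aeval_eq_eval]
    have h2 : (fun i => (Polynomial.aeval s) (Polynomial.C (bas.repr a i) +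
        Polynomial.X * Polynomial.C (bas.repr (b - a) i))) = bas.repr (a + s • (b - a)) := by
      funext i
      simp
    rw [h2]
    rfl
  have hG1 : G ≠ 0 := by
    intro h0
    have h1 := hG 1
    rw [h0, Polynomial.eval_zero, one_smul, add_sub_cancel] at h1
    exact (hF b).1 hb h1.symm
  refine (G.roots.toFinset.finite_toSet).subset ?_
  intro s hs
  rw [Set.mem_ofPred_eq, hF, not_not] at hs
  simp only [Finset.mem_coe, Multiset.mem_toFinset, Polynomial.mem_roots hG1, Polynomial.IsRoot]
  rw [hG, hs]

/-- A Fitting decomposition. -/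
theorem exists_add_lie_of_engel (x w : Model) :
    ∃ z : Model, ∃ l ∈ LieSubalgebra.engel ℂ x, w = l + ⁅z, x⁆ := by
  have h := (LieAlgebra.ad ℂ Model x).eventually_isCompl_ker_pow_range_pow
  obtain ⟨n, hn, hn1⟩ := (h.and (eventually_ge_atTop 1)).exists
  obtain ⟨l, hl, _, ⟨r, rfl⟩, rfl⟩ := Submodule.mem_sup.1 (show w ∈ _ ⊔ _ by
    rw [hn.sup_eq_top]; trivial)
  obtain ⟨m, rfl⟩ : ∃ m, n = m + 1 := ⟨n - 1, by omega⟩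
  refine ⟨-(((LieAlgebra.ad ℂ Model x) ^ m) r), l,
    (LieSubalgebra.mem_engel_iff ℂ x l).2 ⟨m + 1, hl⟩, ?_⟩
  rw [neg_lie, lie_skew, pow_succ', Module.End.mul_apply, LieAlgebra.ad_apply]

open LieAlgebra LieSubalgebra in
theorem eventually_regular_conj {x : Model} (hx : IsRegular ℂ x) :
    ∀ᶠ y in 𝓝 x, IsRegular ℂ y →
      ∃ φ : Model ≃ₗ⁅ℂ⁆ Model, ∀ z, z ∈ engel ℂ x ↔ φ z ∈ engel ℂ y := by
  have h := eventually_exists_expAd (L := (engel ℂ x).toSubmodule) (Z := ⊤) (W := ⊤)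
    (fun _ _ _ _ => trivial) le_top (y := x) trivial (fun w _ => by
      obtain ⟨z, l, hl, h⟩ := exists_add_lie_of_engel x w
      exact ⟨z, trivial, l, hl, h⟩)
  filter_upwards [h] with y hy hyr
  obtain ⟨z, -, l, hl, rfl⟩ := hy trivial
  have hreg := IsRegular.equiv _ hyr
  have hmem : x + l ∈ engel ℂ x := add_mem (self_mem_engel ℂ x) hl
  rw [isRegular_iff_finrank_engel_eq_rank] at hx hreg
  have hbot := engel_isBot_of_isMin (K := ℂ) (L := Model)
    (Cardinal.natCast_lt_aleph0.le.trans (Cardinal.infinite_iff.1 inferInstance))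
    (engel ℂ x) ⟨engel ℂ x, x, self_mem_engel ℂ x, rfl⟩ le_rfl (by
      rintro ⟨_, u, hu, rfl⟩ hle
      have hle' : engel ℂ u ≤ engel ℂ x := hle
      have : (engel ℂ u).toSubmodule = (engel ℂ x).toSubmodule :=
        Submodule.eq_of_le_of_finrank_le hle' (hx.le.trans (rank_le_finrank_engel ℂ u))
      exact this.ge)
  have hle : engel ℂ x ≤ engel ℂ (x + l) := hbot ⟨engel ℂ (x + l), x + l, hmem, rfl⟩
  have heq : (engel ℂ x).toSubmodule = (engel ℂ (x + l)).toSubmodule :=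
    Submodule.eq_of_le_of_finrank_le hle (hreg.trans hx.symm).le
  refine ⟨expAd z, fun w => ?_⟩
  rw [mem_engel_equiv]
  exact SetLike.ext_iff.1 heq w

open LieAlgebra LieSubalgebra in
theorem regular_conj {x y : Model} (hx : IsRegular ℂ x) (hy : IsRegular ℂ y) :
    ∃ φ : Model ≃ₗ⁅ℂ⁆ Model, ∀ z, z ∈ engel ℂ x ↔ φ z ∈ engel ℂ y := by
  refine rel_of_locally (S := {x : Model | IsRegular ℂ x}) (P := fun x y =>
    ∃ φ : Model ≃ₗ⁅ℂ⁆ Model, ∀ z, z ∈ engel ℂ x ↔ φ z ∈ engel ℂ y) ?_ ?_ ?_ hx hy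
    (finite_not_isRegular x y hy).countable
  · rintro a b ⟨φ, hφ⟩
    refine ⟨φ.symm, fun z => ?_⟩
    rw [hφ, LieEquiv.apply_symm_apply]
  · rintro a b c ⟨φ, hφ⟩ ⟨ψ, hψ⟩
    exact ⟨φ.trans ψ, fun z => (hφ z).trans (hψ _)⟩
  · exact fun a ha => eventually_regular_conj ha

open LieAlgebra in
/-- Near every element there are regular elements. -/
theorem exists_regular_of_eventually {x : Model} {P : Model → Prop} (h : ∀ᶠ y in 𝓝 x, P y) :
    ∃ y, IsRegular ℂ y ∧ P y := by
  obtain ⟨b, hb⟩ := exists_isRegular ℂ Model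
  have hcont : ContinuousAt (fun s : ℂ => x + s • (b - x)) 0 := by fun_prop
  have h1 : ∀ᶠ s in 𝓝 (0 : ℂ), P (x + s • (b - x)) := by
    refine hcont.eventually ?_
    simpa using h
  have h2 : ∀ᶠ s in 𝓝[≠] (0 : ℂ), IsRegular ℂ (x + s • (b - x)) := by
    have hf := ((finite_not_isRegular x b hb).subset
      (Set.sdiff_subset (t := {0}))).isClosed.isOpen_compl.mem_nhds (x := (0 : ℂ)) (by simp)
    filter_upwards [mem_nhdsWithin_of_mem_nhds hf, self_mem_nhdsWithin] with s hs hs0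
    by_contra hc
    exact hs ⟨hc, hs0⟩
  obtain ⟨s, hs1, hs2⟩ := ((h1.filter_mono nhdsWithin_le_nhds).and h2).exists
  exact ⟨_, hs2, hs1⟩

/-- The elements of the standard Cartan subalgebra. -/
noncomputable def tor (c : Fin 8 → ℂ) : Model := ∑ i, c i • H i

/-- The half sum of the positive coroots. -/
def rhoCheck : Lat := ![46, 68, 91, 135, 110, 84, 57, 29]

theorem ip_rhoCheck (v : Lat) : ip rhoCheck v = ∑ i, v i := by
  rw [ip_comm, ip_eq_sum]
  refine Finset.sum_congr rfl fun i _ => ?_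
  suffices ip rhoCheck (Pi.single i 1) = 1 by rw [this, mul_one]
  revert i
  decide +kernel

theorem height_ne_zero {v : Lat} (hv : IsRoot v) : ∑ i, v i ≠ 0 := by
  obtain ⟨w, hw, rfl⟩ := exists_mem_roots hv
  have h : ∀ w ∈ roots, w.c0 + w.c1 + w.c2 + w.c3 + w.c4 + w.c5 + w.c6 + w.c7 ≠ 0 := by
      decide +kernel
  simpa [Fin.sum_univ_eight, Vec8.toLat] using h w hw

theorem coord_br_coroot (u : Lat) (x : Model) (a : Idx) :
    bas.coord a (br (coroot u) x) = ip u (wt a) * bas.coord a x := by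
  rw [coroot, map_sum, LinearMap.sum_apply, map_sum, ip_eq_sum]
  simp_rw [ip_comm (wt a)]
  push_cast
  rw [Finset.sum_mul]
  refine Finset.sum_congr rfl fun i _ => ?_
  rw [map_smul, LinearMap.smul_apply, map_smul, coord_br_H, smul_eq_mul, mul_assoc]

open LieSubalgebra in
theorem mem_engel_rhoCheck {x : Model} (hx : x ∈ engel ℂ (coroot rhoCheck)) :
    ∃ c, x = tor c := by
  obtain ⟨n, hn⟩ := (mem_engel_iff ℂ _ x).1 hx
  have hc : ∀ (r : Root) (m : ℕ), bas.coord (Sum.inr r) (((LieAlgebra.ad ℂ Model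
      (coroot rhoCheck)) ^ m) x) = ((∑ i, r.1 i : ℤ) : ℂ) ^ m * bas.coord (Sum.inr r) x := by
    intro r m
    induction m with
    | zero => simp
    | succ m ih =>
      rw [pow_succ', Module.End.mul_apply, LieAlgebra.ad_apply, lie_def, coord_br_coroot, ih,
        ip_rhoCheck, pow_succ', mul_assoc]
      rfl
  have h0 : ∀ r : Root, bas.coord (Sum.inr r) x = 0 := by
    intro r
    have h := hc r n
    rw [hn, map_zero] at h
    have h2 : ((∑ i, r.1 i : ℤ) : ℂ) ≠ 0 := Int.cast_ne_zero.2 (height_ne_zero r.2)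
    exact (mul_eq_zero.1 h.symm).resolve_left (pow_ne_zero n h2)
  refine ⟨fun i => bas.coord (Sum.inl i) x, ?_⟩
  conv_lhs => rw [← bas.sum_repr x]
  rw [Fintype.sum_sum_type]
  have h2 : ∀ r : Root, bas.repr x (Sum.inr r) = 0 := h0
  simp [h2, tor, H]

theorem lie_tor_tor (c d : Fin 8 → ℂ) : ⁅tor c, tor d⁆ = 0 := by
  simp [tor, lie_H_H, sum_lie, lie_sum]

open LieAlgebra LieSubalgebra in
theorem isRegular_rhoCheck : IsRegular ℂ (coroot rhoCheck) := by
  set x := coroot rhoCheck with hxdef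
  have h := eventually_exists_expAd (L := (engel ℂ x).toSubmodule) (Z := ⊤) (W := ⊤)
    (fun _ _ _ _ => trivial) le_top (y := x) trivial (fun w _ => by
      obtain ⟨z, l, hl, h⟩ := exists_add_lie_of_engel x w
      exact ⟨z, trivial, l, hl, h⟩)
  obtain ⟨y, hy, hy'⟩ := exists_regular_of_eventually h
  obtain ⟨z, -, l, hl, rfl⟩ := hy' trivial
  have hreg := IsRegular.equiv _ hy
  obtain ⟨c, hc⟩ := mem_engel_rhoCheck (add_mem (self_mem_engel ℂ x) hl)
  rw [isRegular_iff_finrank_engel_eq_rank] at hreg ⊢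
  refine le_antisymm ?_ (rank_le_finrank_engel ℂ x)
  rw [← hreg]
  refine finrank_engel_le LieEquiv.refl fun z hz => ?_
  obtain ⟨d, rfl⟩ := mem_engel_rhoCheck hz
  rw [mem_engel_iff]
  refine ⟨1, ?_⟩
  rw [pow_one, ad_apply, hc]
  exact lie_tor_tor c d

open LieAlgebra LieSubalgebra in
/-- Every semisimple element is conjugate to an element of the standard Cartan subalgebra. -/
theorem exists_conj_tor {h : Model} (hss : ∀ w, ∃ z l : Model, ⁅h, l⁆ = 0 ∧ w = l + ⁅z, h⁆) :
    ∃ (φ : Model ≃ₗ⁅ℂ⁆ Model) (c : Fin 8 → ℂ), φ h = tor c := by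
  have h1 := eventually_exists_expAd (L := LinearMap.ker (ad ℂ Model h)) (Z := ⊤) (W := ⊤)
    (fun _ _ _ _ => trivial) le_top (y := h) trivial (fun w _ => by
      obtain ⟨z, l, hl, hw⟩ := hss w
      exact ⟨z, trivial, l, hl, hw⟩)
  obtain ⟨y, hy, hy'⟩ := exists_regular_of_eventually h1
  obtain ⟨z, -, l, hl, rfl⟩ := hy' trivial
  obtain ⟨ψ, hψ⟩ := regular_conj (IsRegular.equiv _ hy) isRegular_rhoCheck
  have hm : h ∈ engel ℂ (h + l) := by
    rw [mem_engel_iff]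
    refine ⟨1, ?_⟩
    have hl' : ⁅h, l⁆ = 0 := hl
    rw [pow_one, ad_apply, add_lie, lie_self, zero_add, ← lie_skew, hl', neg_zero]
  obtain ⟨c, hc⟩ := mem_engel_rhoCheck ((hψ h).1 hm)
  exact ⟨ψ, c, hc⟩

end E8

namespace E8

/-- `sl₂`-triples in the model. -/
structure IsTriple (h e f : Model) : Prop where
  he : ⁅h, e⁆ = (2 : ℂ) • e
  hf : ⁅h, f⁆ = (-2 : ℂ) • f
  ef : ⁅e, f⁆ = h

namespace IsTriple
variable {h e f : Model}

theorem map (T : IsTriple h e f) (φ : Model ≃ₗ⁅ℂ⁆ Model) : IsTriple (φ h) (φ e) (φ f) where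
  he := by rw [← LieEquiv.map_lie, T.he, map_smul]
  hf := by rw [← LieEquiv.map_lie, T.hf, map_smul]
  ef := by rw [← LieEquiv.map_lie, T.ef]

theorem rep (T : IsTriple h e f) :
    IsSl2Rep (LieAlgebra.ad ℂ Model h) (LieAlgebra.ad ℂ Model e) (LieAlgebra.ad ℂ Model f) where
  he x := by
    simp only [LieAlgebra.ad_apply]
    rw [leibniz_lie, T.he, smul_lie, add_comm]
  hf x := by
    simp only [LieAlgebra.ad_apply]
    rw [leibniz_lie, T.hf, smul_lie]
    module
  ef x := by
    simp only [LieAlgebra.ad_apply]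
    rw [leibniz_lie, T.ef, add_comm]

theorem exists_conj_tor (T : IsTriple h e f) :
    ∃ (φ : Model ≃ₗ⁅ℂ⁆ Model) (c : Fin 8 → ℂ), φ h = tor c := by
  refine E8.exists_conj_tor fun w => ?_
  have hw : w ∈ ⨆ μ, (LieAlgebra.ad ℂ Model h).eigenspace μ := by
    rw [T.rep.iSup_eigenspace]; trivial
  induction hw using Submodule.iSup_induction' with
  | mem μ w hw =>
    have hw' : ⁅h, w⁆ = μ • w := Module.End.mem_eigenspace_iff.1 hw
    rcases eq_or_ne μ 0 with rfl | hμ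
    · exact ⟨0, w, by simpa using hw', by simp⟩
    · refine ⟨-(μ⁻¹ • w), 0, lie_zero _, ?_⟩
      rw [neg_lie, lie_skew, lie_smul, hw', smul_smul, inv_mul_cancel₀ hμ]
      simp
  | zero => exact ⟨0, 0, by simp, by simp⟩
  | add x y _ _ hx hy =>
    obtain ⟨z, l, hl, hx⟩ := hx
    obtain ⟨z', l', hl', hy⟩ := hy
    refine ⟨z + z', l + l', by rw [lie_add, hl, hl', add_zero], ?_⟩
    rw [add_lie]
    nth_rw 1 [hx, hy]
    abel

end IsTriple

/-- The inverse of the Cartan matrix. -/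
def cartanInv (i j : Fin 8) : ℤ :=
  (![![4, 5, 7, 10, 8, 6, 4, 2], ![5, 8, 10, 15, 12, 9, 6, 3], ![7, 10, 14, 20, 16, 12, 8, 4],
    ![10, 15, 20, 30, 24, 18, 12, 6], ![8, 12, 16, 24, 20, 15, 10, 5],
    ![6, 9, 12, 18, 15, 12, 8, 4], ![4, 6, 8, 12, 10, 8, 6, 3], ![2, 3, 4, 6, 5, 4, 3, 2]] :
    Fin 8 → Fin 8 → ℤ) i j

theorem cartanInv_mul (i k : Fin 8) :
    ∑ j, cartanInv i j * ip (Pi.single k 1) (Pi.single j 1) = if i = k then 1 else 0 := by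
  revert i k
  decide +kernel

theorem lie_tor_E (c : Fin 8 → ℂ) (v : Lat) :
    ⁅tor c, E v⁆ = (∑ k, c k * ip (Pi.single k 1) v) • E v := by
  simp [tor, sum_lie, lie_H_E, Finset.sum_smul, smul_smul]

theorem E_ne_zero {v : Lat} (hv : IsRoot v) : E v ≠ 0 := by
  rw [show E v = bas (Sum.inr ⟨v, hv⟩) from E_coe ⟨v, hv⟩]
  exact bas.ne_zero _

theorem eq_coroot_of_int {c : Fin 8 → ℂ} {a : Fin 8 → ℤ}
    (h : ∀ i, ∑ k, c k * ip (Pi.single k 1) (Pi.single i 1) = a i) :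
    ∃ v : Lat, tor c = coroot v := by
  refine ⟨fun i => ∑ j, cartanInv i j * a j, ?_⟩
  rw [tor, coroot]
  refine Finset.sum_congr rfl fun i _ => ?_
  congr 1
  push_cast
  simp_rw [← h, Finset.mul_sum]
  rw [Finset.sum_comm]
  have h1 : ∀ k, ∑ j, (cartanInv i j : ℂ) * (c k * ip (Pi.single k 1) (Pi.single j 1)) =
      c k * if i = k then 1 else 0 := by
    intro k
    have := congrArg (Int.cast : ℤ → ℂ) (cartanInv_mul i k)
    push_cast at this
    rw [← this, Finset.mul_sum]
    exact Finset.sum_congr rfl fun j _ => by ring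
  simp [h1]

theorem IsTriple.exists_conj_coroot {h e f : Model} (T : IsTriple h e f) :
    ∃ (φ : Model ≃ₗ⁅ℂ⁆ Model) (v : Lat), φ h = coroot v := by
  obtain ⟨φ, c, hc⟩ := T.exists_conj_tor
  have T' := T.map φ
  rw [hc] at T'
  have h1 : ∀ i, ∃ a : ℤ, ∑ k, c k * (ip (Pi.single k 1) (Pi.single i 1) : ℂ) = a := fun i =>
    T'.rep.eq_int_of_eigen (E_ne_zero (isRoot_single i)) (lie_tor_E c _)
  choose a ha using h1
  obtain ⟨v, hv⟩ := eq_coroot_of_int ha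
  exact ⟨φ, v, hc.trans hv⟩

theorem expAd_eq {z w : Model} (h : ⁅z, ⁅z, ⁅z, w⁆⁆⁆ = 0) :
    expAd z w = w + ⁅z, w⁆ + (2⁻¹ : ℂ) • ⁅z, ⁅z, w⁆⁆ := by
  let _ : NormedAlgebra ℚ (Model →L[ℂ] Model) := NormedAlgebra.restrictScalars ℚ ℂ _
  have h1 := (NormedSpace.exp_series_hasSum_exp' (𝕂 := ℂ) (adC z)).mapL
    (ContinuousLinearMap.apply ℂ Model w)
  have h2 := hasSum_sum_of_ne_finset_zero (s := Finset.range 3)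
    (f := fun n => ContinuousLinearMap.apply ℂ Model w ((n.factorial⁻¹ : ℂ) • adC z ^ n))
    (L := .unconditional ℕ) (by
      intro n hn
      obtain ⟨m, rfl⟩ : ∃ m, n = m + 3 := ⟨n - 3, by simp at hn; omega⟩
      have h3 : (adC z ^ 3) w = 0 := h
      have : (adC z ^ (m + 3)) w = 0 := by
        rw [pow_add, mul_apply_eq_comp, h3, map_zero]
      simp [this])
  have h3 := h1.unique h2
  have h4 : (adC z ^ 2) w = ⁅z, ⁅z, w⁆⁆ := rfl
  rw [Finset.sum_range_succ, Finset.sum_range_succ, Finset.sum_range_one] at h3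
  simp only [ContinuousLinearMap.apply_apply, smul_apply, pow_zero, pow_one, h4] at h3
  refine h3.trans ?_
  simp [adC_apply]

/-- Simple reflections are induced by automorphisms. -/
theorem exists_reflection (i : Fin 8) : ∃ φ : Model ≃ₗ⁅ℂ⁆ Model, ∀ v : Lat,
    φ (coroot v) = coroot (v - ip v (Pi.single i 1) • Pi.single i 1) := by
  set α : Lat := Pi.single i 1 with hα
  have hr : IsRoot α := isRoot_single i
  set F := -E (-α) with hF
  have h1 : ⁅E α, F⁆ = coroot α := by
    have h0 : ip α (-α) = -2 := by rw [ip_neg_right]; exact congrArg Neg.neg hr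
    rw [hF, lie_neg, lie_E_E hr hr.neg, h0]
    simp
  have h2 : ∀ v, ⁅E α, coroot v⁆ = -((ip v α : ℂ) • E α) := fun v => br_E_coroot v α
  have h3 : ∀ v, ⁅-F, coroot v⁆ = -((ip v α : ℂ) • F) := fun v => by
    rw [hF, neg_neg, show ⁅E (-α), coroot v⁆ = _ from br_E_coroot v (-α), ip_neg_right]
    simp
  have h4 : ⁅-F, E α⁆ = coroot α := by rw [neg_lie, lie_skew, h1]
  have h5 : ip α α = 2 := hr
  refine ⟨((expAd (E α)).trans (expAd (-F))).trans (expAd (E α)), fun v => ?_⟩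
  have e1 : ∀ v, expAd (E α) (coroot v) = coroot v - (ip v α : ℂ) • E α := fun v => by
    rw [expAd_eq (by simp [h2]), h2]
    simp [sub_eq_add_neg]
  have e2 : ∀ v, expAd (-F) (coroot v) = coroot v - (ip v α : ℂ) • F := fun v => by
    rw [expAd_eq (by simp [h3]), h3]
    simp [sub_eq_add_neg]
  have e3 : expAd (-F) (E α) = E α + coroot α - F := by
    rw [expAd_eq (by simp [h3, h4]), h4, h3, h5]
    push_cast
    module
  have e4 : expAd (E α) (E α) = E α := expAd_of_lie_eq_zero (lie_self _)
  have e5 : expAd (E α) F = F + coroot α - E α := by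
    rw [expAd_eq (by simp [h1, h2]), h1, h2, h5]
    push_cast
    module
  have e6 : coroot (v - ip v α • α) = coroot v - (ip v α : ℂ) • coroot α := by
    simp [coroot, sub_smul, Finset.sum_sub_distrib, Finset.smul_sum, smul_smul]
  simp only [LieEquiv.trans_apply]
  rw [e1, map_sub, map_smul, e2, e3, e6]
  simp only [map_sub, map_add, map_smul, e1, e4, e5, h5]
  push_cast
  module

theorem ip_zsmul_right (n : ℤ) (u w : Lat) : ip u (n • w) = n * ip u w := by
  simp only [ip, Pi.smul_apply, smul_eq_mul, Finset.mul_sum]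
  exact Finset.sum_congr rfl fun i _ => Finset.sum_congr rfl fun j _ => by ring

theorem exists_dominant (v : Lat) : ∃ (φ : Model ≃ₗ⁅ℂ⁆ Model) (w : Lat),
    φ (coroot v) = coroot w ∧ ∀ i, 0 ≤ ip w (Pi.single i 1) := by
  obtain ⟨n, hn⟩ : ∃ n : ℕ, ip (rhoCheck - v) (rhoCheck - v) ≤ n :=
    ⟨_, Int.self_le_toNat _⟩
  induction n generalizing v with
  | zero =>
    have : rhoCheck - v = 0 :=
        eq_zero_of_ip_self _ (le_antisymm (by simpa using hn) (ip_self_nonneg _))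
    rw [sub_eq_zero] at this
    subst this
    refine ⟨LieEquiv.refl, _, rfl, ?_⟩
    decide +kernel
  | succ n ih =>
    by_cases h : ∀ i, 0 ≤ ip v (Pi.single i 1)
    · exact ⟨LieEquiv.refl, v, rfl, h⟩
    push Not at h
    obtain ⟨i, hi⟩ := h
    obtain ⟨φ, hφ⟩ := exists_reflection i
    obtain ⟨ψ, w, hψ, hw⟩ := ih (v - ip v (Pi.single i 1) • Pi.single i 1) (by
      have h2 : ip (Pi.single i 1) (Pi.single i 1) = 2 := isRoot_single i
      have h3 : ip rhoCheck (Pi.single i 1) = 1 := by rw [ip_rhoCheck]; simp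
      have h4 : rhoCheck - (v - ip v (Pi.single i 1) • Pi.single i 1) =
        (rhoCheck - v) + ip v (Pi.single i 1) • Pi.single i 1 := by abel
      rw [h4, ip_add_self]
      rw [ip_zsmul_right, ip_zsmul_right, ip_comm (_ • _), ip_zsmul_right, h2,
        ip_sub_left rhoCheck v (Pi.single i 1), h3]
      push_cast at hn
      nlinarith)
    exact ⟨φ.trans ψ, w, by rw [LieEquiv.trans_apply, hφ, hψ], hw⟩

/-- The neutral element of a triple is conjugate to a dominant coweight. -/
theorem IsTriple.exists_conj_dominant {h e f : Model} (T : IsTriple h e f) :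
    ∃ (φ : Model ≃ₗ⁅ℂ⁆ Model) (v : Lat), φ h = coroot v ∧ ∀ i, 0 ≤ ip v (Pi.single i 1) := by
  obtain ⟨φ, v, hv⟩ := T.exists_conj_coroot
  obtain ⟨ψ, w, hw, hw'⟩ := exists_dominant v
  exact ⟨φ.trans ψ, w, by rw [LieEquiv.trans_apply, hv, hw], hw'⟩

end E8

namespace E8

open LieAlgebra

/-- The weight spaces of the grading defined by a coweight. -/
noncomputable def wtSpace (v : Lat) (k : ℤ) : Submodule ℂ Model :=
  (ad ℂ Model (coroot v)).eigenspace (k : ℂ)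

theorem mem_wtSpace {v : Lat} {k : ℤ} {x : Model} :
    x ∈ wtSpace v k ↔ ⁅coroot v, x⁆ = (k : ℂ) • x := Module.End.mem_eigenspace_iff

theorem lie_mem_wtSpace {v : Lat} {k l : ℤ} {x y : Model} (hx : x ∈ wtSpace v k)
    (hy : y ∈ wtSpace v l) : ⁅x, y⁆ ∈ wtSpace v (k + l) := by
  rw [mem_wtSpace] at *
  rw [leibniz_lie, hx, hy, smul_lie, lie_smul]
  push_cast
  module

theorem coord_eq_zero {v : Lat} {k : ℤ} {x : Model} (hx : x ∈ wtSpace v k) {a : Idx}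
    (ha : ip v (wt a) ≠ k) : bas.coord a x = 0 := by
  rw [mem_wtSpace, lie_def] at hx
  have h := coord_br_coroot v x a
  rw [hx, map_smul, smul_eq_mul, ← sub_eq_zero, ← sub_mul] at h
  refine (mul_eq_zero.1 h).resolve_left ?_
  refine sub_ne_zero.2 ?_
  exact_mod_cast ha.symm

theorem bas_mem_wtSpace {v : Lat} (a : Idx) : bas a ∈ wtSpace v (ip v (wt a)) := by
  rw [mem_wtSpace, lie_def]
  refine bas.ext_elem fun b => ?_
  have := coord_br_coroot v (bas a) b
  simp only [Module.Basis.coord_apply] at this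
  rw [this, map_smul, Finsupp.smul_apply, smul_eq_mul, Module.Basis.repr_self,
    Finsupp.single_apply]
  split_ifs with h
  · rw [h]
  · simp

theorem wtSpace_eq_span (v : Lat) (k : ℤ) : wtSpace v k =
    Submodule.span ℂ (Set.range fun a : {a : Idx // ip v (wt a) = k} => bas a) := by
  refine le_antisymm (fun x hx => ?_) (Submodule.span_le.2 ?_)
  · rw [← bas.sum_repr x]
    refine Submodule.sum_mem _ fun a _ => ?_
    by_cases h : ip v (wt a) = k
    · exact Submodule.smul_mem _ _ (Submodule.subset_span ⟨⟨a, h⟩, rfl⟩)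
    · rw [show bas.repr x a = 0 from coord_eq_zero hx h, zero_smul]
      exact zero_mem _
  · rintro _ ⟨⟨a, rfl⟩, rfl⟩
    exact bas_mem_wtSpace a

theorem finrank_wtSpace (v : Lat) (k : ℤ) :
    Module.finrank ℂ (wtSpace v k) = Fintype.card {a : Idx // ip v (wt a) = k} := by
  rw [wtSpace_eq_span, finrank_span_eq_card]
  exact bas.linearIndependent.comp _ Subtype.val_injective

theorem finrank_wtSpace_neg (v : Lat) (k : ℤ) :
    Module.finrank ℂ (wtSpace v (-k)) = Module.finrank ℂ (wtSpace v k) := by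
  rw [finrank_wtSpace, finrank_wtSpace]
  let neg : Idx ≃ Idx := Equiv.sumCongr (Equiv.refl _)
    ((Equiv.neg Lat).subtypeEquiv fun v => ⟨IsRoot.neg, fun h => by simpa using h.neg⟩)
  have hneg : ∀ a, wt (neg a) = -wt a := by
    rintro (a | a)
    · exact (neg_zero).symm
    · rfl
  refine Fintype.card_congr (neg.subtypeEquiv fun a => ?_)
  rw [hneg, ip_neg_right, neg_eq_iff_eq_neg]

/-- The vectors of weight `k` killed by `e`. -/
noncomputable def cent (v : Lat) (e : Model) (k : ℤ) : Submodule ℂ Model :=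
  wtSpace v k ⊓ LinearMap.ker (ad ℂ Model e)

theorem mem_cent {v : Lat} {e : Model} {k : ℤ} {x : Model} :
    x ∈ cent v e k ↔ x ∈ wtSpace v k ∧ ⁅e, x⁆ = 0 := Iff.rfl

/-- Membership in the derived subalgebra of the centralizer. -/
def Reach (e : Model) : Prop :=
  e ∈ Submodule.span ℂ {z : Model | ∃ x : Model, ⁅e, x⁆ = 0 ∧ ∃ y : Model, ⁅e, y⁆ = 0 ∧ ⁅x, y⁆ = z}

namespace IsTriple
variable {v : Lat} {e f : Model}

theorem e_mem (T : IsTriple (coroot v) e f) : e ∈ wtSpace v 2 := by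
  rw [mem_wtSpace, T.he]; norm_num

theorem f_mem (T : IsTriple (coroot v) e f) : f ∈ wtSpace v (-2) := by
  rw [mem_wtSpace, T.hf]; norm_num

theorem lie_e_mem (T : IsTriple (coroot v) e f) {k : ℤ} {x : Model} (hx : x ∈ wtSpace v k) :
    ⁅e, x⁆ ∈ wtSpace v (k + 2) := by
  rw [add_comm]
  exact lie_mem_wtSpace T.e_mem hx

theorem exists_lie_eq (T : IsTriple (coroot v) e f) {k : ℤ} (hk : 0 < k) {x : Model}
    (hx : x ∈ wtSpace v k) : ∃ y ∈ wtSpace v (k - 2), ⁅e, y⁆ = x := by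
  obtain ⟨y, hy, hy'⟩ := T.rep.exists_e_eq hk (mem_wtSpace.1 hx)
  exact ⟨y, mem_wtSpace.2 hy, hy'⟩

theorem eq_zero_of_neg (T : IsTriple (coroot v) e f) {k : ℤ} (hk : k < 0) {x : Model}
    (hx : x ∈ wtSpace v k) (h : ⁅e, x⁆ = 0) : x = 0 :=
  T.rep.eq_zero_of_neg hk (mem_wtSpace.1 hx) h

/-- The restriction of `ad e` to a weight space. -/
noncomputable def adE (T : IsTriple (coroot v) e f) (k : ℤ) :
    wtSpace v k →ₗ[ℂ] wtSpace v (k + 2) :=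
  (ad ℂ Model e).restrict fun _ hx => T.lie_e_mem hx

theorem adE_surjective (T : IsTriple (coroot v) e f) {k : ℤ} (hk : -2 < k) :
    Function.Surjective (T.adE k) := by
  rintro ⟨x, hx⟩
  obtain ⟨y, hy, rfl⟩ := T.exists_lie_eq (by omega) hx
  rw [add_sub_cancel_right] at hy
  exact ⟨⟨y, hy⟩, rfl⟩

theorem finrank_le (T : IsTriple (coroot v) e f) {k : ℤ} (hk : -2 < k) :
    Module.finrank ℂ (wtSpace v (k + 2)) ≤ Module.finrank ℂ (wtSpace v k) :=
  LinearMap.finrank_le_finrank_of_surjective (T.adE_surjective hk)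

theorem finrank_cent_add (T : IsTriple (coroot v) e f) {k : ℤ} (hk : -2 < k) :
    Module.finrank ℂ (cent v e k) + Module.finrank ℂ (wtSpace v (k + 2)) =
      Module.finrank ℂ (wtSpace v k) := by
  have h := (T.adE k).finrank_range_add_finrank_ker
  rw [LinearMap.range_eq_top.2 (T.adE_surjective hk), finrank_top] at h
  rw [← h, add_comm]
  congr 1
  have h2 : (LinearMap.ker (T.adE k)).map (wtSpace v k).subtype = cent v e k := by
    ext x
    simp only [Submodule.mem_map, LinearMap.mem_ker, mem_cent]
    constructor
    · rintro ⟨⟨y, hy⟩, hy', rfl⟩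
      exact ⟨hy, congrArg Subtype.val hy'⟩
    · rintro ⟨hx, hx'⟩
      exact ⟨⟨x, hx⟩, Subtype.ext hx', rfl⟩
  rw [← h2]
  exact (Submodule.finrank_map_subtype_eq _ _)

/-- A functional concentrated in weight two that vanishes on the relevant brackets vanishes at a
reachable element. -/
theorem functional_eq_zero (T : IsTriple (coroot v) e f) (he : Reach e) (l : Model →ₗ[ℂ] ℂ)
    (hl : ∀ k ≠ 2, ∀ x ∈ wtSpace v k, l x = 0)
    (h02 : ∀ x ∈ cent v e 0, ∀ y ∈ cent v e 2, l ⁅x, y⁆ = 0)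
    (h11 : ∀ x ∈ cent v e 1, ∀ y ∈ cent v e 1, l ⁅x, y⁆ = 0) : l e = 0 := by
  have hker : LinearMap.ker (ad ℂ Model e) ≤ ⨆ μ, LinearMap.ker (ad ℂ Model e) ⊓
      (ad ℂ Model (coroot v)).eigenspace μ := by
    have h := Submodule.inf_iSup_genEigenspace (p := LinearMap.ker (ad ℂ Model e))
      (f := ad ℂ Model (coroot v)) (fun x hx => T.rep.e_h_eq_zero hx) 1
    have h2 := T.rep.iSup_eigenspace
    simp only [Module.End.eigenspace] at h2 ⊢
    rw [h2, inf_top_eq] at h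
    exact h.le
  have hcoeff : ∀ μ : ℂ, ∀ x ∈ LinearMap.ker (ad ℂ Model e) ⊓
      (ad ℂ Model (coroot v)).eigenspace μ, ∃ k : ℤ, 0 ≤ k ∧ x ∈ cent v e k := by
    rintro μ x ⟨hx, hx'⟩
    rcases eq_or_ne x 0 with rfl | h0
    · exact ⟨0, le_rfl, zero_mem _⟩
    obtain ⟨k, rfl⟩ := T.rep.eq_int_of_eigen h0 (Module.End.mem_eigenspace_iff.1 hx')
    refine ⟨k, ?_, hx', hx⟩
    by_contra hk
    exact h0 (T.eq_zero_of_neg (not_le.1 hk) hx' hx)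
  have hkk : ∀ (j k : ℤ), 0 ≤ j → 0 ≤ k → ∀ x ∈ cent v e j, ∀ y ∈ cent v e k, l ⁅x, y⁆ = 0 := by
    intro j k hj hk x hx y hy
    by_cases h : j + k = 2
    · have : j = 0 ∨ j = 1 ∨ j = 2 := by omega
      rcases this with rfl | rfl | rfl
      · obtain rfl : k = 2 := by omega
        exact h02 x hx y hy
      · obtain rfl : k = 1 := by omega
        exact h11 x hx y hy
      · obtain rfl : k = 0 := by omega
        rw [← lie_skew, map_neg, h02 y hy x hx, neg_zero]
    · exact hl _ h _ (lie_mem_wtSpace hx.1 hy.1)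
  have hall : ∀ x : Model, ⁅e, x⁆ = 0 → ∀ y : Model, ⁅e, y⁆ = 0 → l ⁅x, y⁆ = 0 := by
    intro x hx y hy
    have hx' := hker (show x ∈ LinearMap.ker (ad ℂ Model e) from hx)
    have hy' := hker (show y ∈ LinearMap.ker (ad ℂ Model e) from hy)
    clear hx hy
    induction hx' using Submodule.iSup_induction' with
    | mem μ x hx =>
      obtain ⟨j, hj, hx⟩ := hcoeff μ x hx
      induction hy' using Submodule.iSup_induction' with
      | mem ν y hy =>
        obtain ⟨k, hk, hy⟩ := hcoeff ν y hy
        exact hkk j k hj hk x hx y hy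
      | zero => simp
      | add y y' _ _ h h' => rw [lie_add, map_add, h, h', add_zero]
    | zero => simp
    | add x x' _ _ h h' => rw [add_lie, map_add, h, h', add_zero]
  have hle : Submodule.span ℂ
      {z : Model | ∃ x : Model, ⁅e, x⁆ = 0 ∧ ∃ y : Model, ⁅e, y⁆ = 0 ∧ ⁅x, y⁆ = z} ≤
      LinearMap.ker l := by
    rw [Submodule.span_le]
    rintro _ ⟨x, hx, y, hy, rfl⟩
    exact hall x hx y hy
  exact hle he

end IsTriple

/-! ### The Killing form -/

theorem killing_lie (x y z : Model) :
    killingForm ℂ Model ⁅x, y⁆ z = killingForm ℂ Model x ⁅y, z⁆ :=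
  LieModule.traceForm_apply_lie_apply ℂ Model Model x y z

theorem killing_comm (x y : Model) : killingForm ℂ Model x y = killingForm ℂ Model y x :=
  LieModule.traceForm_comm ℂ Model Model x y

theorem killing_eq_zero {v : Lat} {k l : ℤ} (hkl : k + l ≠ 0) {x y : Model}
    (hx : x ∈ wtSpace v k) (hy : y ∈ wtSpace v l) : killingForm ℂ Model x y = 0 := by
  have h := killing_lie x (coroot v) y
  rw [← lie_skew, mem_wtSpace.1 hx, mem_wtSpace.1 hy, map_neg, map_smul, map_smul,
    LinearMap.neg_apply, LinearMap.smul_apply, smul_eq_mul, smul_eq_mul, neg_eq_iff_add_eq_zero,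
    ← add_mul] at h
  refine (mul_eq_zero.1 h).resolve_left ?_
  exact_mod_cast hkl

theorem killing_coroot_ne_zero {v : Lat} (hv : v ≠ 0) :
    killingForm ℂ Model (coroot v) (coroot v) ≠ 0 := by
  classical
  have h1 : killingForm ℂ Model (coroot v) (coroot v) = ((∑ a, ip v (wt a) ^ 2 : ℤ) : ℂ) := by
    rw [killingForm_apply_apply, LinearMap.trace_eq_matrix_trace ℂ bas, Matrix.trace]
    push_cast
    refine Finset.sum_congr rfl fun a _ => ?_
    rw [Matrix.diag_apply, LinearMap.toMatrix_apply, LinearMap.comp_apply, ad_apply, ad_apply,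
      mem_wtSpace.1 (bas_mem_wtSpace a), lie_smul, mem_wtSpace.1 (bas_mem_wtSpace a)]
    simp [sq]
  rw [h1, Int.cast_ne_zero]
  intro h2
  rw [Finset.sum_eq_zero_iff_of_nonneg fun _ _ => sq_nonneg _] at h2
  apply hv
  apply eq_zero_of_ip_self
  rw [ip_eq_sum]
  refine Finset.sum_eq_zero fun i _ => ?_
  have := h2 (Sum.inr ⟨Pi.single i 1, isRoot_single i⟩) (Finset.mem_univ _)
  rw [show ip v (Pi.single i 1) = 0 from pow_eq_zero_iff two_ne_zero |>.1 this, mul_zero]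

theorem killing_E_neg_ne_zero {v : Lat} (hv : IsRoot v) :
    killingForm ℂ Model (E v) (E (-v)) ≠ 0 := by
  intro h
  have h0 : ip v (-v) = -2 := by rw [ip_neg_right]; exact congrArg Neg.neg hv
  have h1 : ⁅E v, E (-v)⁆ = -coroot v := by
    rw [lie_E_E hv hv.neg, h0]
    simp
  have h2 := killing_lie (E v) (E (-v)) (coroot v)
  rw [h1, show ⁅E (-v), coroot v⁆ = _ from br_E_coroot v (-v)] at h2
  simp only [map_neg, map_smul, h, smul_zero, neg_zero, LinearMap.neg_apply, neg_eq_zero] at h2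
  exact killing_coroot_ne_zero hv.ne_zero h2

theorem killing_E_E {u v : Lat} (h : u + v ≠ 0) : killingForm ℂ Model (E u) (E v) = 0 := by
  by_cases hu : IsRoot u
  swap
  · simp [E, hu]
  by_cases hv : IsRoot v
  swap
  · simp [E, hv]
  have h1 : E u ∈ wtSpace (u + v) (ip (u + v) u) := mem_wtSpace.2 (lie_coroot_E _ _)
  have h2 : E v ∈ wtSpace (u + v) (ip (u + v) v) := mem_wtSpace.2 (lie_coroot_E _ _)
  refine killing_eq_zero ?_ h1 h2
  rw [← ip_add_right]
  exact fun h3 => h (eq_zero_of_ip_self _ h3)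

end E8

namespace E8

namespace IsSl2Rep
variable {V : Type*} [AddCommGroup V] [Module ℂ V] {h e f : Module.End ℂ V}

theorem e_pow_f_pow (s : IsSl2Rep h e f) {x : V} (hx : e x = 0) {k : ℕ}
    (hk : h x = (k : ℂ) • x) {n : ℕ} (hn : n ≤ k) :
    ∃ c : ℂ, c ≠ 0 ∧ (e ^ n) ((f ^ n) x) = c • x := by
  induction n with
  | zero => exact ⟨1, one_ne_zero, by simp⟩
  | succ n ih =>
    obtain ⟨c, hc, h⟩ := ih (by omega)
    refine ⟨(n + 1) * (k - n) * c, ?_, ?_⟩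
    · refine mul_ne_zero (mul_ne_zero (by exact_mod_cast n.succ_ne_zero) ?_) hc
      rw [sub_ne_zero]
      exact_mod_cast (show k ≠ n by omega)
    · rw [pow_succ e, Module.End.mul_apply, s.e_pow_f_succ hx, hk, ← sub_smul, map_smul, map_smul,
        map_smul, h, smul_smul, smul_smul]

theorem exists_e_pow_eq (s : IsSl2Rep h e f) (n : ℕ) {k : ℕ} {z : V} (hz : h z = (k : ℂ) • z)
    (hn : (e ^ n) z = 0) : ∃ x, h x = -(k : ℂ) • x ∧ (e ^ k) x = z := by
  induction n generalizing k z with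
  | zero => exact ⟨0, by simp, by simpa using hn.symm⟩
  | succ n ih =>
    obtain ⟨w, hw, hwz⟩ := ih (k := k + 2) (z := e z)
      (by rw [s.he, hz, map_smul]; push_cast; module)
      (by rwa [← Module.End.mul_apply, ← pow_succ])
    set y := z - (e ^ (k + 1)) w with hy
    have hey : e y = 0 := by
      rw [hy, map_sub, ← Module.End.mul_apply, ← pow_succ', hwz, sub_self]
    have hhy : h y = (k : ℂ) • y := by
      rw [hy, map_sub, hz, s.h_pow_e, hw, map_smul]; push_cast; module
    obtain ⟨c, hc, hcy⟩ := s.e_pow_f_pow hey hhy le_rfl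
    refine ⟨e w + c⁻¹ • (f ^ k) y, ?_, ?_⟩
    · rw [map_add, map_smul, s.he, hw, s.h_pow_f, hhy, map_smul, map_smul]; push_cast; module
    · rw [map_add, map_smul, hcy, smul_smul, inv_mul_cancel₀ hc, one_smul,
        ← Module.End.mul_apply, ← pow_succ, hy, add_sub_cancel]

end IsSl2Rep

theorem IsRoot.sign {v : Lat} (hv : IsRoot v) : (∀ i, 0 ≤ v i) ∨ ∀ i, v i ≤ 0 := by
  obtain ⟨w, hw, rfl⟩ := exists_mem_roots hv
  have h : ∀ w ∈ roots, (∀ i, 0 ≤ w.toLat i) ∨ ∀ i, w.toLat i ≤ 0 := by decide +kernel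
  exact h w hw

open LieAlgebra in
theorem killing_pow (e x y : Model) (k : ℕ) : killingForm ℂ Model x ((ad ℂ Model e ^ k) y) =
    (-1) ^ k * killingForm ℂ Model ((ad ℂ Model e ^ k) x) y := by
  induction k generalizing x with
  | zero => simp
  | succ k ih =>
    rw [pow_succ', Module.End.mul_apply, ad_apply, ← killing_lie, ← lie_skew, map_neg,
      LinearMap.neg_apply, ih]
    rw [← pow_succ', pow_succ (ad ℂ Model e), Module.End.mul_apply, ad_apply]
    ring

theorem eq_zero_of_killing {v : Lat} {k : ℤ} (hk : k ≠ 0) {x : Model} (hx : x ∈ wtSpace v k)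
    (h : ∀ y ∈ wtSpace v (-k), killingForm ℂ Model y x = 0) : x = 0 := by
  refine bas.ext_elem fun a => ?_
  rw [map_zero, Finsupp.zero_apply]
  by_cases ha : ip v (wt a) = k
  swap
  · exact coord_eq_zero hx ha
  rcases a with i | ⟨r, hr⟩
  · refine absurd ha ?_
    simpa [wt, ip] using hk.symm
  have h1 : killingForm ℂ Model (E (-r)) x =
      bas.repr x (.inr ⟨r, hr⟩) * killingForm ℂ Model (E (-r)) (E r) := by
    conv_lhs => rw [← bas.sum_repr x]
    rw [map_sum, Finset.sum_eq_single (Sum.inr ⟨r, hr⟩)]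
    · rw [map_smul, smul_eq_mul, ← E_coe]
    · rintro (i | ⟨w, hw⟩) _ hne
      · rw [map_smul, show bas.repr x (Sum.inl i) = 0 from coord_eq_zero hx (by
          simpa [wt, ip] using hk.symm), zero_smul]
      · rw [map_smul, ← E_coe, killing_E_E, smul_zero]
        intro h
        have : w = r := by rw [neg_add_eq_zero] at h; exact h.symm
        subst this
        exact hne rfl
    · simp
  have h2 : E (-r) ∈ wtSpace v (-k) := by
    rw [mem_wtSpace, lie_coroot_E, ip_neg_right]
    rw [show ip v r = k from ha]
  rw [h _ h2, eq_comm, mul_eq_zero, killing_comm] at h1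
  exact h1.resolve_right (killing_E_neg_ne_zero hr)

namespace IsTriple
variable {v : Lat} {e f : Model}
open LieAlgebra

/-- The odd weight spaces are even-dimensional. -/
theorem even_finrank (T : IsTriple (coroot v) e f) {k : ℕ} (hk : Odd k) :
    Even (Module.finrank ℂ (wtSpace v k)) := by
  classical
  by_contra hodd
  rw [Nat.not_even_iff_odd, ← finrank_wtSpace_neg, finrank_wtSpace] at hodd
  let M : Matrix {a : Idx // ip v (wt a) = -(k : ℤ)} {a : Idx // ip v (wt a) = -(k : ℤ)} ℂ :=
    .of fun a b => killingForm ℂ Model (bas a) ((ad ℂ Model e ^ k) (bas b))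
  have hskew : M.transpose = -M := by
    ext a b
    simp only [M, Matrix.transpose_apply, Matrix.of_apply, Matrix.neg_apply]
    rw [killing_pow, hk.neg_one_pow, killing_comm, neg_one_mul]
  have hdet : M.det = 0 := by
    have := congrArg Matrix.det hskew
    rw [Matrix.det_transpose, Matrix.det_neg, hodd.neg_one_pow, neg_one_mul] at this
    exact self_eq_neg.1 this
  obtain ⟨y, hy0, hy⟩ := Matrix.exists_mulVec_eq_zero_iff.2 hdet
  have hmem : ∀ a : {a : Idx // ip v (wt a) = -(k : ℤ)}, bas a ∈ wtSpace v (-k) := fun a => by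
    have := bas_mem_wtSpace (v := v) a
    rwa [a.2] at this
  set Y : Model := ∑ a, y a • bas a.1 with hY
  have hYm : Y ∈ wtSpace v (-k) := Submodule.sum_mem _ fun a _ => Submodule.smul_mem _ _ (hmem a)
  have h1 : ∀ x ∈ wtSpace v (-k), killingForm ℂ Model x ((ad ℂ Model e ^ k) Y) = 0 := by
    intro x hx
    rw [wtSpace_eq_span] at hx
    induction hx using Submodule.span_induction with
    | mem x hx =>
      obtain ⟨a, rfl⟩ := hx
      have := congrFun hy a
      simp only [Matrix.mulVec, dotProduct, M, Matrix.of_apply, Pi.zero_apply] at this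
      rw [hY, map_sum, map_sum, ← this]
      refine Finset.sum_congr rfl fun b _ => ?_
      rw [map_smul, map_smul, smul_eq_mul, mul_comm]
    | zero => simp
    | add x x' _ _ h h' => rw [map_add, LinearMap.add_apply, h, h', add_zero]
    | smul c x _ h => rw [map_smul, LinearMap.smul_apply, h, smul_zero]
  have h2 : Y = 0 := by
    refine eq_zero_of_killing (by have := hk.pos; omega) hYm fun z hz => ?_
    rw [neg_neg] at hz
    obtain ⟨n, hn⟩ := T.rep.exists_e_pow_eq_zero
    obtain ⟨x, hx, rfl⟩ := T.rep.exists_e_pow_eq n (k := k) (z := z)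
      (by simpa using mem_wtSpace.1 hz) (by rw [hn]; rfl)
    have h3 := h1 x (mem_wtSpace.2 (by simpa using hx))
    rw [killing_pow, hk.neg_one_pow, neg_one_mul, neg_eq_zero] at h3
    exact h3
  have hli := (bas.linearIndependent.comp (fun a : {a : Idx // ip v (wt a) = -(k : ℤ)} => a.1)
    Subtype.val_injective)
  rw [Fintype.linearIndependent_iff] at hli
  exact hy0 (funext (hli y (hY.symm.trans h2)))

/-- The labels of a dominant neutral element are at most two. -/
theorem label_le_two (T : IsTriple (coroot v) e f) (hv : ∀ i, 0 ≤ ip v (Pi.single i 1))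
    (i : Fin 8) : ip v (Pi.single i 1) ≤ 2 := by
  by_contra! hi
  have hneg : ∀ r, IsRoot r → ip v r < 0 → ∀ j, r j ≤ 0 := by
    intro r hr h
    refine hr.sign.resolve_left fun h0 => ?_
    rw [ip_comm, ip_eq_sum] at h
    refine absurd (Finset.sum_nonneg fun j _ => mul_nonneg (h0 j) (hv j)) (not_le.2 h)
  have hs := isRoot_single i
  have hmem : E (-Pi.single i 1) ∈ wtSpace v (-ip v (Pi.single i 1)) := by
    rw [mem_wtSpace, lie_coroot_E, ip_neg_right]
  refine E_ne_zero hs.neg (T.eq_zero_of_neg (by omega) hmem ?_)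
  have he := T.e_mem
  rw [wtSpace_eq_span] at he
  clear T
  induction he using Submodule.span_induction with
  | zero => simp
  | add x x' _ _ h h' => rw [add_lie, h, h', add_zero]
  | smul c x _ h => rw [smul_lie, h, smul_zero]
  | mem x hx =>
    obtain ⟨⟨a | ⟨r, hr⟩, ha⟩, rfl⟩ := hx
    · simp [wt, ip] at ha
    change ip v r = 2 at ha
    change ⁅bas (Sum.inr ⟨r, hr⟩), _⁆ = _
    rw [← E_coe, lie_E_E hr hs.neg]
    split_ifs with h1 h2
    · exfalso
      have h3 := hr.add hs.neg h1
      have h4 := hneg _ h3 (by rw [ip_add_right, ip_neg_right, ha]; omega)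
      have h5 := hneg _ hr.neg
      rcases hr.sign with h0 | h0
      · have hz : ∀ j ≠ i, r j = 0 := fun j hj => by
          have := h4 j
          have h6 := h0 j
          simp [hj] at this
          omega
        have h7 : ip v r = r i * ip v (Pi.single i 1) := by
          rw [ip_comm, ip_eq_sum, Finset.sum_eq_single i]
          · intro j _ hj; rw [hz j hj, zero_mul]
          · simp
        have h8 := h0 i
        rw [ha] at h7
        rcases h8.eq_or_lt with h9 | h9
        · rw [← h9] at h7; omega
        · nlinarith
      · have : ip v r ≤ 0 := by
          rw [ip_comm, ip_eq_sum]
          exact Finset.sum_nonpos fun j _ => mul_nonpos_of_nonpos_of_nonneg (h0 j) (hv j)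
        omega
    · have h3 : r = Pi.single i 1 := by
        have := hr.eq_neg hs.neg h2
        simpa using this.symm
      rw [h3] at ha
      omega
    · rfl

/-- A nonzero reachable element has centralizing vectors of weight one. -/
theorem cent_one_ne_bot (T : IsTriple (coroot v) e f) (hv : v ≠ 0) (he : Reach e) :
    cent v e 1 ≠ ⊥ := by
  intro hbot
  have h1 := T.functional_eq_zero he (killingForm ℂ Model f)
    (fun k hk x hx => killing_eq_zero (by omega) T.f_mem hx) ?_ ?_
  · have h2 := killing_lie (coroot v) e f
    rw [T.he, T.ef, map_smul, LinearMap.smul_apply, killing_comm, h1, smul_zero] at h2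
    exact killing_coroot_ne_zero hv h2.symm
  · intro x hx y hy
    have := T.rep.f_eq_zero_of_weight_zero (x := x) (by simpa using mem_wtSpace.1 hx.1) hx.2
    rw [← killing_lie, show ⁅f, x⁆ = 0 from this, map_zero, LinearMap.zero_apply]
  · intro x hx y hy
    rw [hbot, Submodule.mem_bot] at hx
    rw [hx, zero_lie, map_zero]

theorem finrank_lt (T : IsTriple (coroot v) e f) (hv : v ≠ 0) (he : Reach e) :
    Module.finrank ℂ (wtSpace v 3) < Module.finrank ℂ (wtSpace v 1) := by
  have h := T.finrank_cent_add (k := 1) (by norm_num)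
  have h2 := Submodule.one_le_finrank_iff.2 (T.cent_one_ne_bot hv he)
  rw [show (1 : ℤ) + 2 = 3 from rfl] at h
  omega

end IsTriple
end E8

namespace E8

/-! ### Counting roots by weight -/

/-- The weight of the vector with decimal digits `n` for a list of labels, last label first. -/
def dot : ℕ → List ℕ → ℕ
  | _, [] => 0
  | n, a :: l => n % 10 * a + dot (n / 10) l

theorem sum_root (g : Lat → ℕ) : ∑ r : Root, g r = (roots.map fun w => g w.toLat).sum := by
  rw [← List.sum_toFinset _ roots_nodup]
  symm
  refine Finset.sum_bij (fun w hw => ⟨w.toLat, isRoot_of_mem_roots (List.mem_toFinset.1 hw)⟩)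
    (fun _ _ => Finset.mem_univ _) ?_ ?_ (fun _ _ => rfl)
  · intro a _ b _ hab
    exact Vec8.toLat_injective (congrArg Subtype.val hab)
  · rintro ⟨r, hr⟩ _
    obtain ⟨w, hw, rfl⟩ := exists_mem_roots hr
    exact ⟨w, List.mem_toFinset.2 hw, rfl⟩

theorem ip_eq_dot {v : Lat} {a : Fin 8 → ℕ} (ha : ∀ i, ip v (Pi.single i 1) = a i) (n : ℕ)
    (hn : n < 100000000) : ip v (Vec8.ofDigits n).toLat =
      dot n [a 7, a 6, a 5, a 4, a 3, a 2, a 1, a 0] := by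
  rw [ip_comm, ip_eq_sum]
  simp only [ha, Fin.sum_univ_eight, dot, Vec8.ofDigits, Vec8.toLat]
  simp only [Nat.div_div_eq_div_mul]
  have h : n / 10000000 % 10 = n / 10000000 := by omega
  have h2 : ∀ x0 x1 x2 x3 x4 x5 x6 x7 : ℤ, (![x0, x1, x2, x3, x4, x5, x6, x7] 0 = x0 ∧
    ![x0, x1, x2, x3, x4, x5, x6, x7] 1 = x1 ∧ ![x0, x1, x2, x3, x4, x5, x6, x7] 2 = x2 ∧
    ![x0, x1, x2, x3, x4, x5, x6, x7] 3 = x3 ∧ ![x0, x1, x2, x3, x4, x5, x6, x7] 4 = x4 ∧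
    ![x0, x1, x2, x3, x4, x5, x6, x7] 5 = x5 ∧ ![x0, x1, x2, x3, x4, x5, x6, x7] 6 = x6 ∧
    ![x0, x1, x2, x3, x4, x5, x6, x7] 7 = x7) := fun _ _ _ _ _ _ _ _ =>
    ⟨rfl, rfl, rfl, rfl, rfl, rfl, rfl, rfl⟩
  obtain ⟨e0, e1, e2, e3, e4, e5, e6, e7⟩ := h2 (.ofNat (n / 10000000))
    (.ofNat (n / 1000000 % 10)) (.ofNat (n / 100000 % 10)) (.ofNat (n / 10000 % 10))
    (.ofNat (n / 1000 % 10)) (.ofNat (n / 100 % 10)) (.ofNat (n / 10 % 10)) (.ofNat (n % 10))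
  rw [e0, e1, e2, e3, e4, e5, e6, e7]
  norm_num [h]
  ring

theorem count_weight (k : ℕ) (f : ℕ → ℕ) (L : List ℕ) : ∃ A C,
    (L.map fun n => 256 ^ f n).sum = A + 256 ^ k * (L.countP (fun n => f n = k) + 256 * C) ∧
      256 * A ≤ L.length * 256 ^ k := by
  induction L with
  | nil => exact ⟨0, 0, by simp, by simp⟩
  | cons n L ih =>
    obtain ⟨A, C, h, hA⟩ := ih
    rcases lt_trichotomy (f n) k with hk | hk | hk
    · refine ⟨A + 256 ^ f n, C, ?_, ?_⟩
      · rw [List.map_cons, List.sum_cons, h, List.countP_cons_of_neg (by simpa using hk.ne)]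
        ring
      · have : 256 ^ (f n + 1) ≤ 256 ^ k := Nat.pow_le_pow_right (by norm_num) hk
        rw [pow_succ] at this
        rw [List.length_cons]
        linarith
    · refine ⟨A, C, ?_, ?_⟩
      · rw [List.map_cons, List.sum_cons, h, List.countP_cons_of_pos (by simpa using hk), hk]
        ring
      · rw [List.length_cons]
        nlinarith [Nat.zero_le (256 ^ k)]
    · obtain ⟨j, hj⟩ := Nat.exists_eq_add_of_lt hk
      refine ⟨A, C + 256 ^ j, ?_, ?_⟩
      · rw [List.map_cons, List.sum_cons, h, List.countP_cons_of_neg (by simpa using hk.ne'), hj]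
        ring
      · rw [List.length_cons]
        nlinarith [Nat.zero_le (256 ^ k)]

/-- The weights of the positive roots, packed into a number. -/
def hist (l : List ℕ) : ℕ := (posRootDigits.map fun n => 256 ^ dot n l).sum

theorem hist_digit (l : List ℕ) (k : ℕ) :
    hist l / 256 ^ k % 256 = posRootDigits.countP (fun n => dot n l = k) := by
  obtain ⟨A, C, h, hA⟩ := count_weight k (dot · l) posRootDigits
  have hlen : posRootDigits.length = 120 := by decide +kernel
  have hpos : 0 < 256 ^ k := by positivity
  have hle := List.countP_le_length (p := fun n => dot n l = k) (l := posRootDigits)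
  rw [hlen] at hA hle
  rw [hist, h, Nat.add_mul_div_left _ _ hpos, Nat.div_eq_of_lt (by linarith), zero_add,
    Nat.add_mul_mod_self_left, Nat.mod_eq_of_lt (by omega)]

theorem sum_map_ite {α : Type*} (P : α → Prop) [DecidablePred P] (L : List α) :
    (L.map fun a => if P a then 1 else 0).sum = L.countP (fun a => P a) := by
  induction L with
  | nil => rfl
  | cons a L ih =>
    rw [List.map_cons, List.sum_cons, ih, List.countP_cons, add_comm]
    simp

/-- The dimension of the weight space of weight `k`, extracted from `hist`. -/
def wtDim (N k : ℕ) : ℕ := if k = 0 then 8 + 2 * (N % 256) else N / 256 ^ k % 256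

theorem finrank_eq_wtDim {v : Lat} {a : Fin 8 → ℕ} (ha : ∀ i, ip v (Pi.single i 1) = a i)
    (k : ℕ) : Module.finrank ℂ (wtSpace v k) =
      wtDim (hist [a 7, a 6, a 5, a 4, a 3, a 2, a 1, a 0]) k := by
  classical
  set l := [a 7, a 6, a 5, a 4, a 3, a 2, a 1, a 0] with hl
  have hlt : ∀ n ∈ posRootDigits, n < 100000000 := by decide +kernel
  have h1 : posRootDigits.countP (fun n => ip v (Vec8.ofDigits n).toLat = (k : ℤ)) =
      posRootDigits.countP (fun n => dot n l = k) := by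
    refine List.countP_congr fun n hn => ?_
    rw [decide_eq_true_iff, decide_eq_true_iff, ip_eq_dot ha n (hlt n hn), Nat.cast_inj]
  have h2 : posRootDigits.countP (fun n => ip v (Vec8.ofDigits n).neg.toLat = (k : ℤ)) =
      if k = 0 then posRootDigits.countP (fun n => dot n l = k) else 0 := by
    split_ifs with hk
    · subst hk
      refine List.countP_congr fun n hn => ?_
      rw [decide_eq_true_iff, decide_eq_true_iff, Vec8.toLat_neg, ip_neg_right,
        ip_eq_dot ha n (hlt n hn), ← hl]
      omega
    · refine List.countP_eq_zero.2 fun n hn => ?_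
      rw [decide_eq_true_iff, Vec8.toLat_neg, ip_neg_right, ip_eq_dot ha n (hlt n hn)]
      omega
  rw [finrank_wtSpace, Fintype.card_subtype, Finset.card_filter, Fintype.sum_sum_type]
  refine (congrArg₂ (· + ·) rfl (sum_root fun w => if ip v w = (k : ℤ) then 1 else 0)).trans ?_
  rw [roots, List.map_append, List.sum_append, posRoots, List.map_map, List.map_map,
    List.map_map]
  change _ + ((posRootDigits.map fun n => if ip v (Vec8.ofDigits n).toLat = (k : ℤ) then 1
    else 0).sum + (posRootDigits.map fun n => if ip v (Vec8.ofDigits n).neg.toLat = (k : ℤ) then 1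
    else 0).sum) = _
  rw [sum_map_ite, sum_map_ite, h1, h2, ← hist_digit, wtDim]
  have h3 : ∀ i : Fin 8, (ip v (wt (Sum.inl i)) = (k : ℤ)) ↔ k = 0 := fun i => by
    rw [wt, ip_comm]
    simp [ip, eq_comm]
  simp only [h3, Finset.sum_const, Finset.card_univ, Fintype.card_fin]
  split_ifs with hk
  · subst hk
    simp
    ring
  · simp

end E8

namespace E8

/-! ### The possible labels -/

/-- Application, evaluating the argument first. -/
noncomputable def force {β : Type} (n : ℕ) (f : ℕ → β) : β :=
  Nat.rec (f 0) (fun m _ => f (Nat.succ m)) n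

theorem force_eq {β : Type} (n : ℕ) (f : ℕ → β) : force n f = f n := by
  cases n <;> rfl

/-- Prepend an entry to a table, merging equal keys, and pass the result on. -/
noncomputable def insertKey {β : Type} (k n : ℕ) (T : List (ℕ × ℕ)) (c : List (ℕ × ℕ) → β) : β :=
  List.casesOn T (c [(k, n)]) fun p T => Prod.casesOn p fun k' n' =>
    cond (Nat.beq k k') (force (Nat.add n n') fun m => c ((k, m) :: T))
      (c ((k, n) :: (k', n') :: T))

/-- Split off the last digit of all keys in a table, truncate, and pass the result on. -/
noncomputable def stepTable {β : Type} (a : ℕ) (T : List (ℕ × ℕ)) :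
    List (ℕ × ℕ) → (List (ℕ × ℕ) → β) → β :=
  List.rec (fun acc c => c acc) (fun p _ ih acc c => Prod.casesOn p fun k n =>
    Nat.rec (ih acc c) (fun m _ => force (Nat.div k 10) fun k' =>
      insertKey k' (Nat.succ m) acc fun acc' => ih acc' c)
    (Nat.mod (Nat.mul n (Nat.pow 256 (Nat.mul (Nat.mod k 10) a))) 18446744073709551616)) T

/-- The value of a table for given labels. -/
def evalTable (T : List (ℕ × ℕ)) (l : List ℕ) : ℕ := (T.map fun p => p.2 * 256 ^ dot p.1 l).sum

theorem evalTable_cons (k n : ℕ) (T : List (ℕ × ℕ)) (l : List ℕ) :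
    evalTable ((k, n) :: T) l = n * 256 ^ dot k l + evalTable T l := by
  simp [evalTable]

theorem insertKey_spec {β : Type} (k n : ℕ) (T : List (ℕ × ℕ)) (c : List (ℕ × ℕ) → β) :
    ∃ T', insertKey k n T c = c T' ∧
      ∀ l, evalTable T' l = n * 256 ^ dot k l + evalTable T l := by
  rcases T with _ | ⟨⟨k', n'⟩, T⟩
  · exact ⟨[(k, n)], rfl, fun l => evalTable_cons _ _ _ _⟩
  · change ∃ T', cond (Nat.beq k k') (force (Nat.add n n') fun m => c ((k, m) :: T))
      (c ((k, n) :: (k', n') :: T)) = c T' ∧ _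
    cases h : Nat.beq k k'
    · exact ⟨_, rfl, fun l => evalTable_cons _ _ _ _⟩
    · rw [cond_true, force_eq]
      refine ⟨_, rfl, fun l => ?_⟩
      rw [evalTable_cons, evalTable_cons, Nat.eq_of_beq_eq_true h, Nat.add_eq]
      ring

theorem stepTable_spec {β : Type} (a : ℕ) (T acc : List (ℕ × ℕ)) (c : List (ℕ × ℕ) → β) :
    ∃ T', stepTable a T acc c = c T' ∧
      ∀ l, evalTable T' l ≡ evalTable T (a :: l) + evalTable acc l [MOD 256 ^ 8] := by
  induction T generalizing acc with
  | nil => exact ⟨acc, rfl, fun l => by rw [show evalTable [] (a :: l) = 0 from rfl, zero_add]⟩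
  | cons p T ih =>
    have hmod := Nat.mod_modEq (p.2 * 256 ^ (p.1 % 10 * a)) (256 ^ 8)
    change ∃ T', Nat.rec (stepTable a T acc c) (fun m _ => force (p.1 / 10) fun k' =>
      insertKey k' (Nat.succ m) acc fun acc' => stepTable a T acc' c)
      (p.2 * 256 ^ (p.1 % 10 * a) % 256 ^ 8) = c T' ∧ _
    generalize p.2 * 256 ^ (p.1 % 10 * a) % 256 ^ 8 = r at hmod
    have hr : ∀ l, r * 256 ^ dot (p.1 / 10) l + evalTable T (a :: l) ≡
        evalTable (p :: T) (a :: l) [MOD 256 ^ 8] := by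
      intro l
      rw [evalTable_cons, dot, pow_add, ← mul_assoc]
      exact (hmod.mul_right _).add_right _
    cases r with
    | zero =>
      obtain ⟨T', h1, h2⟩ := ih acc
      refine ⟨T', h1, fun l => (h2 l).trans (Nat.ModEq.add_right _ ?_)⟩
      simpa using hr l
    | succ m =>
      change ∃ T', (force (p.1 / 10) fun k' =>
        insertKey k' (m + 1) acc fun acc' => stepTable a T acc' c) = c T' ∧ _
      rw [force_eq]
      obtain ⟨T1, h1, h1'⟩ := insertKey_spec (p.1 / 10) (m + 1) acc
        fun acc' => stepTable a T acc' c
      obtain ⟨T2, h2, h2'⟩ := ih T1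
      refine ⟨T2, h1.trans h2, fun l => (h2' l).trans ?_⟩
      rw [h1']
      convert (hr l).add_right (evalTable acc l) using 1
      ring

/-- The value of a table for the empty list of labels. -/
noncomputable def sumTable (T : List (ℕ × ℕ)) : ℕ := List.rec 0 (fun p _ ih => Nat.add p.2 ih) T

theorem sumTable_eq (T : List (ℕ × ℕ)) : sumTable T = evalTable T [] := by
  induction T with
  | nil => rfl
  | cons p T ih =>
    rw [evalTable_cons, ← ih, dot, pow_zero, mul_one]
    rfl

/-- The base `256` digits of a number do not increase in steps of two, and every other digit is
even. -/
noncomputable def digitTest (n : ℕ) : ℕ → Bool :=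
  Nat.rec (fun _ => true) (fun _ ih M => force (Nat.div M 65536) fun M' =>
    cond (Nat.ble (Nat.mod M' 256) (Nat.mod M 256)) (cond (Nat.beq (Nat.mod M 2) 0)
      (cond (Nat.ble (Nat.mod (Nat.div M' 256) 256) (Nat.mod (Nat.div M 256) 256)) (ih M') false)
      false) false) n

theorem digitTest_eq_true (n : ℕ) {M : ℕ} (h1 : ∀ k, M / 256 ^ (k + 2) % 256 ≤ M / 256 ^ k % 256)
    (h2 : ∀ k, Even k → Even (M / 256 ^ k % 256)) : digitTest n M = true := by
  induction n generalizing M with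
  | zero => rfl
  | succ n ih =>
    have h3 := h1 0
    have h4 := Nat.even_iff.1 (h2 0 (by decide))
    have h5 := h1 1
    norm_num at h3 h4 h5
    change (force (M / 65536) fun M' => cond (Nat.ble (M' % 256) (M % 256))
      (cond (Nat.beq (M % 2) 0) (cond (Nat.ble (M' / 256 % 256) (M / 256 % 256))
        (digitTest n M') false) false) false) = true
    have hshift : ∀ k, M / 65536 / 256 ^ k = M / 256 ^ (k + 2) := fun k => by
      rw [Nat.div_div_eq_div_mul, pow_add, mul_comm]; norm_num
    rw [force_eq, Nat.div_div_eq_div_mul, Nat.ble_eq_true_of_le h3, Nat.ble_eq_true_of_le h5]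
    have h6 : M % 2 = 0 := by omega
    rw [h6]
    change digitTest n (M / 65536) = true
    refine ih (fun k => ?_) fun k hk => ?_
    · rw [hshift, hshift]
      exact h1 _
    · rw [hshift]
      exact h2 _ (hk.add (by decide))

/-- A necessary condition on the dimensions of the weight spaces for a reachable element. -/
noncomputable def dimTest (N : ℕ) : Bool :=
  cond (Nat.blt (Nat.mod (Nat.div N 16777216) 256) (Nat.mod (Nat.div N 256) 256))
    (digitTest 30 (Nat.div N 256)) false

/-- The labels of the candidates for reachable orbits. -/
def labels : List ℕ := [
  00000001, 00000010, 00000100, 00001000, 00010000, 00010001, 00010010, 00100000, 00100001,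
  01000000, 01000010, 10000000, 10000001, 10000010, 10000101, 10001000,
  00000101, 00001010, 00001012, 00010002, 00010102, 00100002, 00100010, 00100100, 00100101,
  00100102, 00101000, 00101012, 00101020, 01000012, 10000100, 10000102, 10001010, 10001012,
  10010000, 10010001, 10010002, 10010010, 10010100, 10010101, 10010102, 10010122, 20010102]

/-- Further labels, which pass the test in low degrees only. -/
def spuriousLabels : List ℕ := [00100111, 11001122, 12111011, 20010122, 21101010]

/-- The labels are listed if `dimTest` succeeds in low degrees. -/
noncomputable def leafTest (N c : ℕ) : Bool :=
  cond (dimTest N) ((labels ++ spuriousLabels).any (Nat.beq c)) true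

theorem leafTest_spec {N c : ℕ} (h : leafTest N c = true) (hd : dimTest N = true) :
    c ∈ labels ++ spuriousLabels := by
  rw [leafTest, hd, cond_true, List.any_eq_true] at h
  obtain ⟨x, hx, hxc⟩ := h
  rwa [Nat.eq_of_beq_eq_true hxc]

/-- Every choice of labels passing `dimTest` in low degrees is listed. -/
noncomputable def testLabels (n : ℕ) : ℕ → List (ℕ × ℕ) → ℕ → Bool :=
  Nat.rec (fun _ T c => force (Nat.mod (sumTable T) 18446744073709551616) fun N => leafTest N c)
    (fun _ ih p T c => and (stepTable 0 T [] fun T' => ih (Nat.mul 10 p) T' c)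
      (and (stepTable 1 T [] fun T' => ih (Nat.mul 10 p) T' (Nat.add c p))
        (stepTable 2 T [] fun T' => ih (Nat.mul 10 p) T' (Nat.add c (Nat.mul 2 p))))) n

theorem testLabels_spec {n p c N : ℕ} {T : List (ℕ × ℕ)} (h : testLabels n p T c = true)
    {l : List ℕ} (hl : l.length = n) (h2 : ∀ a ∈ l, a ≤ 2)
    (hN : evalTable T l ≡ N [MOD 256 ^ 8]) (hd : dimTest (N % 256 ^ 8) = true) :
    c + p * Nat.ofDigits 10 l ∈ labels ++ spuriousLabels := by
  induction n generalizing p c T l with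
  | zero =>
    obtain rfl := List.length_eq_zero_iff.1 hl
    change (force (sumTable T % 256 ^ 8) fun N => leafTest N c) = true at h
    rw [force_eq, sumTable_eq, hN] at h
    simpa using leafTest_spec h hd
  | succ n ih =>
    obtain _ | ⟨a, l⟩ := l
    · simp at hl
    change and (stepTable 0 T [] fun T' => testLabels n (10 * p) T' c)
      (and (stepTable 1 T [] fun T' => testLabels n (10 * p) T' (c + p))
        (stepTable 2 T [] fun T' => testLabels n (10 * p) T' (c + 2 * p))) = true at h
    simp only [Bool.and_eq_true] at h
    rw [List.length_cons, Nat.succ_inj] at hl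
    have h4 : ∀ b ∈ l, b ≤ 2 := fun b hb => h2 b (List.mem_cons_of_mem _ hb)
    have key : ∀ c', stepTable a T [] (fun T' => testLabels n (10 * p) T' c') = true →
        c' + 10 * p * Nat.ofDigits 10 l ∈ labels ++ spuriousLabels := by
      intro c' hc
      obtain ⟨T', hT, hT'⟩ := stepTable_spec a T [] fun T' => testLabels n (10 * p) T' c'
      exact ih (hT.symm.trans hc) hl h4 ((hT' l).trans hN)
    have h3 := h2 a List.mem_cons_self
    have : c + p * (a + 10 * Nat.ofDigits 10 l) = (c + a * p) + 10 * p * Nat.ofDigits 10 l := by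
      ring
    rw [Nat.ofDigits_cons, this]
    interval_cases a
    · simpa using key c h.1
    · simpa using key _ h.2.1
    · exact key _ h.2.2

theorem testLabels_true : testLabels 8 1 (posRootDigits.map fun n => (n, 1)) 0 = true := by
  decide +kernel

theorem mod_digit (N k : ℕ) :
    N % 256 ^ 8 / 256 ^ k % 256 = if k < 8 then N / 256 ^ k % 256 else 0 := by
  split_ifs with hk
  · obtain ⟨j, hj⟩ := Nat.exists_eq_add_of_lt hk
    rw [hj, add_assoc, pow_add, Nat.mod_mul_right_div_self, pow_succ', Nat.mod_mul_right_mod]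
  · rw [Nat.div_eq_of_lt]
    exact (Nat.mod_lt _ (by positivity)).trans_le
      (Nat.pow_le_pow_right (by norm_num) (not_lt.1 hk))

theorem dimTest_spurious : ∀ c ∈ spuriousLabels, dimTest (hist [c % 10, c / 10 % 10,
    c / 100 % 10, c / 1000 % 10, c / 10000 % 10, c / 100000 % 10, c / 1000000 % 10,
    c / 10000000]) = false := by
  decide +kernel

theorem dimTest_of_antitone {N : ℕ} (h1 : N / 256 ^ 3 % 256 < N / 256 ^ 1 % 256)
    (h2 : ∀ k, N / 256 ^ (k + 3) % 256 ≤ N / 256 ^ (k + 1) % 256)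
    (h3 : ∀ k, Even k → Even (N / 256 ^ (k + 1) % 256)) : dimTest N = true := by
  have h4 : Nat.blt (Nat.mod (Nat.div N 16777216) 256) (Nat.mod (Nat.div N 256) 256) = true :=
    (Nat.blt_eq ..).mpr h1
  have h5 : ∀ k, N / 256 / 256 ^ k = N / 256 ^ (k + 1) := fun k => by
    rw [Nat.div_div_eq_div_mul, pow_succ']
  rw [dimTest, h4]
  refine digitTest_eq_true 30 (M := N / 256) (fun k => ?_) fun k hk => ?_
  · rw [h5, h5]
    exact h2 k
  · rw [h5]
    exact h3 k hk

namespace IsTriple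
variable {v : Lat} {e f : Model}

/-- The labels of the neutral element attached to a reachable element are listed in `labels`. -/
theorem mem_labels (T : IsTriple (coroot v) e f) (hv : v ≠ 0)
    (hd : ∀ i, 0 ≤ ip v (Pi.single i 1)) (he : Reach e) : ∃ a : Fin 8 → ℕ, (∀ i, a i ≤ 2) ∧
      (∀ i, ip v (Pi.single i 1) = a i) ∧
      Nat.ofDigits 10 [a 7, a 6, a 5, a 4, a 3, a 2, a 1, a 0] ∈ labels := by
  choose a ha using fun i => Int.eq_ofNat_of_zero_le (hd i)
  have h2 : ∀ i, a i ≤ 2 := fun i => by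
    have := T.label_le_two hd i
    rw [ha] at this
    exact_mod_cast this
  refine ⟨a, h2, ha, ?_⟩
  set l := [a 7, a 6, a 5, a 4, a 3, a 2, a 1, a 0] with hl
  have h1 : ∀ k, hist l / 256 ^ (k + 1) % 256 = Module.finrank ℂ (wtSpace v (k + 1 : ℕ)) :=
    fun k => by rw [finrank_eq_wtDim ha, wtDim, if_neg k.succ_ne_zero]
  have h3 := T.finrank_lt hv he
  have h4 : ∀ k, Module.finrank ℂ (wtSpace v (k + 2 + 1 : ℕ)) ≤
      Module.finrank ℂ (wtSpace v (k + 1 : ℕ)) := fun k => by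
    exact_mod_cast T.finrank_le (k := (k + 1 : ℕ)) (by omega)
  have h5 : ∀ k, Even k → Even (Module.finrank ℂ (wtSpace v (k + 1 : ℕ))) := fun k hk =>
    T.even_finrank hk.add_one
  have h6 : dimTest (hist l) = true := by
    refine dimTest_of_antitone ?_ (fun k => ?_) fun k hk => ?_
    · exact ((h1 2).trans_lt h3).trans_eq (h1 0).symm
    · rw [h1, show k + 3 = k + 2 + 1 from rfl, h1]
      exact h4 k
    · rw [h1]
      exact h5 k hk
  have h7 : dimTest (hist l % 256 ^ 8) = true := by
    refine dimTest_of_antitone ?_ (fun k => ?_) fun k hk => ?_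
    · rw [mod_digit, mod_digit]
      exact ((h1 2).trans_lt h3).trans_eq (h1 0).symm
    · rw [mod_digit, mod_digit, h1, show k + 3 = k + 2 + 1 from rfl, h1]
      have := h4 k
      split_ifs <;> omega
    · rw [mod_digit, h1]
      split_ifs
      · exact h5 k hk
      · exact Even.zero
  have h8 := testLabels_spec testLabels_true (l := l) rfl (by simp [hl, h2])
    (N := hist l) (by rw [hist, evalTable, List.map_map]; simp [Function.comp_def, Nat.ModEq]) h7
  rw [zero_add, one_mul, List.mem_append] at h8
  refine h8.resolve_right fun h9 => ?_
  have h10 := dimTest_spurious _ h9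
  have h11 : ∀ i, a i % 10 = a i := fun i => Nat.mod_eq_of_lt ((h2 i).trans_lt (by norm_num))
  have e7 := h2 7
  have e6 := h2 6
  have e5 := h2 5
  have e4 := h2 4
  have e3 := h2 3
  have e2 := h2 2
  have e1 := h2 1
  have e0 := h2 0
  have h12 : Nat.ofDigits 10 l = a 7 + 10 * (a 6 + 10 * (a 5 + 10 * (a 4 + 10 * (a 3 + 10 *
      (a 2 + 10 * (a 1 + 10 * a 0)))))) := by
    simp [hl, Nat.ofDigits_cons]
  rw [h12] at h10
  rw [show [_, _, _, _, _, _, _, _] = l by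
    simp only [hl, List.cons.injEq, and_true]
    refine ⟨?_, ?_, ?_, ?_, ?_, ?_, ?_, ?_⟩ <;> omega, h6] at h10
  exact absurd h10 (by decide)

end IsTriple
end E8

namespace E8

/-! ### Integral computations in the model -/

namespace Vec8

/-- The bilinear form `E8.bil`. -/
protected def bil (v w : Vec8) : ℤ :=
  v.c0 * w.c0 + v.c1 * w.c1 + v.c2 * (w.c2 - w.c0) + v.c3 * (w.c3 - w.c1 - w.c2)
    + v.c4 * (w.c4 - w.c3) + v.c5 * (w.c5 - w.c4) + v.c6 * (w.c6 - w.c5) + v.c7 * (w.c7 - w.c6)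

theorem bil_toLat (v w : Vec8) : E8.bil v.toLat w.toLat = v.bil w := by
  simp only [E8.bil, cocycleMatrix, CartanMatrix.E₈, Fin.sum_univ_eight, toLat, Vec8.bil]
  simp
  ring

/-- The lattice vector whose coordinates, increased by eight, are the hexadecimal digits of a
natural number. -/
def ofHex (n : ℕ) : Vec8 :=
  ⟨Int.subNatNat (Nat.div n 268435456) 8, Int.subNatNat (Nat.mod (Nat.div n 16777216) 16) 8,
    Int.subNatNat (Nat.mod (Nat.div n 1048576) 16) 8,
    Int.subNatNat (Nat.mod (Nat.div n 65536) 16) 8, Int.subNatNat (Nat.mod (Nat.div n 4096) 16) 8,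
    Int.subNatNat (Nat.mod (Nat.div n 256) 16) 8, Int.subNatNat (Nat.mod (Nat.div n 16) 16) 8,
    Int.subNatNat (Nat.mod n 16) 8⟩

theorem ofHex_eq (n : ℕ) : ofHex n = ⟨(n / 268435456 : ℕ) - 8, (n / 16777216 % 16 : ℕ) - 8,
    (n / 1048576 % 16 : ℕ) - 8, (n / 65536 % 16 : ℕ) - 8, (n / 4096 % 16 : ℕ) - 8,
    (n / 256 % 16 : ℕ) - 8, (n / 16 % 16 : ℕ) - 8, (n % 16 : ℕ) - 8⟩ := by
  simp only [ofHex, Int.subNatNat_eq_coe]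
  rfl

/-- The number with given hexadecimal digits. -/
def hexVal (z0 z1 z2 z3 z4 z5 z6 z7 : ℕ) : ℕ :=
  ((((((z0 * 16 + z1) * 16 + z2) * 16 + z3) * 16 + z4) * 16 + z5) * 16 + z6) * 16 + z7

theorem ofHex_hexVal (z0 : ℕ) {z1 z2 z3 z4 z5 z6 z7 : ℕ} (h1 : z1 < 16) (h2 : z2 < 16)
    (h3 : z3 < 16) (h4 : z4 < 16) (h5 : z5 < 16) (h6 : z6 < 16) (h7 : z7 < 16) :
    ofHex (hexVal z0 z1 z2 z3 z4 z5 z6 z7) =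
      ⟨z0 - 8, z1 - 8, z2 - 8, z3 - 8, z4 - 8, z5 - 8, z6 - 8, z7 - 8⟩ := by
  have hd : ∀ a b : ℕ, b < 16 → (a * 16 + b) / 16 = a := fun a b hb => by omega
  have hm : ∀ a b : ℕ, b < 16 → (a * 16 + b) % 16 = b := fun a b hb => by omega
  have hq : ∀ n : ℕ, n / 256 = n / 16 / 16 ∧ n / 4096 = n / 16 / 16 / 16 ∧
      n / 65536 = n / 16 / 16 / 16 / 16 ∧ n / 1048576 = n / 16 / 16 / 16 / 16 / 16 ∧
      n / 16777216 = n / 16 / 16 / 16 / 16 / 16 / 16 ∧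
      n / 268435456 = n / 16 / 16 / 16 / 16 / 16 / 16 / 16 := fun n => by
    simp only [Nat.div_div_eq_div_mul, and_self]
  obtain ⟨q2, q3, q4, q5, q6, q7⟩ := hq (hexVal z0 z1 z2 z3 z4 z5 z6 z7)
  rw [ofHex_eq, q2, q3, q4, q5, q6, q7, hexVal]
  simp only [hd _ _ h1, hd _ _ h2, hd _ _ h3, hd _ _ h4, hd _ _ h5, hd _ _ h6, hd _ _ h7,
    hm _ _ h1, hm _ _ h2, hm _ _ h3, hm _ _ h4, hm _ _ h5, hm _ _ h6, hm _ _ h7]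

theorem exists_hexVal (n : ℕ) : ∃ z0 z1 z2 z3 z4 z5 z6 z7 : ℕ,
    n = hexVal z0 z1 z2 z3 z4 z5 z6 z7 ∧ z1 < 16 ∧ z2 < 16 ∧ z3 < 16 ∧ z4 < 16 ∧ z5 < 16 ∧
      z6 < 16 ∧ z7 < 16 := by
  have h : ∀ n : ℕ, ∃ a b, n = a * 16 + b ∧ b < 16 := fun n =>
    ⟨n / 16, n % 16, by omega, Nat.mod_lt _ (by norm_num)⟩
  obtain ⟨n1, z7, rfl, h7⟩ := h n
  obtain ⟨n2, z6, rfl, h6⟩ := h n1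
  obtain ⟨n3, z5, rfl, h5⟩ := h n2
  obtain ⟨n4, z4, rfl, h4⟩ := h n3
  obtain ⟨n5, z3, rfl, h3⟩ := h n4
  obtain ⟨n6, z2, rfl, h2⟩ := h n5
  obtain ⟨n7, z1, rfl, h1⟩ := h n6
  exact ⟨n7, z1, z2, z3, z4, z5, z6, z7, rfl, h1, h2, h3, h4, h5, h6, h7⟩

theorem ofHex_injective : Function.Injective ofHex := by
  intro n m h
  obtain ⟨n0, n1, n2, n3, n4, n5, n6, n7, rfl, a1, a2, a3, a4, a5, a6, a7⟩ := exists_hexVal n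
  obtain ⟨m0, m1, m2, m3, m4, m5, m6, m7, rfl, b1, b2, b3, b4, b5, b6, b7⟩ := exists_hexVal m
  rw [ofHex_hexVal _ a1 a2 a3 a4 a5 a6 a7, ofHex_hexVal _ b1 b2 b3 b4 b5 b6 b7] at h
  simp only [Vec8.mk.injEq, sub_left_inj, Nat.cast_inj] at h
  obtain ⟨rfl, rfl, rfl, rfl, rfl, rfl, rfl, rfl⟩ := h
  rfl

/-- A bound for the coordinates of roots. -/
theorem abs_le_of_mem_roots : ∀ v ∈ roots, (-7 ≤ v.c0 ∧ v.c0 ≤ 7) ∧ (-7 ≤ v.c1 ∧ v.c1 ≤ 7) ∧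
    (-7 ≤ v.c2 ∧ v.c2 ≤ 7) ∧ (-7 ≤ v.c3 ∧ v.c3 ≤ 7) ∧ (-7 ≤ v.c4 ∧ v.c4 ≤ 7) ∧
    (-7 ≤ v.c5 ∧ v.c5 ≤ 7) ∧ (-7 ≤ v.c6 ∧ v.c6 ≤ 7) ∧ (-7 ≤ v.c7 ∧ v.c7 ≤ 7) := by
  intro v hv
  have h : ∀ v ∈ roots, ∀ x ∈ [v.c0, v.c1, v.c2, v.c3, v.c4, v.c5, v.c6, v.c7],
      x.natAbs ≤ 7 := by
    set_option maxRecDepth 10000 in decide +kernel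
  have := h v hv
  simp only [List.forall_mem_cons, List.not_mem_nil, IsEmpty.forall_iff, implies_true,
    and_true] at this
  omega

theorem ofHex_sub_add {n m : ℕ} (h : (ofHex n).add (ofHex m) ∈ roots) :
    ofHex (n + m - 2290649224) = (ofHex n).add (ofHex m) := by
  have h1 := abs_le_of_mem_roots _ h
  clear h
  obtain ⟨n0, n1, n2, n3, n4, n5, n6, n7, rfl, a1, a2, a3, a4, a5, a6, a7⟩ := exists_hexVal n
  obtain ⟨m0, m1, m2, m3, m4, m5, m6, m7, rfl, b1, b2, b3, b4, b5, b6, b7⟩ := exists_hexVal m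
  rw [ofHex_hexVal _ a1 a2 a3 a4 a5 a6 a7, ofHex_hexVal _ b1 b2 b3 b4 b5 b6 b7] at h1 ⊢
  simp only [Vec8.add] at h1 ⊢
  have hs : ∀ x y : ℕ, (-7 ≤ (x - 8 + (y - 8) : ℤ) ∧ (x - 8 + (y - 8) : ℤ) ≤ 7) →
      ∃ s : ℕ, x + y = s + 8 ∧ s < 16 ∧ (x - 8 + (y - 8) : ℤ) = s - 8 := fun x y h =>
    ⟨x + y - 8, by omega, by omega, by omega⟩
  obtain ⟨h0, h1, h2, h3, h4, h5, h6, h7⟩ := h1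
  obtain ⟨s0, t0, c0, e0⟩ := hs _ _ h0
  obtain ⟨s1, t1, c1, e1⟩ := hs _ _ h1
  obtain ⟨s2, t2, c2, e2⟩ := hs _ _ h2
  obtain ⟨s3, t3, c3, e3⟩ := hs _ _ h3
  obtain ⟨s4, t4, c4, e4⟩ := hs _ _ h4
  obtain ⟨s5, t5, c5, e5⟩ := hs _ _ h5
  obtain ⟨s6, t6, c6, e6⟩ := hs _ _ h6
  obtain ⟨s7, t7, c7, e7⟩ := hs _ _ h7
  rw [e0, e1, e2, e3, e4, e5, e6, e7, ← ofHex_hexVal s0 c1 c2 c3 c4 c5 c6 c7]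
  refine congrArg ofHex ?_
  clear h0 h1 h2 h3 h4 h5 h6 h7 e0 e1 e2 e3 e4 e5 e6 e7
  simp only [hexVal]
  omega

end Vec8
end E8

namespace E8

open Vec8

/-- The numerals that stand for basis vectors: `n < 8` for the simple coroots, and the sums
`∑ (vᵢ + 8) 16 ^ (7 - i)` for the roots `v`. -/
def IsKey (n : ℕ) : Prop := n < 8 ∨ IsRoot (ofHex n).toLat

/-- The basis vector with a given key. -/
noncomputable def keyGen (n : ℕ) : Model := if h : n < 8 then H ⟨n, h⟩ else E (ofHex n).toLat

/-- The coordinate with a given key. -/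
noncomputable def keyCoord (n : ℕ) : Model →ₗ[ℂ] ℂ :=
  open Classical in
  if h : n < 8 then bas.coord (.inl ⟨n, h⟩) else
    if h : IsRoot (ofHex n).toLat then bas.coord (.inr ⟨_, h⟩) else 0

theorem keyCoord_keyGen {n m : ℕ} (hn : IsKey n) (hm : IsKey m) :
    keyCoord n (keyGen m) = if n = m then 1 else 0 := by
  by_cases h1 : n < 8
  · by_cases h2 : m < 8
    · simp [keyCoord, keyGen, h1, h2, H, Finsupp.single_apply, eq_comm]
    · have hr := hm.resolve_left h2
      rw [if_neg (by omega)]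
      simp [keyCoord, keyGen, h1, h2, E, hr]
  · have hr := hn.resolve_left h1
    by_cases h2 : m < 8
    · rw [if_neg (by omega)]
      simp [keyCoord, keyGen, h1, h2, hr, H]
    · have hs := hm.resolve_left h2
      simp only [keyCoord, keyGen, h1, h2, hr, hs, E, dite_true, dite_false,
        Module.Basis.coord_apply,
        Module.Basis.repr_self, Finsupp.single_apply, Sum.inr.injEq, Subtype.mk.injEq,
        toLat_injective.eq_iff, ofHex_injective.eq_iff, eq_comm]

/-- A list of terms with integral coefficients represents a vector of the model. -/
inductive Rep : List (ℕ × ℤ) → Model → Prop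
  | nil : Rep [] 0
  | cons {k : ℕ} {c : ℤ} {w : List (ℕ × ℤ)} {x : Model} :
    IsKey k → Rep w x → Rep ((k, c) :: w) ((c : ℂ) • keyGen k + x)

/-- Force an integer. -/
noncomputable def forceInt {β : Type} (c : ℤ) (f : ℤ → β) : β :=
  Int.rec (fun n => force n fun n => f (Int.ofNat n)) (fun n => force n fun n => f (Int.negSucc n))
    c

theorem forceInt_eq {β : Type} (c : ℤ) (f : ℤ → β) : forceInt c f = f c := by
  cases c <;> simp only [forceInt, force_eq]

/-- Force a lattice vector. -/
noncomputable def forceVec8 {β : Type} (v : Vec8) (f : Vec8 → β) : β :=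
  Vec8.casesOn v fun c0 c1 c2 c3 c4 c5 c6 c7 =>
    forceInt c0 fun c0 => forceInt c1 fun c1 => forceInt c2 fun c2 => forceInt c3 fun c3 =>
    forceInt c4 fun c4 => forceInt c5 fun c5 => forceInt c6 fun c6 => forceInt c7 fun c7 =>
    f ⟨c0, c1, c2, c3, c4, c5, c6, c7⟩

theorem forceVec8_eq {β : Type} (v : Vec8) (f : Vec8 → β) : forceVec8 v f = f v := by
  cases v
  simp only [forceVec8, forceInt_eq]

/-- The root attached to a key. -/
noncomputable def keyVec (n : ℕ) : Vec8 :=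
  cond (Nat.blt n 8) ⟨cond (Nat.beq n 0) 1 0, cond (Nat.beq n 1) 1 0, cond (Nat.beq n 2) 1 0,
    cond (Nat.beq n 3) 1 0, cond (Nat.beq n 4) 1 0, cond (Nat.beq n 5) 1 0,
    cond (Nat.beq n 6) 1 0, cond (Nat.beq n 7) 1 0⟩ (ofHex n)

theorem beq_of_ne {n m : ℕ} (h : n ≠ m) : Nat.beq n m = false :=
  Bool.eq_false_iff.2 fun h' => h (Nat.eq_of_beq_eq_true h')

theorem blt_of_lt {n m : ℕ} (h : n < m) : Nat.blt n m = true := by rwa [Nat.blt_eq]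

theorem blt_of_not_lt {n m : ℕ} (h : ¬ n < m) : Nat.blt n m = false := by
  rw [Bool.eq_false_iff, ne_eq, Nat.blt_eq]; exact h

theorem keyVec_of_lt {n : ℕ} (h : n < 8) : (keyVec n).toLat = Pi.single ⟨n, h⟩ 1 := by
  have : ∀ i : Fin 8, (keyVec i).toLat = Pi.single i 1 := by
    intro i
    fin_cases i <;> ext j <;> fin_cases j <;> rfl
  exact this ⟨n, h⟩

theorem keyVec_of_le {n : ℕ} (h : ¬ n < 8) : keyVec n = ofHex n := by
  rw [keyVec, blt_of_not_lt h, cond_false]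

/-- The coefficients of minus a coroot. -/
def negCoroot (v : Vec8) : List (ℕ × ℤ) :=
  [(0, -v.c0), (1, -v.c1), (2, -v.c2), (3, -v.c3), (4, -v.c4), (5, -v.c5), (6, -v.c6), (7, -v.c7)]

theorem rep_negCoroot (v : Vec8) : Rep (negCoroot v) (-coroot v.toLat) := by
  have h : ∀ i : Fin 8, IsKey i ∧ keyGen i = H i := fun i => ⟨Or.inl i.2, by simp [keyGen]⟩
  have h2 : -coroot v.toLat = ((-v.c0 : ℤ) : ℂ) • keyGen 0 + (((-v.c1 : ℤ) : ℂ) • keyGen 1 +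
      (((-v.c2 : ℤ) : ℂ) • keyGen 2 + (((-v.c3 : ℤ) : ℂ) • keyGen 3 +
        (((-v.c4 : ℤ) : ℂ) • keyGen 4 +
      (((-v.c5 : ℤ) : ℂ) • keyGen 5 + (((-v.c6 : ℤ) : ℂ) • keyGen 6 +
      (((-v.c7 : ℤ) : ℂ) • keyGen 7 + 0))))))) := by
    rw [show keyGen 0 = H 0 from (h 0).2, show keyGen 1 = H 1 from (h 1).2,
      show keyGen 2 = H 2 from (h 2).2, show keyGen 3 = H 3 from (h 3).2,
      show keyGen 4 = H 4 from (h 4).2, show keyGen 5 = H 5 from (h 5).2,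
      show keyGen 6 = H 6 from (h 6).2, show keyGen 7 = H 7 from (h 7).2]
    simp only [coroot, Fin.sum_univ_eight, toLat]
    simp
    abel
  rw [h2]
  exact .cons (h 0).1 <| .cons (h 1).1 <| .cons (h 2).1 <| .cons (h 3).1 <| .cons (h 4).1 <|
    .cons (h 5).1 <| .cons (h 6).1 <| .cons (h 7).1 .nil

/-- The sign `(-1) ^ n`. -/
def sign (n : ℤ) : ℤ := cond (Nat.beq (Nat.mod (Int.natAbs n) 2) 0) 1 (-1)

theorem sign_bil (v w : Vec8) : ((sign (v.bil w) : ℤ) : ℂ) = eps v.toLat w.toLat := by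
  rw [eps, bil_toLat, sign]
  rcases Int.even_or_odd (v.bil w) with h | h
  · rw [Int.negOnePow_even _ h, show Nat.beq (Nat.mod (v.bil w).natAbs 2) 0 = true from
      by rw [Nat.beq_eq]; exact Nat.even_iff.1 (Int.natAbs_even.2 h)]
    rfl
  · have : Nat.beq (Nat.mod (v.bil w).natAbs 2) 0 = false := by
      have h2 : (v.bil w).natAbs.mod 2 = 1 := Nat.odd_iff.1 (Int.natAbs_odd.2 h)
      rw [h2]; rfl
    rw [Int.negOnePow_odd _ h, this]
    rfl

/-- The bracket of two root vectors, given their inner product. -/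
noncomputable def lieRoots (o a b : ℕ) (va vb : Vec8) (i : ℤ) : List (ℕ × ℤ) :=
  Int.casesOn i (fun _ => []) fun n =>
    cond (Nat.beq n 0) (force (Nat.sub (Nat.add a b) o) fun k => [(k, sign (va.bil vb))])
      (cond (Nat.beq n 1) (negCoroot va) [])

theorem lieRoots_neg_one (o a b : ℕ) (va vb : Vec8) :
    lieRoots o a b va vb (-1) = [(a + b - o, sign (va.bil vb))] :=
  force_eq (a + b - o) fun k => [(k, sign (va.bil vb))]

/-- The bracket of two basis vectors. -/
noncomputable def lieKey (a b : ℕ) : List (ℕ × ℤ) :=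
  forceVec8 (keyVec a) fun va => forceVec8 (keyVec b) fun vb => forceInt (va.ip vb) fun i =>
    cond (Nat.blt a 8) (cond (Nat.blt b 8) [] [(b, i)])
      (cond (Nat.blt b 8) [(a, Int.neg i)] (lieRoots 2290649224 a b va vb i))

theorem Rep.single {k : ℕ} (hk : IsKey k) (c : ℤ) : Rep [(k, c)] ((c : ℂ) • keyGen k) := by
  simpa using Rep.cons (c := c) hk .nil

theorem not_isRoot_of_lt {n : ℕ} (h : n < 8) : ¬ IsRoot (ofHex n).toLat := by
  have h2 : ∀ i : Fin 8, (ofHex i).ip (ofHex i) ≠ 2 := by decide +kernel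
  exact fun h3 => h2 ⟨n, h⟩ ((ip_toLat _ _).symm.trans h3)

theorem rep_lieRoots {a b : ℕ} (ha : ¬ a < 8) (hb : ¬ b < 8) (hva : IsRoot (ofHex a).toLat)
    (hvb : IsRoot (ofHex b).toLat) :
    Rep (lieRoots 2290649224 a b (ofHex a) (ofHex b) ((ofHex a).ip (ofHex b)))
      ⁅keyGen a, keyGen b⁆ := by
  simp only [keyGen, ha, hb, dite_false]
  rw [lie_E_E hva hvb, ip_toLat]
  set i := (ofHex a).ip (ofHex b) with hi
  obtain h | h | h : i = -1 ∨ i = -2 ∨ (i ≠ -1 ∧ i ≠ -2) := by omega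
  · have hs : IsRoot ((ofHex a).toLat + (ofHex b).toLat) := hva.add hvb (by rw [ip_toLat, ← hi, h])
    rw [← toLat_add] at hs
    obtain ⟨w, hw, hw'⟩ := exists_mem_roots hs
    rw [toLat_injective hw'] at hw
    obtain ⟨k, h3, hk⟩ : ∃ k, ofHex k = (ofHex a).add (ofHex b) ∧
        lieRoots 2290649224 a b (ofHex a) (ofHex b) i =
          [(k, sign ((ofHex a).bil (ofHex b)))] :=
      ⟨_, ofHex_sub_add hw, by rw [h, lieRoots_neg_one]⟩
    rw [hk, if_pos h, ← sign_bil, ← toLat_add, ← h3]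
    rw [← h3] at hs
    have h8 : ¬ k < 8 := by
      intro h8
      exact not_isRoot_of_lt h8 hs
    have := Rep.single (Or.inr hs) (sign ((ofHex a).bil (ofHex b)))
    rwa [keyGen, dif_neg h8] at this
  · rw [if_neg (by omega), if_pos h, h]
    exact rep_negCoroot _
  · rw [if_neg h.1, if_neg h.2]
    have hlr : lieRoots 2290649224 a b (ofHex a) (ofHex b) i = [] := by
      obtain n | n := i
      · rfl
      · have h0 : n ≠ 0 := by rintro rfl; exact h.1 rfl
        have h1 : n ≠ 1 := by rintro rfl; exact h.2 rfl
        obtain ⟨m, rfl⟩ : ∃ m, n = m + 2 := ⟨n - 2, by omega⟩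
        rfl
    rw [hlr]
    exact .nil

theorem rep_lieKey {a b : ℕ} (ha : IsKey a) (hb : IsKey b) :
    Rep (lieKey a b) ⁅keyGen a, keyGen b⁆ := by
  simp only [lieKey, forceVec8_eq, forceInt_eq]
  by_cases h1 : a < 8
  · by_cases h2 : b < 8
    · rw [blt_of_lt h1, blt_of_lt h2, cond_true, cond_true, keyGen, keyGen, dif_pos h1,
        dif_pos h2, lie_H_H]
      exact .nil
    · rw [blt_of_lt h1, blt_of_not_lt h2, cond_true, cond_false, ← ip_toLat, keyVec_of_lt h1,
        keyVec_of_le h2]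
      have := Rep.single hb (ip (Pi.single ⟨a, h1⟩ 1) (ofHex b).toLat)
      rw [keyGen, keyGen, dif_pos h1, dif_neg h2, lie_H_E]
      rwa [keyGen, dif_neg h2] at this
  · by_cases h2 : b < 8
    · rw [blt_of_not_lt h1, blt_of_lt h2, cond_true, cond_false, ← ip_toLat, keyVec_of_lt h2,
        keyVec_of_le h1]
      have := Rep.single ha (-ip (Pi.single ⟨b, h2⟩ 1) (ofHex a).toLat)
      rw [keyGen, keyGen, dif_pos h2, dif_neg h1, ← lie_skew, lie_H_E, ← neg_smul, ← Int.cast_neg,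
        ip_comm]
      rw [keyGen, dif_neg h1, ip_comm] at this
      rw [ip_comm] at this
      exact this
    · rw [blt_of_not_lt h1, blt_of_not_lt h2, cond_false, cond_false, keyVec_of_le h1,
        keyVec_of_le h2]
      exact rep_lieRoots h1 h2 (ha.resolve_left h1) (hb.resolve_left h2)

/-- Add a term to a vector. -/
noncomputable def addTerm (k : ℕ) (c : ℤ) (w : List (ℕ × ℤ)) : List (ℕ × ℤ) :=
  List.rec [(k, c)] (fun p w ih => Prod.casesOn p fun k' c' =>
    cond (Nat.beq k k') ((k', Int.add c c') :: w) ((k', c') :: ih)) w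

theorem Rep.addTerm {k : ℕ} (hk : IsKey k) (c : ℤ) {w : List (ℕ × ℤ)} {x : Model} (h : Rep w x) :
    Rep (addTerm k c w) ((c : ℂ) • keyGen k + x) := by
  induction h with
  | nil => exact .cons hk .nil
  | @cons k' c' w x hk' hw ih =>
    change Rep (cond (Nat.beq k k') ((k', c + c') :: w) ((k', c') :: E8.addTerm k c w)) _
    by_cases h : k = k'
    · subst h
      rw [Nat.beq_refl, cond_true, ← add_assoc, ← add_smul, ← Int.cast_add]
      exact .cons hk' hw
    · rw [beq_of_ne h, cond_false, add_left_comm]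
      exact .cons hk' ih

/-- Add a multiple of a vector to a vector. -/
noncomputable def addMul (c : ℤ) (t w : List (ℕ × ℤ)) : List (ℕ × ℤ) :=
  List.rec w (fun p _ ih => Prod.casesOn p fun k d => addTerm k (Int.mul c d) ih) t

theorem Rep.addMul (c : ℤ) {t w : List (ℕ × ℤ)} {x y : Model} (ht : Rep t y) (hw : Rep w x) :
    Rep (addMul c t w) ((c : ℂ) • y + x) := by
  induction ht with
  | nil => simpa [E8.addMul] using hw
  | @cons k d t y hk ht ih =>
    have := ih.addTerm hk (c * d)
    rwa [Int.cast_mul, mul_smul, ← add_assoc, ← smul_add] at this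

/-- Normalise a vector, dropping zero coefficients, and pass it on. -/
noncomputable def normalize {β : Type} (w : List (ℕ × ℤ)) : (List (ℕ × ℤ) → β) → β :=
  List.rec (fun f => f []) (fun p _ ih f => Prod.casesOn p fun k c => forceInt c fun c =>
    Int.casesOn c
      (fun n => Nat.casesOn n (ih f) fun n => force k fun k => ih fun w =>
        f ((k, Int.ofNat (Nat.succ n)) :: w))
      fun n => force k fun k => ih fun w => f ((k, Int.negSucc n) :: w)) w

theorem Rep.normalize {w : List (ℕ × ℤ)} {x : Model} (h : Rep w x) :
    ∃ w', Rep w' x ∧ ∀ {β : Type} (f : List (ℕ × ℤ) → β), normalize w f = f w' := by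
  induction h with
  | nil => exact ⟨[], .nil, fun f => rfl⟩
  | @cons k c w x hk hw ih =>
    obtain ⟨w', h1, h2⟩ := ih
    obtain (_ | n) | n := c
    · refine ⟨w', by simpa using h1, fun f => ?_⟩
      exact h2 f
    · refine ⟨(k, Int.ofNat (Nat.succ n)) :: w', .cons hk h1, fun f => ?_⟩
      change force k (fun k => E8.normalize w fun w => f ((k, Int.ofNat (Nat.succ n)) :: w)) = _
      rw [force_eq, h2]
    · refine ⟨(k, Int.negSucc n) :: w', .cons hk h1, fun f => ?_⟩
      rw [show E8.normalize ((k, Int.negSucc n) :: w) f = force n fun n => force k fun k =>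
        E8.normalize w fun w => f ((k, Int.negSucc n) :: w) from rfl, force_eq]
      rw [force_eq, h2]

/-- Add a multiple of the bracket of a basis vector and a vector. -/
noncomputable def addLie (k : ℕ) (c : ℤ) (w acc : List (ℕ × ℤ)) : List (ℕ × ℤ) :=
  List.rec acc (fun q _ ih => Prod.casesOn q fun m d => addMul (Int.mul c d) (lieKey k m) ih) w

theorem Rep.addLie {k : ℕ} (hk : IsKey k) (c : ℤ) {w acc : List (ℕ × ℤ)} {x y : Model}
    (hw : Rep w x) (ha : Rep acc y) : Rep (addLie k c w acc) ((c : ℂ) • ⁅keyGen k, x⁆ + y) := by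
  induction hw with
  | nil => simpa [E8.addLie] using ha
  | @cons m d w x hm hw ih =>
    have := (rep_lieKey hk hm).addMul (c * d) ih
    rw [lie_add, lie_smul, smul_add, smul_smul, add_assoc, ← Int.cast_mul]
    exact this

/-- The bracket of two vectors. -/
noncomputable def lieVec (u w : List (ℕ × ℤ)) : List (ℕ × ℤ) :=
  List.rec [] (fun p _ ih => Prod.casesOn p fun k c => addLie k c w ih) u

theorem Rep.lie {u w : List (ℕ × ℤ)} {x y : Model} (hu : Rep u x) (hw : Rep w y) :
    Rep (lieVec u w) ⁅x, y⁆ := by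
  induction hu with
  | nil => simpa [lieVec] using Rep.nil
  | @cons k c u x hk hu ih =>
    rw [add_lie, smul_lie]
    exact Rep.addLie hk c hw ih

/-- The coefficient of a basis vector. -/
noncomputable def coef (k : ℕ) (w : List (ℕ × ℤ)) : ℤ :=
  List.rec 0 (fun p _ ih => Prod.casesOn p fun k' c' => cond (Nat.beq k k') (Int.add c' ih) ih) w

theorem Rep.keyCoord {k : ℕ} (hk : IsKey k) {w : List (ℕ × ℤ)} {x : Model} (h : Rep w x) :
    keyCoord k x = coef k w := by
  induction h with
  | nil => simp [coef]
  | @cons k' c' w x hk' hw ih =>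
    change _ = ((cond (Nat.beq k k') (c' + coef k w) (coef k w) : ℤ) : ℂ)
    rw [map_add, map_smul, ih, keyCoord_keyGen hk hk']
    by_cases h : k = k'
    · subst h
      simp
    · simp [beq_of_ne h, h]

end E8

namespace E8

open Vec8

/-- Whether an integer is zero. -/
noncomputable def isZero (d : ℤ) : Bool := Int.casesOn d (fun n => Nat.beq n 0) fun _ => false

theorem isZero_iff {d : ℤ} : isZero d = true ↔ d = 0 := by
  obtain (_ | n) | n := d
  · exact ⟨fun _ => rfl, fun _ => rfl⟩
  · exact ⟨nofun, fun h => absurd (Int.ofNat.inj h) (Nat.succ_ne_zero n)⟩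
  · exact ⟨nofun, nofun⟩

theorem isZero_of_ne {d : ℤ} (h : d ≠ 0) : isZero d = false :=
  Bool.eq_false_iff.2 fun hz => h (isZero_iff.1 hz)

/-- Apply a vector valued function to the members of a list, normalise and pass the result on. -/
noncomputable def mapNormalize {α β : Type} (g : α → List (ℕ × ℤ)) (L : List α) :
    (List (List (ℕ × ℤ)) → β) → β :=
  List.rec (fun f => f []) (fun a _ ih f => normalize (g a) fun w => ih fun L => f (w :: L)) L

theorem exists_mapNormalize {α : Type} {g : α → List (ℕ × ℤ)} {L : List α} {S : Submodule ℂ Model}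
    (h : ∀ a ∈ L, ∃ x ∈ S, Rep (g a) x) :
    ∃ L' : List (List (ℕ × ℤ)), (∀ w ∈ L', ∃ x ∈ S, Rep w x) ∧
      ∀ {β : Type} (f : List (List (ℕ × ℤ)) → β), mapNormalize g L f = f L' := by
  induction L with
  | nil => exact ⟨[], by simp, fun f => rfl⟩
  | cons a L ih =>
    obtain ⟨L', h1, h2⟩ := ih fun b hb => h b (List.mem_cons_of_mem _ hb)
    obtain ⟨x, hx, hr⟩ := h a List.mem_cons_self
    obtain ⟨w, h3, h4⟩ := hr.normalize
    refine ⟨w :: L', ?_, fun f => ?_⟩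
    · rintro u (_ | ⟨_, hu⟩)
      exacts [⟨x, hx, h3⟩, h1 u hu]
    · exact (h4 fun w => mapNormalize g L fun L => f (w :: L)).trans (h2 _)

/-- Eliminate a coordinate with the help of a pivot. -/
noncomputable def eliminate (k : ℕ) (c : ℤ) (r w : List (ℕ × ℤ)) : List (ℕ × ℤ) :=
  forceInt (coef k w) fun d => cond (isZero d) w (addMul c w (addMul (Int.neg d) r []))

theorem Rep.eliminate {k : ℕ} (hk : IsKey k) {r w : List (ℕ × ℤ)} {x y : Model} (hr : Rep r x)
    (hw : Rep w y) {S : Submodule ℂ Model} (hx : x ∈ S) (hy : y ∈ S) :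
    ∃ z ∈ S ⊓ LinearMap.ker (E8.keyCoord k), Rep (E8.eliminate k (coef k r) r w) z := by
  rw [E8.eliminate, forceInt_eq]
  by_cases h : coef k w = 0
  · rw [isZero_iff.2 h, cond_true]
    exact ⟨y, ⟨hy, by rw [SetLike.mem_coe, LinearMap.mem_ker, hw.keyCoord hk, h, Int.cast_zero]⟩,
      hw⟩
  · rw [isZero_of_ne h, cond_false]
    refine ⟨_, ⟨?_, ?_⟩, hw.addMul (coef k r) (hr.addMul (-coef k w) .nil)⟩
    · exact S.add_mem (S.smul_mem _ hy) (S.add_mem (S.smul_mem _ hx) S.zero_mem)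
    · rw [SetLike.mem_coe, LinearMap.mem_ker, map_add, map_add, map_smul, map_smul,
        hw.keyCoord hk, hr.keyCoord hk, map_zero, smul_eq_mul, smul_eq_mul, Int.cast_neg]
      ring

/-- A lower bound for the rank of a family of vectors, by fraction free elimination. -/
noncomputable def rank (n : ℕ) : List (List (ℕ × ℤ)) → ℕ :=
  Nat.rec (fun _ => 0) (fun _ ih L => List.casesOn L 0 fun r L => List.casesOn r (ih L) fun p _ =>
    Prod.casesOn p fun k _ => forceInt (coef k r) fun c =>
      cond (isZero c) 0 (mapNormalize (eliminate k c r) L fun L => Nat.succ (ih L))) n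

theorem rank_le (n : ℕ) : ∀ (L : List (List (ℕ × ℤ))) (S : Submodule ℂ Model),
    (∀ w ∈ L, ∃ x ∈ S, Rep w x) → rank n L ≤ Module.finrank ℂ S := by
  induction n with
  | zero => exact fun L S h => Nat.zero_le _
  | succ n ih =>
    intro L S h
    obtain _ | ⟨_ | ⟨⟨k, d⟩, r⟩, L⟩ := L
    · exact Nat.zero_le _
    · exact ih L S fun w hw => h w (List.mem_cons_of_mem _ hw)
    · obtain ⟨x, hx, hr⟩ := h _ List.mem_cons_self
      have hk : IsKey k := by cases hr; assumption
      change forceInt (coef k ((k, d) :: r)) (fun c => cond (isZero c) 0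
        (mapNormalize (eliminate k c ((k, d) :: r)) L fun L => Nat.succ (rank n L))) ≤ _
      rw [forceInt_eq]
      by_cases hc : coef k ((k, d) :: r) = 0
      · rw [isZero_iff.2 hc]
        exact Nat.zero_le _
      · rw [isZero_of_ne hc, cond_false]
        obtain ⟨L', h1, h2⟩ := exists_mapNormalize (g := eliminate k (coef k ((k, d) :: r)) _)
          (L := L) (S := S ⊓ LinearMap.ker (keyCoord k)) fun w hw => by
            obtain ⟨y, hy, hw⟩ := h w (List.mem_cons_of_mem _ hw)
            exact hr.eliminate hk hw hx hy
        rw [h2]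
        refine (ih L' _ h1).trans_lt (Submodule.finrank_lt_finrank_of_lt
          (lt_of_le_of_ne inf_le_left fun h => hc ?_))
        rw [← h] at hx
        have := hx.2
        rw [SetLike.mem_coe, LinearMap.mem_ker, hr.keyCoord hk] at this
        exact_mod_cast this

/-- Whether a numeral is a key. -/
noncomputable def keyOK (n : ℕ) : Bool :=
  cond (Nat.blt n 8) true (forceVec8 (ofHex n) fun v => isZero (v.ip v - 2))

theorem isKey_of_keyOK {n : ℕ} (h : keyOK n = true) : IsKey n := by
  by_cases h8 : n < 8
  · exact Or.inl h8
  · rw [keyOK, blt_of_not_lt h8, cond_false, forceVec8_eq, isZero_iff, sub_eq_zero] at h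
    exact Or.inr ((ip_toLat _ _).trans h)

/-- Decode the terms of a vector, and pass the result on. -/
noncomputable def decode {β : Type} (L : List ℕ) : (List (ℕ × ℤ) → β) → β :=
  List.rec (fun f => f []) (fun t _ ih f => force (Nat.mod t 4294967296) fun k =>
    cond (keyOK k) (forceInt (Int.subNatNat (Nat.div t 4294967296) 8) fun c =>
      ih fun w => f ((k, c) :: w)) (ih f)) L

theorem exists_decode (L : List ℕ) : ∃ w x, Rep w x ∧
    ∀ {β : Type} (f : List (ℕ × ℤ) → β), decode L f = f w := by
  induction L with
  | nil => exact ⟨[], 0, .nil, fun f => rfl⟩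
  | cons t L ih =>
    obtain ⟨w, x, h1, h2⟩ := ih
    have h : ∀ {β : Type} (f : List (ℕ × ℤ) → β), decode (t :: L) f =
      force (Nat.mod t 4294967296) fun k =>
        cond (keyOK k) (forceInt (Int.subNatNat (Nat.div t 4294967296) 8) fun c =>
          decode L fun w => f ((k, c) :: w)) (decode L f) := fun f => rfl
    simp only [force_eq, forceInt_eq, h2] at h
    cases hk : keyOK (Nat.mod t 4294967296)
    · exact ⟨w, x, h1, fun f => by rw [h, hk, cond_false]⟩
    · exact ⟨_, _, .cons (isKey_of_keyOK hk) h1, fun f => by rw [h, hk, cond_true]⟩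

/-- Decode a list of vectors, and pass the result on. -/
noncomputable def decodeList {β : Type} (L : List (List ℕ)) :
    (List (List (ℕ × ℤ)) → β) → β :=
  List.rec (fun f => f []) (fun t _ ih f => decode t fun w => ih fun L => f (w :: L)) L

theorem exists_decodeList (L : List (List ℕ)) : ∃ L', (∀ w ∈ L', ∃ x, Rep w x) ∧
    ∀ {β : Type} (f : List (List (ℕ × ℤ)) → β), decodeList L f = f L' := by
  induction L with
  | nil => exact ⟨[], by simp, fun f => rfl⟩
  | cons t L ih =>
    obtain ⟨L', h1, h2⟩ := ih
    obtain ⟨w, x, h3, h4⟩ := exists_decode t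
    refine ⟨w :: L', ?_, fun f => ?_⟩
    · rintro u (_ | ⟨_, hu⟩)
      exacts [⟨x, h3⟩, h1 u hu]
    · exact (h4 fun w => decodeList L fun L => f (w :: L)).trans (h2 _)

/-- The weight of a basis vector. -/
noncomputable def weight (l : Vec8) (n : ℕ) : ℤ :=
  cond (Nat.blt n 8) 0 (forceVec8 (ofHex n) fun v => v.c0 * l.c0 + v.c1 * l.c1 + v.c2 * l.c2 +
    v.c3 * l.c3 + v.c4 * l.c4 + v.c5 * l.c5 + v.c6 * l.c6 + v.c7 * l.c7)

theorem keyGen_mem_wtSpace {v : Lat} {l : Vec8} (hl : ∀ i, ip v (Pi.single i 1) = l.toLat i)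
    {n : ℕ} (hn : IsKey n) : keyGen n ∈ wtSpace v (weight l n) := by
  by_cases h : n < 8
  · rw [weight, blt_of_lt h, cond_true, keyGen, dif_pos h]
    have := bas_mem_wtSpace (v := v) (.inl ⟨n, h⟩)
    rwa [wt, show ip v 0 = 0 by simp [ip]] at this
  · rw [weight, blt_of_not_lt h, cond_false, forceVec8_eq, keyGen, dif_neg h]
    have hr := hn.resolve_left h
    have := bas_mem_wtSpace (v := v) (.inr ⟨_, hr⟩)
    rw [wt, ip_comm, ip_eq_sum, Fin.sum_univ_eight] at this
    simp only [hl] at this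
    rw [E, dif_pos hr]
    exact this

/-- Whether a vector is homogeneous of a given weight. -/
noncomputable def hasWeight (l : Vec8) (k : ℤ) (w : List (ℕ × ℤ)) : Bool :=
  List.rec true (fun p _ ih => cond (isZero (weight l p.1 - k)) ih false) w

theorem Rep.mem_wtSpace {v : Lat} {l : Vec8} (hl : ∀ i, ip v (Pi.single i 1) = l.toLat i) {k : ℤ}
    {w : List (ℕ × ℤ)} {x : Model} (h : Rep w x) (hw : hasWeight l k w = true) :
    x ∈ wtSpace v k := by
  induction h with
  | nil => exact zero_mem _
  | @cons n c w x hn h ih =>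
    change cond (isZero (weight l n - k)) (hasWeight l k w) false = true at hw
    rw [Bool.cond_false_right, Bool.and_eq_true, isZero_iff, sub_eq_zero] at hw
    refine add_mem (Submodule.smul_mem _ _ ?_) (ih hw.2)
    rw [← hw.1]
    exact keyGen_mem_wtSpace hl hn

end E8

namespace E8

open Vec8

/-! ### The Killing form in coordinates -/

/-- The value of the Killing form at a pair of opposite root vectors. -/
noncomputable def killingConst : ℂ :=
  killingForm ℂ Model (E (Pi.single 0 1)) (E (-Pi.single 0 1))

theorem ip_mul_killing {u : Lat} (hu : IsRoot u) (w : Lat) :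
    (ip w u : ℂ) * killingForm ℂ Model (E u) (E (-u)) =
      -killingForm ℂ Model (coroot u) (coroot w) := by
  have h0 : ip u (-u) = -2 := by rw [ip_neg_right]; exact congrArg Neg.neg hu
  have h1 : ⁅E u, E (-u)⁆ = -coroot u := by
    rw [lie_E_E hu hu.neg, if_neg (by omega), if_pos h0]
  have h2 := killing_lie (E u) (E (-u)) (coroot w)
  rw [h1, ← lie_skew, lie_coroot_E, ip_neg_right, Int.cast_neg, neg_smul, neg_neg, map_smul,
    smul_eq_mul, map_neg, LinearMap.neg_apply] at h2
  exact h2.symm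

theorem killing_E_neg_eq_of_ip_ne_zero {u w : Lat} (hu : IsRoot u) (hw : IsRoot w)
    (h : ip u w ≠ 0) :
    killingForm ℂ Model (E u) (E (-u)) = killingForm ℂ Model (E w) (E (-w)) := by
  have h1 := ip_mul_killing hu w
  have h2 := ip_mul_killing hw u
  rw [killing_comm (coroot u), ← h2, ip_comm] at h1
  exact mul_left_cancel₀ (Int.cast_ne_zero.2 h) h1

theorem killing_E_neg {u : Lat} (hu : IsRoot u) :
    killingForm ℂ Model (E u) (E (-u)) = killingConst := by
  have hs : ∀ i j : Fin 8, CartanMatrix.E₈ i j ≠ 0 →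
      killingForm ℂ Model (E (Pi.single i 1)) (E (-Pi.single i 1)) =
        killingForm ℂ Model (E (Pi.single j 1)) (E (-Pi.single j 1)) := fun i j h =>
    killing_E_neg_eq_of_ip_ne_zero (isRoot_single i) (isRoot_single j) (by rwa [ip_single_single])
  have h2 := hs 2 0 (by decide)
  have h3 := (hs 3 2 (by decide)).trans h2
  have h1 := (hs 1 3 (by decide)).trans h3
  have h4 := (hs 4 3 (by decide)).trans h3
  have h5 := (hs 5 4 (by decide)).trans h4
  have h6 := (hs 6 5 (by decide)).trans h5
  have h7 := (hs 7 6 (by decide)).trans h6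
  obtain ⟨i, hi⟩ := exists_pos_coord hu
  rw [killing_E_neg_eq_of_ip_ne_zero hu (isRoot_single i) (right_ne_zero_of_mul hi.ne')]
  fin_cases i
  exacts [rfl, h1, h2, h3, h4, h5, h6, h7]

theorem killingConst_ne_zero : killingConst ≠ 0 := killing_E_neg_ne_zero (isRoot_single 0)

theorem ofHex_sub {n : ℕ} (h : ofHex n ∈ roots) : ofHex (4581298448 - n) = (ofHex n).neg := by
  have h1 := abs_le_of_mem_roots _ h
  clear h
  obtain ⟨n0, n1, n2, n3, n4, n5, n6, n7, rfl, a1, a2, a3, a4, a5, a6, a7⟩ := exists_hexVal n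
  rw [ofHex_hexVal _ a1 a2 a3 a4 a5 a6 a7] at h1 ⊢
  simp only [Vec8.neg] at h1 ⊢
  have hs : ∀ x : ℕ, (-7 ≤ (x - 8 : ℤ) ∧ (x - 8 : ℤ) ≤ 7) →
      ∃ s : ℕ, s + x = 16 ∧ s < 16 ∧ -(x - 8 : ℤ) = s - 8 := fun x h =>
    ⟨16 - x, by omega, by omega, by omega⟩
  obtain ⟨h0, h1, h2, h3, h4, h5, h6, h7⟩ := h1
  obtain ⟨s0, t0, c0, e0⟩ := hs _ h0
  obtain ⟨s1, t1, c1, e1⟩ := hs _ h1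
  obtain ⟨s2, t2, c2, e2⟩ := hs _ h2
  obtain ⟨s3, t3, c3, e3⟩ := hs _ h3
  obtain ⟨s4, t4, c4, e4⟩ := hs _ h4
  obtain ⟨s5, t5, c5, e5⟩ := hs _ h5
  obtain ⟨s6, t6, c6, e6⟩ := hs _ h6
  obtain ⟨s7, t7, c7, e7⟩ := hs _ h7
  rw [e0, e1, e2, e3, e4, e5, e6, e7, ← ofHex_hexVal s0 c1 c2 c3 c4 c5 c6 c7]
  refine congrArg ofHex ?_
  clear h0 h1 h2 h3 h4 h5 h6 h7 e0 e1 e2 e3 e4 e5 e6 e7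
  simp only [hexVal]
  omega

/-- The sum of the keys of opposite roots. -/
def oppositeSum : ℕ := 4581298448

theorem killing_keyGen {a b : ℕ} (ha : IsKey a) (ha8 : ¬ a < 8) (hb8 : ¬ b < 8) :
    killingForm ℂ Model (keyGen a) (keyGen b) =
      if a + b = oppositeSum then killingConst else 0 := by
  have hra := ha.resolve_left ha8
  obtain ⟨w, hw, hw'⟩ := exists_mem_roots hra
  rw [toLat_injective hw'] at hw
  have h := ofHex_sub hw
  rw [keyGen, keyGen, dif_neg ha8, dif_neg hb8]
  split_ifs with hab
  · have h2 : b = 4581298448 - a := by rw [oppositeSum] at hab; omega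
    rw [h2, h, toLat_neg, killing_E_neg hra]
  · refine killing_E_E fun h0 => hab ?_
    rw [← sub_neg_eq_add, sub_eq_zero, ← toLat_neg, toLat_injective.eq_iff] at h0
    have h2 : (ofHex b).neg.neg = ofHex b := by simp [Vec8.neg]
    have h3 : b = 4581298448 - a := ofHex_injective (by rw [h, h0, h2])
    have h5 : a ≤ 4581298448 := by
      by_contra h5
      omega
    rw [oppositeSum]
    omega

/-- Whether the keys of a vector stand for root vectors. -/
noncomputable def onRoots (w : List (ℕ × ℤ)) : Bool :=
  List.rec true (fun p _ ih => cond (Nat.blt p.1 8) false ih) w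

/-- The pairing of a basis vector and a vector by the normalised Killing form. -/
noncomputable def pairKey (s k : ℕ) (w : List (ℕ × ℤ)) : ℤ :=
  List.rec 0 (fun p _ ih => Prod.casesOn p fun m d =>
    cond (Nat.beq (Nat.add k m) s) (Int.add d ih) ih) w

/-- The pairing of two vectors by the normalised Killing form. -/
noncomputable def pair (s : ℕ) (u w : List (ℕ × ℤ)) : ℤ :=
  List.rec 0 (fun p _ ih => Prod.casesOn p fun k c => Int.add (Int.mul c (pairKey s k w)) ih) u

theorem onRoots_cons {k : ℕ} {c : ℤ} {w : List (ℕ × ℤ)} (h : onRoots ((k, c) :: w) = true) :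
    ¬ k < 8 ∧ onRoots w = true := by
  change cond (Nat.blt k 8) false (onRoots w) = true at h
  by_cases hk : k < 8
  · rw [blt_of_lt hk] at h
    cases h
  · rw [blt_of_not_lt hk] at h
    exact ⟨hk, h⟩

theorem Rep.killing_keyGen {k : ℕ} (hk : IsKey k) (hk8 : ¬ k < 8) {w : List (ℕ × ℤ)} {x : Model}
    (hw : Rep w x) (h : onRoots w = true) :
    killingForm ℂ Model (keyGen k) x = killingConst * pairKey oppositeSum k w := by
  induction hw with
  | nil => simp [pairKey]
  | @cons m d w x hm hw ih =>
    obtain ⟨hm8, h⟩ := onRoots_cons h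
    change _ = killingConst * ((cond (Nat.beq (k + m) oppositeSum)
      (d + pairKey oppositeSum k w) (pairKey oppositeSum k w) : ℤ) : ℂ)
    rw [map_add, map_smul, ih h, E8.killing_keyGen hk hk8 hm8]
    split_ifs with hs
    · rw [hs, Nat.beq_refl, cond_true, smul_eq_mul]
      push_cast
      ring
    · rw [beq_of_ne hs, cond_false, smul_zero, zero_add]

theorem Rep.killing {u w : List (ℕ × ℤ)} {x y : Model} (hu : Rep u x) (hw : Rep w y)
    (h1 : onRoots u = true) (h2 : onRoots w = true) :
    killingForm ℂ Model x y = killingConst * pair oppositeSum u w := by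
  induction hu with
  | nil => simp [pair]
  | @cons k c u x hk hu ih =>
    obtain ⟨hk8, h1⟩ := onRoots_cons h1
    change _ = killingConst * ((c * pairKey oppositeSum k w + pair oppositeSum u w : ℤ) : ℂ)
    rw [map_add, map_smul, LinearMap.add_apply, LinearMap.smul_apply, ih h1,
      hw.killing_keyGen hk hk8 h2, smul_eq_mul]
    push_cast
    ring

end E8

namespace E8

open Vec8

/-! ### Certificates -/

/-- The vector `e₀` has weight two and its orbit under the weight zero part is open. -/
def IsGeneric (v : Lat) (e₀ : Model) : Prop :=
  e₀ ∈ wtSpace v 2 ∧ ∀ y ∈ wtSpace v 2, ∃ x ∈ wtSpace v 0, ⁅x, e₀⁆ = y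

/-- The labels and the dimensions of the weight spaces of a vector of the lattice. -/
structure HasLabels (v : Lat) (l : Vec8) (N : ℕ) : Prop where
  ip_eq : ∀ i, ip v (Pi.single i 1) = l.toLat i
  finrank_eq : ∀ k : ℕ, Module.finrank ℂ (wtSpace v k) = wtDim N k

/-- Whether two vectors commute. -/
noncomputable def commutes (u w : List (ℕ × ℤ)) : Bool :=
  normalize (lieVec u w) fun w => List.casesOn w true fun _ _ => false

theorem Rep.eq_zero {x : Model} (h : Rep [] x) : x = 0 := by
  cases h
  rfl

theorem Rep.lie_eq_zero {u w : List (ℕ × ℤ)} {x y : Model} (hu : Rep u x) (hw : Rep w y)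
    (h : commutes u w = true) : ⁅x, y⁆ = 0 := by
  obtain ⟨t, h1, h2⟩ := (hu.lie hw).normalize
  rw [commutes, h2] at h
  cases t with
  | nil => exact h1.eq_zero
  | cons => cases h

/-- Check that the orbit of a vector is open, and pass the vector on. -/
noncomputable def checkGeneric (l : Vec8) (N : ℕ) (e o : List ℕ)
    (f : List (ℕ × ℤ) → Bool) : Bool :=
  decode e fun e => decode o fun o => hasWeight l 2 e && hasWeight l 0 o &&
    mapNormalize (fun p => lieVec [p] e) o (fun L => Nat.ble (wtDim N 2) (rank 256 L)) && f e

theorem Rep.exists_mem_wtSpace {v : Lat} {l : Vec8}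
    (hl : ∀ i, ip v (Pi.single i 1) = l.toLat i) {k : ℤ} {w : List (ℕ × ℤ)} {x : Model}
    (h : Rep w x) (hw : hasWeight l k w = true) : ∀ p ∈ w, ∃ y ∈ wtSpace v k, Rep [p] y := by
  induction h with
  | nil => simp
  | @cons n c w x hn h ih =>
    change cond (isZero (weight l n - k)) (hasWeight l k w) false = true at hw
    rw [Bool.cond_false_right, Bool.and_eq_true] at hw
    rintro p (_ | ⟨_, hp⟩)
    · refine ⟨_, (Rep.single hn c).mem_wtSpace hl ?_, Rep.single hn c⟩
      change cond (isZero (weight l n - k)) true false = true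
      rw [hw.1, cond_true]
    · exact ih hw.2 p hp

theorem exists_isGeneric {v : Lat} {l : Vec8} {N : ℕ} (V : HasLabels v l N) {e o : List ℕ}
    {f : List (ℕ × ℤ) → Bool} (h : checkGeneric l N e o f = true) :
    ∃ w e₀, Rep w e₀ ∧ IsGeneric v e₀ ∧ f w = true := by
  obtain ⟨w, e₀, hw, h1⟩ := exists_decode e
  obtain ⟨u, x, hu, h2⟩ := exists_decode o
  rw [checkGeneric, h1, h2, Bool.and_eq_true, Bool.and_eq_true, Bool.and_eq_true] at h
  obtain ⟨⟨⟨h3, h4⟩, h5⟩, h6⟩ := h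
  have he := hw.mem_wtSpace V.ip_eq h3
  obtain ⟨S, hS⟩ : ∃ S, S = (wtSpace v 0).map (LieAlgebra.ad ℂ Model e₀ : Module.End ℂ Model) :=
    ⟨_, rfl⟩
  have hS' : ∀ x, x ∈ S ↔ ∃ y ∈ wtSpace v 0, ⁅y, e₀⁆ = x := fun x => by
    rw [hS]
    constructor
    · rintro ⟨y, hy, rfl⟩
      exact ⟨-y, neg_mem hy, by rw [neg_lie, lie_skew]; rfl⟩
    · rintro ⟨y, hy, rfl⟩
      exact ⟨-y, neg_mem hy, (lie_neg e₀ y).trans (lie_skew y e₀)⟩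
  obtain ⟨L, h7, h8⟩ := exists_mapNormalize (g := fun p => lieVec [p] w) (L := u) (S := S)
    fun p hp => by
      obtain ⟨y, hy, hr⟩ := hu.exists_mem_wtSpace V.ip_eq h4 p hp
      exact ⟨_, (hS' _).2 ⟨y, hy, rfl⟩, hr.lie hw⟩
  rw [h8] at h5
  have h9 := (Nat.ble_eq.mp h5).trans (rank_le 256 L S h7)
  have hle : S ≤ wtSpace v 2 := fun x hx => by
    obtain ⟨y, hy, rfl⟩ := (hS' x).1 hx
    rw [← zero_add (2 : ℤ)]
    exact lie_mem_wtSpace hy he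
  have h11 := V.finrank_eq 2
  rw [Nat.cast_ofNat] at h11
  have h10 := Submodule.eq_of_le_of_finrank_le hle (h11.le.trans h9)
  refine ⟨w, e₀, hw, ⟨he, fun y hy => ?_⟩, h6⟩
  rw [← h10] at hy
  exact (hS' y).1 hy

/-- Check that a vector commutes with a nonzero vector of negative weight. -/
noncomputable def checkSpurious (l : Vec8) (d : ℕ) (x : List ℕ) (e : List (ℕ × ℤ)) : Bool :=
  decode x fun x => hasWeight l (Int.negSucc d) x && commutes e x && Nat.ble 1 (rank 1 [x])

theorem not_isTriple_of_checkSpurious {v : Lat} {l : Vec8} {N : ℕ} (V : HasLabels v l N) {d : ℕ}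
    {x : List ℕ} {w : List (ℕ × ℤ)} {e₀ : Model} (hw : Rep w e₀)
    (h : checkSpurious l d x w = true) (f : Model) : ¬ IsTriple (coroot v) e₀ f := by
  intro T
  obtain ⟨u, y, hu, h1⟩ := exists_decode x
  rw [checkSpurious, h1, Bool.and_eq_true, Bool.and_eq_true] at h
  obtain ⟨⟨h2, h3⟩, h4⟩ := h
  have h5 := T.eq_zero_of_neg (Int.negSucc_lt_zero d) (hu.mem_wtSpace V.ip_eq h2)
    (hw.lie_eq_zero hu h3)
  have h6 := (Nat.ble_eq.mp h4).trans (rank_le 1 [u] ⊥ (by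
    rintro _ (_ | ⟨_, ⟨⟩⟩)
    exact ⟨y, h5, hu⟩))
  rw [finrank_bot] at h6
  omega

/-- The member of a list of vectors at a given place. -/
noncomputable def nth {α : Type} (n : ℕ) : List (List α) → List α :=
  Nat.rec (fun L => List.casesOn L [] fun a _ => a)
    (fun _ ih L => List.casesOn L [] fun _ L => ih L) n

theorem exists_rep_nth {S : Submodule ℂ Model} {L : List (List (ℕ × ℤ))}
    (h : ∀ w ∈ L, ∃ x ∈ S, Rep w x) (n : ℕ) : ∃ x ∈ S, Rep (nth n L) x := by
  induction n generalizing L with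
  | zero =>
    cases L with
    | nil => exact ⟨0, zero_mem _, .nil⟩
    | cons w L => exact h w List.mem_cons_self
  | succ n ih =>
    cases L with
    | nil => exact ⟨0, zero_mem _, .nil⟩
    | cons w L => exact ih fun u hu => h u (List.mem_cons_of_mem _ hu)

/-- The subalgebra generated by the part of weight one of a centraliser. -/
noncomputable def genByOne (v : Lat) (e : Model) : LieSubalgebra ℂ Model :=
  LieSubalgebra.lieSpan ℂ Model {x | ⁅e, x⁆ = 0 ∧ ⁅coroot v, x⁆ = x}

theorem cent_one_le (v : Lat) (e : Model) : cent v e 1 ≤ (genByOne v e).toSubmodule := by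
  intro x hx
  obtain ⟨h1, h2⟩ := mem_cent.1 hx
  refine LieSubalgebra.subset_lieSpan ⟨h2, ?_⟩
  rw [mem_wtSpace.1 h1, Int.cast_one, one_smul]

/-- Check that the centraliser is generated in weight one, from a given weight on. -/
noncomputable def checkLevels (N : ℕ) (X : List (List (ℕ × ℤ))) (P : List (List (ℕ × ℕ))) :
    ℕ → List (List (ℕ × ℤ)) → Bool :=
  List.rec (fun k _ => Nat.beq (Nat.div N (Nat.pow 256 k)) 0) (fun p _ ih k B =>
    mapNormalize (fun q => lieVec (nth (Prod.fst q) X) (nth (Prod.snd q) B)) p fun L =>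
      Nat.ble (wtDim N k) (Nat.add (wtDim N (Nat.add k 2)) (rank 256 L)) &&
        ih (Nat.succ k) L) P

theorem lie_mem_cent {v : Lat} {e x y : Model} {k l : ℤ} (hx : x ∈ cent v e k)
    (hy : y ∈ cent v e l) : ⁅x, y⁆ ∈ cent v e (k + l) := by
  rw [mem_cent] at *
  refine ⟨lie_mem_wtSpace hx.1 hy.1, ?_⟩
  rw [leibniz_lie, hx.2, hy.2, zero_lie, lie_zero, add_zero]

theorem finrank_cent_le {v : Lat} {l : Vec8} {N : ℕ} (V : HasLabels v l N) {e₀ f : Model}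
    (T : IsTriple (coroot v) e₀ f) {k r : ℕ}
    (h : Nat.ble (wtDim N k) (wtDim N (k + 2) + r) = true) :
    Module.finrank ℂ (cent v e₀ k) ≤ r := by
  have h1 := T.finrank_cent_add (k := k) (by omega)
  have h2 := V.finrank_eq (k + 2)
  rw [Nat.cast_add, Nat.cast_ofNat] at h2
  have h3 := Nat.ble_eq.mp h
  rw [h2, V.finrank_eq k] at h1
  omega

theorem cent_le_of_checkLevels {v : Lat} {l : Vec8} {N : ℕ} (V : HasLabels v l N) {e₀ f : Model}
    (T : IsTriple (coroot v) e₀ f) {X : List (List (ℕ × ℤ))}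
    (hX : ∀ w ∈ X, ∃ x ∈ cent v e₀ 1, Rep w x) (P : List (List (ℕ × ℕ))) (k : ℕ)
    (B : List (List (ℕ × ℤ))) (hk : 1 ≤ k)
    (hB : ∀ w ∈ B, ∃ x ∈ cent v e₀ k ⊓ (genByOne v e₀).toSubmodule, Rep w x)
    (h : checkLevels N X P (k + 1) B = true) (m : ℕ) (hm : k < m) :
    cent v e₀ m ≤ (genByOne v e₀).toSubmodule := by
  induction P generalizing k B with
  | nil =>
    have h1 : N / 256 ^ (k + 1) = 0 := Nat.eq_of_beq_eq_true h
    have h2 : N / 256 ^ m = 0 := by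
      refine Nat.eq_zero_of_le_zero (h1 ▸ Nat.div_le_div_left ?_ (by positivity))
      exact Nat.pow_le_pow_right (by norm_num) hm
    have h3 := V.finrank_eq m
    rw [wtDim, if_neg (by omega), h2, Nat.zero_mod, Submodule.finrank_eq_zero] at h3
    exact (inf_le_left.trans h3.le).trans bot_le
  | cons p P ih =>
    obtain ⟨L, h1, h2⟩ := exists_mapNormalize
      (g := fun q : ℕ × ℕ => lieVec (nth q.1 X) (nth q.2 B)) (L := p)
      (S := cent v e₀ ((k + 1 : ℕ) : ℤ) ⊓ (genByOne v e₀).toSubmodule) fun q _ => by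
        obtain ⟨x, hx, hx'⟩ := exists_rep_nth hX q.1
        obtain ⟨y, hy, hy'⟩ := exists_rep_nth hB q.2
        refine ⟨⁅x, y⁆, ⟨?_, (genByOne v e₀).lie_mem (cent_one_le v e₀ hx) hy.2⟩, hx'.lie hy'⟩
        rw [Nat.cast_add, Nat.cast_one, add_comm]
        exact lie_mem_cent hx hy.1
    replace h : mapNormalize (fun q : ℕ × ℕ => lieVec (nth q.1 X) (nth q.2 B)) p (fun L =>
      Nat.ble (wtDim N (k + 1)) (wtDim N (k + 1 + 2) + rank 256 L) &&
        checkLevels N X P (k + 1 + 1) L) = true := h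
    rw [h2, Bool.and_eq_true] at h
    obtain rfl | hlt := eq_or_lt_of_le (Nat.succ_le_of_lt hm)
    · have h3 := Submodule.eq_of_le_of_finrank_le inf_le_left
        ((finrank_cent_le V T h.1).trans (rank_le 256 L _ h1))
      exact (h3.symm.le.trans inf_le_right :)
    · exact ih (k + 1) L (by omega) h1 h.2 hlt

/-- Check that the centraliser is generated in weight one. -/
noncomputable def checkGenerated (l : Vec8) (N : ℕ) (X : List (List ℕ)) (P : List (List (ℕ × ℕ)))
    (e : List (ℕ × ℤ)) : Bool :=
  decodeList X fun X => X.all (fun x => hasWeight l 1 x && commutes e x) && checkLevels N X P 2 X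

theorem cent_le_of_checkGenerated {v : Lat} {l : Vec8} {N : ℕ} (V : HasLabels v l N)
    {w : List (ℕ × ℤ)} {e₀ f : Model} (hw : Rep w e₀) (T : IsTriple (coroot v) e₀ f)
    {X : List (List ℕ)} {P : List (List (ℕ × ℕ))} (h : checkGenerated l N X P w = true) (m : ℕ)
    (hm : 1 ≤ m) : cent v e₀ m ≤ (genByOne v e₀).toSubmodule := by
  obtain ⟨L, h1, h2⟩ := exists_decodeList X
  rw [checkGenerated, h2, Bool.and_eq_true, List.all_eq_true] at h
  have hX : ∀ u ∈ L, ∃ x ∈ cent v e₀ (1 : ℕ), Rep u x := fun u hu => by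
    obtain ⟨x, hx⟩ := h1 u hu
    have h3 := h.1 u hu
    rw [Bool.and_eq_true] at h3
    exact ⟨x, mem_cent.2 ⟨hx.mem_wtSpace V.ip_eq h3.1, hw.lie_eq_zero hx h3.2⟩, hx⟩
  obtain rfl | hm := eq_or_lt_of_le hm
  · exact cent_one_le v e₀
  · exact cent_le_of_checkLevels V T hX P 1 L le_rfl (fun u hu => by
      obtain ⟨x, hx, hr⟩ := hX u hu
      exact ⟨x, ⟨hx, cent_one_le v e₀ hx⟩, hr⟩) h.2 m hm

/-- Check that a vector is separated from the derived algebra of its centraliser by the pairing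
with a given vector. -/
noncomputable def checkSeparated (l : Vec8) (N s : ℕ) (y : List ℕ) (Z X : List (List ℕ))
    (e : List (ℕ × ℤ)) : Bool :=
  decode y fun y => decodeList Z fun Z => decodeList X fun X =>
    hasWeight l (-2) y && (onRoots y && onRoots e && !isZero (pair s y e)) &&
    (Z.all (fun z => hasWeight l 0 z && commutes e z && commutes y z) &&
      Nat.ble (wtDim N 0) (Nat.add (wtDim N 2) (rank 256 Z))) &&
    (X.all (fun x => hasWeight l 1 x && commutes e x && onRoots x) &&
      Nat.ble (wtDim N 1) (Nat.add (wtDim N 3) (rank 256 X))) &&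
    X.all fun x => normalize (lieVec y x) fun w =>
      onRoots w && X.all fun x => isZero (pair s w x)

theorem cent_eq_span {v : Lat} {l : Vec8} {N : ℕ} (V : HasLabels v l N) {e₀ f : Model}
    (T : IsTriple (coroot v) e₀ f) {k : ℕ} {L : List (List (ℕ × ℤ))}
    (h : ∀ w ∈ L, ∃ x, Rep w x ∧ x ∈ cent v e₀ k)
    (hr : Nat.ble (wtDim N k) (wtDim N (k + 2) + rank 256 L) = true) :
    cent v e₀ k = Submodule.span ℂ {x | x ∈ cent v e₀ k ∧ ∃ w ∈ L, Rep w x} := by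
  refine (Submodule.eq_of_le_of_finrank_le (Submodule.span_le.2 fun x hx => hx.1)
    ((finrank_cent_le V T hr).trans (rank_le 256 L _ fun w hw => ?_))).symm
  obtain ⟨x, h1, h2⟩ := h w hw
  exact ⟨x, Submodule.subset_span ⟨h2, w, hw, h1⟩, h1⟩

end E8

namespace E8

open Vec8

theorem not_reach_of_checkSeparated {v : Lat} {l : Vec8} {N : ℕ} (V : HasLabels v l N)
    {w : List (ℕ × ℤ)} {e₀ f : Model} (hw : Rep w e₀) (T : IsTriple (coroot v) e₀ f)
    {y : List ℕ} {Z X : List (List ℕ)} (h : checkSeparated l N oppositeSum y Z X w = true) :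
    ¬ Reach e₀ := by
  intro he
  obtain ⟨u, y, hu, h1⟩ := exists_decode y
  obtain ⟨Z, hZ, h2⟩ := exists_decodeList Z
  obtain ⟨X, hX, h3⟩ := exists_decodeList X
  rw [checkSeparated, h1, h2, h3] at h
  simp only [Bool.and_eq_true, List.all_eq_true, Bool.not_eq_true'] at h
  obtain ⟨⟨⟨⟨h4, ⟨h5, h6⟩, h7⟩, h8, h9⟩, h10, h11⟩, h12⟩ := h
  have hy := hu.mem_wtSpace V.ip_eq h4
  have hZ' := cent_eq_span V T (k := 0) (L := Z) (fun z hz => by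
    obtain ⟨x, hx⟩ := hZ z hz
    exact ⟨x, hx, mem_cent.2 ⟨hx.mem_wtSpace V.ip_eq (h8 z hz).1.1,
      hw.lie_eq_zero hx (h8 z hz).1.2⟩⟩) h9
  have hX' := cent_eq_span V T (k := 1) (L := X) (fun z hz => by
    obtain ⟨x, hx⟩ := hX z hz
    exact ⟨x, hx, mem_cent.2 ⟨hx.mem_wtSpace V.ip_eq (h10 z hz).1.1,
      hw.lie_eq_zero hx (h10 z hz).1.2⟩⟩) h11
  rw [Nat.cast_zero] at hZ'
  rw [Nat.cast_one] at hX'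
  have h13 := T.functional_eq_zero he (killingForm ℂ Model y)
    (fun k hk x hx => killing_eq_zero (by omega) hy hx) (fun x hx z _ => by
      have h14 : ⁅y, x⁆ = 0 := by
        rw [hZ'] at hx
        induction hx using Submodule.span_induction with
        | mem x hx =>
          obtain ⟨-, t, ht, hr⟩ := hx
          exact hu.lie_eq_zero hr (h8 t ht).2
        | zero => exact lie_zero y
        | add a b _ _ ha hb => rw [lie_add, ha, hb, add_zero]
        | smul c a _ ha => rw [lie_smul, ha, smul_zero]
      rw [← killing_lie, h14, map_zero, LinearMap.zero_apply])
    (fun x hx z hz => by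
      rw [← killing_lie]
      rw [hX'] at hx hz
      induction hx using Submodule.span_induction with
      | mem x hx =>
        obtain ⟨-, t, ht, hr⟩ := hx
        obtain ⟨s, hs, h14⟩ := (hu.lie hr).normalize
        have h15 := h12 t ht
        rw [h14, Bool.and_eq_true, List.all_eq_true] at h15
        induction hz using Submodule.span_induction with
        | mem z hz =>
          obtain ⟨-, t', ht', hr'⟩ := hz
          rw [hs.killing hr' h15.1 (h10 t' ht').2, isZero_iff.1 (h15.2 t' ht'), Int.cast_zero,
            mul_zero]
        | zero => exact map_zero _
        | add a b _ _ ha hb => rw [map_add, ha, hb, add_zero]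
        | smul c a _ ha => rw [map_smul, ha, smul_zero]
      | zero => rw [lie_zero, map_zero, LinearMap.zero_apply]
      | add a b _ _ ha hb => rw [lie_add, map_add, LinearMap.add_apply, ha, hb, add_zero]
      | smul c a _ ha => rw [lie_smul, map_smul, LinearMap.smul_apply, ha, smul_zero])
  rw [hu.killing hw h5 h6, mul_eq_zero, Int.cast_eq_zero] at h13
  rw [isZero_iff.2 (h13.resolve_left killingConst_ne_zero)] at h7
  cases h7

/-- A certificate for a labelling. The labels of `spurious` do not belong to any triple, the ones
of `generated` belong to triples with centralisers generated in weight one, and the ones of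
`separated` to triples which are not reachable. -/
inductive Certificate
  | spurious (e o : List ℕ) (d : ℕ) (x : List ℕ)
  | generated (e o : List ℕ) (X : List (List ℕ)) (P : List (List (ℕ × ℕ)))
  | separated (e o y : List ℕ) (Z X : List (List ℕ))

/-- Check a certificate. -/
noncomputable def Certificate.check (l : Vec8) (N : ℕ) (C : Certificate) : Bool :=
  Certificate.casesOn C (fun e o d x => checkGeneric l N e o (checkSpurious l d x))
    (fun e o X P => checkGeneric l N e o (checkGenerated l N X P))
    (fun e o y Z X => checkGeneric l N e o (checkSeparated l N oppositeSum y Z X))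

theorem exists_isGeneric_of_check {v : Lat} {l : Vec8} {N : ℕ} (V : HasLabels v l N)
    {C : Certificate} (h : C.check l N = true) : ∃ e₀, IsGeneric v e₀ ∧
      ∀ f, IsTriple (coroot v) e₀ f → Reach e₀ → ∀ m : ℕ, 1 ≤ m →
        cent v e₀ m ≤ (genByOne v e₀).toSubmodule := by
  cases C with
  | spurious e o d x =>
    obtain ⟨w, e₀, hw, hg, h⟩ := exists_isGeneric V h
    exact ⟨e₀, hg, fun f T => (not_isTriple_of_checkSpurious V hw h f T).elim⟩
  | generated e o X P =>
    obtain ⟨w, e₀, hw, hg, h⟩ := exists_isGeneric V h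
    exact ⟨e₀, hg, fun f T _ => cent_le_of_checkGenerated V hw T h⟩
  | separated e o y Z X =>
    obtain ⟨w, e₀, hw, hg, h⟩ := exists_isGeneric V h
    exact ⟨e₀, hg, fun f T hr => (not_reach_of_checkSeparated V hw T h hr).elim⟩

/-- Check a certificate for the labels with a given code. -/
noncomputable def checkCode (n : ℕ) (C : Certificate) : Bool :=
  forceVec8 (ofDigits n) fun l => force (hist [n % 10, n / 10 % 10, n / 100 % 10, n / 1000 % 10,
    n / 10000 % 10, n / 100000 % 10, n / 1000000 % 10, n / 10000000]) fun N => C.check l N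

theorem digits_eq {b₀ b₁ b₂ b₃ b₄ b₅ b₆ b₇ n : ℕ} (h₇ : b₇ ≤ 2) (h₆ : b₆ ≤ 2) (h₅ : b₅ ≤ 2)
    (h₄ : b₄ ≤ 2) (h₃ : b₃ ≤ 2) (h₂ : b₂ ≤ 2) (h₁ : b₁ ≤ 2)
    (h : b₇ + 10 * (b₆ + 10 * (b₅ + 10 * (b₄ + 10 * (b₃ + 10 * (b₂ + 10 * (b₁ + 10 * b₀)))))) = n) :
    n % 10 = b₇ ∧ n / 10 % 10 = b₆ ∧ n / 100 % 10 = b₅ ∧ n / 1000 % 10 = b₄ ∧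
      n / 10000 % 10 = b₃ ∧ n / 100000 % 10 = b₂ ∧ n / 1000000 % 10 = b₁ ∧ n / 10000000 = b₀ := by
  refine ⟨?_, ?_, ?_, ?_, ?_, ?_, ?_, ?_⟩ <;> omega

theorem hasLabels {v : Lat} {a : Fin 8 → ℕ} (ha : ∀ i, a i ≤ 2)
    (hv : ∀ i, ip v (Pi.single i 1) = a i) {n : ℕ}
    (hn : Nat.ofDigits 10 [a 7, a 6, a 5, a 4, a 3, a 2, a 1, a 0] = n) :
    HasLabels v (ofDigits n) (hist [n % 10, n / 10 % 10, n / 100 % 10, n / 1000 % 10,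
      n / 10000 % 10, n / 100000 % 10, n / 1000000 % 10, n / 10000000]) := by
  have h : a 7 + 10 * (a 6 + 10 * (a 5 + 10 * (a 4 + 10 * (a 3 + 10 *
      (a 2 + 10 * (a 1 + 10 * a 0)))))) = n := by
    rw [← hn]
    simp [Nat.ofDigits_cons]
  obtain ⟨d7, d6, d5, d4, d3, d2, d1, d0⟩ :=
    digits_eq (ha 7) (ha 6) (ha 5) (ha 4) (ha 3) (ha 2) (ha 1) h
  constructor
  · intro i
    rw [hv, ofDigits, toLat, d0, d1, d2, d3, d4, d5, d6, d7]
    fin_cases i <;> rfl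
  · intro k
    rw [finrank_eq_wtDim hv, d0, d1, d2, d3, d4, d5, d6, d7]

theorem exists_isGeneric_of_checkCode {v : Lat} {a : Fin 8 → ℕ} (ha : ∀ i, a i ≤ 2)
    (hv : ∀ i, ip v (Pi.single i 1) = a i) {n : ℕ}
    (hn : Nat.ofDigits 10 [a 7, a 6, a 5, a 4, a 3, a 2, a 1, a 0] = n) {C : Certificate}
    (h : checkCode n C = true) : ∃ e₀, IsGeneric v e₀ ∧
      ∀ f, IsTriple (coroot v) e₀ f → Reach e₀ → ∀ m : ℕ, 1 ≤ m →
        cent v e₀ m ≤ (genByOne v e₀).toSubmodule := by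
  rw [checkCode, forceVec8_eq, force_eq] at h
  exact exists_isGeneric_of_check (hasLabels ha hv hn) h

end E8

namespace E8

/-- The certificates for all labels. -/
def certificates : List (ℕ × Certificate) := [
  (00000001, .generated
    [41537166522]
    [38654705671]
    [[40945354889], [40945354905], [40945355161], [40945359257], [40945424793], [40946473369],
    [40962202009], [40963250585], [40963316121], [40963320217], [40963320473], [40963320489],
    [41214908825], [41231686041], [41231751577], [41231755673], [41231755929], [41231755945],
    [41232800153], [41232804249], [41232804505], [41232804521], [41232869785], [41232870041],
    [41232870057], [41232874137], [41232874153], [41232874409], [41249647001], [41249647257],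
    [41249647273], [41249651353], [41249651369], [41249651625], [41249716889], [41249716905],
    [41249717161], [41249721257], [41250765465], [41250765481], [41250765737], [41250769833],
    [41250835369], [41267612585], [41519200921], [41519200937], [41519201193], [41519205289],
    [41519270825], [41520319401], [41536048041], [41537096617], [41537162153], [41537166249],
    [41537166505], [41537166521]]
    [[(0, 55)]]),
  (00000010, .generated
    [41232874409, 41249647273, 41537166249]
    [38654705670, 40641062792, 40657840008, 40657905544, 40657909896, 40658954120, 40658958472,
    40659024008, 40659028104, 40675801224, 40927389576, 40927393928, 40927459464, 40927463560,
    40928508040, 40928512136, 40928577672, 40944236680, 40945285256, 40945350792, 40945355144,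
    40945359240, 40945424776, 40946473352, 41214908808, 38654705665, 38654705668]
    [[40945354904], [40945354905], [40945359256], [40945359257], [40945424792], [40945424793],
    [40946473368], [40946473369], [40962202008], [40962202009], [40963250584], [40963250585],
    [40963316120], [40963316121], [40963320216], [40963320217], [40963320472], [40963320473],
    [41214908824], [41214908825], [41231686040], [41231686041], [41231751576], [41231751577],
    [41231755672], [41231755673], [41231755928], [41231755929], [41232800152], [41232800153],
    [41232804248], [41232804249], [41232804504], [41232804505], [41232869784], [41232869785],
    [41232870040], [41232870041], [32355420568, 41232874136], [32355420569, 41232874137],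
    [40945355160, 41249647000], [40945355161, 41249647001], [41249647256], [41249647257],
    [41249651352], [41249651353], [41249716888], [41249716889], [41250765464], [41250765465],
    [41519200920], [41519200921]]
    [[(0, 17), (0, 27), (0, 33), (0, 37), (0, 39), (0, 43), (0, 45), (0, 47), (0, 49), (0, 51), (2,
    37), (2, 43), (2, 47), (2, 49), (2, 51), (4, 43), (4, 49), (4, 51), (6, 43), (6, 51), (8, 49),
    (8, 51), (10, 51), (12, 51), (14, 51), (16, 51), (18, 43)], [(0, 25), (1, 25)]]),
  (00000100, .generated
    [41232804505, 41232870040, 41249651352, 41249716905]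
    [40658958472, 40659024008, 40675870856, 40927393928, 40927459464, 40928512136, 40928577672,
    40944306312, 40945285256, 40945350792, 40945354871, 40945354872, 40945354887, 40945354904,
    40945424520, 40946403464, 40946469000, 40962197640, 40963315848, 41214838920, 41214904456,
    41231751304, 38654705665, 38654705666, 40928508040, 40945289352, 40945354889, 40945420424,
    38654705669, 38654705671]
    [[40945355160], [40945359256], [40945424776], [40945359257, 40945424792], [32355424648,
    40945424793], [40946473368], [40962201992], [32355420569, 40962202008], [40945355144,
    40962202009], [40963250584], [40963316104], [32373315993, 40963316120], [40963250568,
    40963316121], [40963320200], [32356538777, 40963320216], [40946473352, 40963320217],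
    [41214908824], [41231686040], [41231751560], [32641751449, 41231751576], [41231686024,
    41231751577], [41231755656], [32624974233, 41231755672], [41214908808, 41231755673],
    [41232800152], [41232804248], [41232869768], [32642869657, 41232869784], [41232804232,
    41232869785], [41249646984], [41232800153, 41249647000], [32642865544, 41249647001]]
    [[(0, 13), (0, 15), (0, 21), (0, 23), (0, 26), (0, 27), (0, 29), (0, 31), (1, 26), (1, 28), (1,
    29), (2, 11), (2, 19), (2, 27), (2, 31), (5, 29), (5, 31), (6, 30), (10, 27), (16, 29), (16,
    31), (18, 27), (0, 28), (1, 31), (2, 30), (3, 29), (3, 31)], [(0, 13), (0, 14), (0, 18), (0,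
    21), (0, 25), (1, 14), (1, 18), (1, 21), (2, 16), (2, 20), (5, 21), (6, 16), (6, 20), (9, 21),
    (10, 20), (13, 20)], [(0, 15), (2, 13), (3, 14)]]),
  (00000101, .separated
    [40946473369, 40962202009, 40963320472, 41519200920] [38654705669, 40657909896, 40658958472,
    40659024008, 40659028104, 40675801224, 40675805320, 40675870856, 40676919432, 40928508040,
    40928512136, 40928577672, 40946403464, 40946469000, 40946473096, 38654705665, 41213790344,
    41214838920, 41214904456, 41214908552, 41231681672, 41231685768, 41231751304, 41232799880,
    38654705664, 38654705671]
    [40371508856]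
    [[38654705665, 38654705666], [38654705667], [38654705668], [38654705670], [40927393928],
    [40927459464], [40927463560], [32338573448, 40944236680], [32338577544, 40944240776],
    [32338643080, 40944306312], [40945285256], [40945289352], [40945350792], [40945354872],
    [40945354904], [40945358984], [40945420424], [40945424520], [32356468872, 40962132104],
    [32356534408, 40962197640], [32356538504, 40962201736], [40963246216], [40963250312],
    [40963315848]]
    [[40945355144], [40945355160], [40945359240], [40945359256], [40945424776], [40945424792],
    [32356538760, 40962201992], [32356538776, 40962202008], [40963250568], [40963250584],
    [40963316104], [40963316120], [40963320200], [40963320216]]),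
  (00001000, .generated
    [40963320200, 40963320489, 41231755673, 41232804505, 41232870040, 41249647000]
    [40659028104, 40675805320, 40675870856, 40676919432, 40927463560, 40928512136, 40928577672,
    40944240776, 40944306312, 40945289352, 40945420424, 40946403464, 40946469000, 40962132104,
    40962197640, 40963246216, 38654705665, 38654705666, 38654705667, 40945354615, 40945354616,
    40945354871, 40945354872, 40945354904, 40945354905, 40945355160, 40945355161, 38654705664,
    38654705668, 38654705670]
    [[40945359256], [40946473096], [40962201992], [32355489928, 40946473352, 40963250312],
    [32355490184, 32372267144, 40963250568], [40945359257, 40945424792, 40963250584], [32355490201,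
    32373315993, 40963316120], [40963316121], [32356538776, 41214908552], [32355424392,
    41214908824], [40945424792, 32373315992, 41214908808, 41231685768], [40962202008, 41231686024],
    [32355424648, 41231686040], [32372267417, 41231751560], [32355490184, 32373315976, 41231686041,
    32641816984], [32373381512, 41231751577], [32356538777, 41232799880], [40945424793,
    32373315993, 32641816712, 41232800136], [32355489928, 32373315720, 41214908825, 41232800152],
    [40963315848, 41232800153]]
    [[(0, 7), (0, 13), (0, 16), (1, 2), (1, 15), (2, 19), (0, 15), (0, 17), (0, 19), (1, 11), (1,
    13), (1, 14), (2, 8), (2, 16), (2, 18), (3, 15), (5, 15), (5, 19), (8, 13), (11, 16)], [(0, 4),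
    (0, 5), (0, 10), (0, 13), (1, 5), (1, 16), (2, 4), (2, 17), (0, 15), (1, 14), (2, 11), (3, 16),
    (8, 5), (8, 14), (8, 16), (9, 5)], [(0, 4), (0, 6), (0, 12), (1, 7), (1, 15), (2, 5), (2, 14),
    (6, 12), (8, 7), (11, 5)], [(0, 7), (1, 6), (2, 4), (5, 7)]]),
  (00001010, .spurious
    [40945359256, 40945424793, 41231686041, 41232800152, 41249646984] [38654705664, 40675805320,
    40676919432, 40928512136, 40944240776, 40944306312, 40945289352, 40946403464, 40962132104,
    40962197640, 41214838920, 41214904456, 38654705666, 38654705668, 40675870856, 40927463560,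
    40928577672, 40945354887, 40945354889, 40945420424, 40946469000, 40963246216, 38654705665,
    38654705670, 40659028104]
    0
    [40675800968]),
  (00001012, .separated
    [40945354889, 40962202008, 41214908824, 41249646984] [38654705664, 38654705666, 40659028104,
    40675805320, 40675870856, 40676919432, 40927463560, 40946403464, 40946469000, 40962132104,
    40962197640, 40963246216, 40928512136, 40928577672, 38654705665, 38654705671]
    [40945354887]
    [[38654705667], [38654705668], [38654705669], [38654705664, 42949672961, 47244640258,
    42949672966, 38654705671], [40944240776], [40944306312], [40945289352], [40945354632],
    [40945355144], [40945420424], [41213790344], [32372197512, 41214838920], [32372263048,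
    41214904456], [41231681672]]
    [[40945358984], [40945359240], [40945424520], [40945424776], [32372267144, 41214908552],
    [32372267400, 41214908808], [41231685768], [41231686024], [41231751304], [41231751560]]),
  (00010000, .generated
    [40963320200, 40963320489, 41231751577, 41231755928, 41232799880, 41232804505]
    [40945350792, 40945354872, 40945354889, 40945355144, 40945358984, 40945359257, 38654705667,
    38654705668, 40675870856, 40676919432, 40944306312, 40945350519, 40945350520, 40945354616,
    40945354632, 40945354871, 40945354887, 40945354904, 40945354905, 40945355160, 40945355161,
    40945359240, 40945359256, 40946403464, 41213790344, 41214838920, 38654705669, 38654705670,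
    38654705671, 38654705666]
    [[32355485832, 40946473352], [32372263048, 40963250568], [32355490184, 32356538776,
    41214904456], [40946473369, 41214908808], [32355490201, 40946473096, 41214908824],
    [32355489928, 41214908825], [32372267400, 32373315992, 41231681672], [40963250585,
    41231686024], [32372267417, 40963250312, 41231686040], [32372267144, 41231686041]]
    [[(0, 1), (3, 7), (5, 9), (0, 6), (0, 7), (3, 9), (4, 9), (0, 9), (2, 7), (3, 8), (2, 6), (4,
    8), (0, 8), (2, 9), (2, 8)], [(0, 8), (0, 14), (1, 8), (1, 14), (2, 6), (3, 6), (6, 6), (7, 6),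
    (0, 6), (0, 9), (1, 6), (1, 9), (0, 11), (1, 11)], [(0, 6), (0, 11), (3, 7), (0, 7), (0, 10),
    (2, 6), (2, 7), (2, 11), (3, 11), (3, 13)], [(0, 2), (0, 5), (0, 6), (1, 2), (1, 5), (1, 6)],
    [(0, 3), (0, 5), (2, 3), (3, 3), (4, 3)]]),
  (00010001, .generated
    [40946473369, 40963316120, 41231686041, 41231755656, 41232800136, 41232804248]
    [40928577672, 40945350520, 40945350536, 40945354616, 40945355144, 40945355160, 40945359240,
    40946403464, 40962132104, 41214838920, 38654705665, 38654705669, 40676919432, 40945350792,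
    40945354872, 40945354904, 40945358984, 41213790344, 38654705667, 40675870856, 40944306312,
    38654705664, 38654705666, 38654705671]
    [[40963250312], [40963250568], [41214904456], [41214908824], [32355420313, 40945424520,
    32356534408, 45526648968], [40945354889, 28061571208, 40962197640, 41231685768], [32355424665,
    28061571464, 40962202008, 41231686024], [40945355161, 40945424776, 32356538776, 45526653336]]
    [[(0, 2), (0, 3), (1, 2), (1, 3), (0, 7), (2, 6), (4, 7), (5, 6), (4, 6)], [(0, 5), (1, 5), (2,
    4), (3, 4), (0, 6), (1, 6), (2, 7), (3, 7)], [(0, 6), (1, 7), (2, 4), (3, 5), (0, 7), (1, 6),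
    (2, 5), (3, 4), (4, 1)], [(0, 3), (0, 6), (2, 1), (2, 4), (4, 1), (4, 5), (4, 8), (5, 3)], [(0,
    2), (0, 7), (2, 0), (2, 4), (4, 4)], [(0, 3), (1, 3), (2, 1), (3, 1)], [(4, 1)]]),
  (00010002, .separated
    [40945354905, 40963315848, 40963320472, 41231755656, 41232800136, 41232800152] [38654705667,
    40676919432, 40945350520, 40945350792, 40946403464, 40675870856, 40944306312, 40945350536,
    40945354616, 40945354632, 40945354872, 40945354904, 40945355144, 40945355160, 40945358984,
    40945359256, 38654705664, 38654705666, 38654705671, 40945359240, 38654705669, 38654705670]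
    [45240322167, 40945354887]
    [[38654705665], [38654705666, 38654705668], [40928577672], [40962132104], [27790968968,
    28060448632, 40945350536, 32355420568, 41213790344], [27792017544, 45240321912, 32355420040,
    40945359256, 41214838920]]
    [[40945420424], [40946473096], [40962197640], [40963250312], [32355490200, 41214904456],
    [40946473368, 41214908552], [40945424520, 32356534408, 41214908824], [32372267416,
    41231681672], [40963250584, 41231685768], [40962201736, 32373311624, 41231686040]]),
  (00010010, .generated
    [40946473368, 40962202009, 40963316104, 41214908825, 41231686040, 41231751304, 41232804232]
    [40945350536, 40945350792, 40945354632, 40945355144, 40945358984, 40945359240, 38654705668,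
    38654705669, 40928577672, 40944306312, 40945354887, 40945354889, 40946403464, 40962132104,
    41213790344, 41214838920, 38654705665, 38654705666, 38654705667, 38654705670, 38654705664]
    [[40945359256, 40945424520, 32372267400, 41214908808], [32355420313, 32356534408, 32373315720,
    41231681672], [32355420312, 45240322457, 32372263048, 28078348680, 49804839048, 41231685768],
    [45240322456, 40945359257, 28060518536, 32356538760, 32624973960, 49821620616]]
    [[(0, 3), (1, 2), (0, 2), (1, 3), (0, 1), (2, 3)], [(0, 2), (1, 3), (0, 4), (1, 4), (0, 1), (1,
    0), (2, 4), (3, 4)], [(0, 4), (1, 5), (2, 6), (3, 7), (0, 3), (2, 5)], [(0, 4), (1, 4), (0, 1),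
    (1, 0), (0, 2), (1, 3)], [(2, 1), (3, 0), (2, 0), (3, 1), (0, 1), (2, 4)], [(0, 4), (1, 4), (0,
    0), (0, 3)], [(2, 3), (0, 2), (1, 3)], [(0, 2), (1, 1)]]),
  (00010102, .separated
    [40945354889, 40946473352, 40962201992, 40963250584, 40963315848, 41214908824,
    41232799880] [40676919432, 40946403464, 38654705667, 40675870856, 40928577672, 40945354872,
    40962132104, 41214838920, 38654705671, 40944306312, 40945354904, 41213790344, 38654705664,
    38654705665, 38654705666, 38654705669, 38654705670]
    [40675800952]
    [[38654705668], [40945350792], [40945358984]]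
    [[32355420552, 32356534408, 41231681672], [40945359240, 32356538504, 41231685768]]),
  (00100000, .generated
    [41232804505, 41232869785, 41232870040, 41249647273, 41249651352]
    [38654705666, 40928507767, 40928507784, 40928508040, 40928512136, 40945284983, 40945284984,
    40945285256, 40945350520, 40945350792, 40945354872, 40945355144, 40945355160, 40945355161,
    40945359256, 40945359257, 40945424776, 40945424793, 40962201992, 38654705670, 40928507768,
    40928577672, 40945289352, 40945350536, 40945354616, 40945354632, 40945354871, 40945354889,
    40945354905, 40945359240, 40945420424, 40945424520, 38654705668, 38654705669, 38654705665]
    [[40946403464], [40946473368], [40963246216], [40946469000, 40963250312], [40946473096,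
    40963250584], [32356538760, 40963250585], [32373315976, 40963315848], [40963316104],
    [32356538760, 40963316120], [40963316121, 40963320200], [32356538777, 40963320216],
    [32373385625, 40963320472], [40963320473], [40963320489], [41214838920], [41214908824],
    [41231681672], [41214904456, 41231685768], [41214908552, 41231686040], [32624974216,
    41231686041], [32641751432, 41231751304], [41231751560], [32624974216, 41231751576],
    [41231751577, 41231755656], [32624974233, 41231755672], [32641821081, 41231755928],
    [41231755929], [41231755945]]
    [[(0, 20), (0, 21), (0, 22), (0, 24), (0, 26), (0, 27), (1, 21), (1, 25), (1, 26), (2, 23), (2,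
    26), (2, 27), (6, 26), (7, 27), (9, 27), (0, 23), (0, 25), (1, 20), (1, 23), (2, 24), (2, 25),
    (3, 23), (3, 26), (3, 27), (4, 26), (6, 25), (6, 27), (3, 25)], [(0, 12), (0, 13), (0, 14), (0,
    25), (0, 26), (1, 12), (2, 14), (14, 12), (14, 13), (14, 14), (14, 25), (14, 26), (15, 12),
    (16, 14)], [(0, 12), (0, 13), (1, 13), (2, 12), (3, 12), (5, 12), (5, 13)]]),
  (00100001, .generated
    [40946473369, 41231751577, 41232800136, 41232869784, 41249651352]
    [40676919432, 40928507768, 40928507784, 40928508040, 40928512136, 40928577672, 40945284984,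
    40945285256, 40945350520, 40945350536, 40945350792, 40945354872, 40945355144, 40945420424,
    38654705664, 38654705669, 40945289352, 40945358984, 40945359240, 40945359256, 40962132104,
    40962201736, 40962201992, 40962202008, 38654705665, 38654705666, 38654705671]
    [[40963246216], [40963315848], [40963316104], [40963316120], [45241436296, 40962202009,
    32373315976, 40963320216], [41214838920], [41214908552], [41214908808], [41214908824],
    [40946403464, 41231681672], [32356538504, 41231751304], [32356538760, 41231751560],
    [32356538776, 41231751576], [32355424665, 45509871752, 32641751432, 41231755672]]
    [[(0, 6), (0, 7), (0, 8), (1, 7), (1, 8), (2, 8), (0, 13), (1, 13), (2, 13), (3, 13), (4, 5),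
    (4, 6), (4, 7), (4, 8), (4, 13)], [(0, 11), (0, 13), (1, 12), (2, 13), (5, 7), (5, 9), (6, 8),
    (7, 9), (0, 12), (1, 13), (5, 8), (6, 9), (4, 10), (4, 11), (4, 12), (4, 13)], [(0, 6), (0, 7),
    (0, 11), (1, 7), (5, 2), (5, 3), (5, 9), (6, 3), (0, 14), (5, 14), (4, 10)], [(0, 7), (4, 4),
    (4, 5), (4, 6), (4, 7), (5, 3)], [(4, 5)]]),
  (00100002, .spurious
    [40945355161, 41232800152, 41232874136, 41249646984] [38654705666, 38654705669, 40928507784,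
    40928508040, 40928512136, 40928577672, 40945285000, 40945285256, 40945350536, 40945350792,
    40945354632, 40945354904, 40945355160, 40945359256, 40945424792, 38654705665, 38654705670,
    40945354616, 40945358984, 40945424520, 40962201736]
    2
    [40658954103]),
  (00100010, .spurious
    [40963316120, 40963320473, 41214908824, 41231755673, 41232799880, 41249646984] [38654705667,
    40928577672, 40945285000, 40945285256, 40945289352, 40945350536, 40945350792, 40945354632,
    40945358984, 40962132104, 40962197640, 40962201736, 38654705665, 38654705666, 38654705668,
    40676919432, 40928507784, 40928508040, 40928512136, 40945354887, 40945354889, 40945355144,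
    40962201992, 38654705669, 38654705664]
    0
    [40659024008, 32337524616, 40928507768, 28059404424, 40945350519]),
  (00100100, .separated
    [40963250584, 40963316104, 40963320217, 41214908825, 41231751576, 41231755656,
    41232799880] [40928577672, 40945420424, 40945424520, 40962132104, 40962197640, 40962201736,
    38654705665, 40928508040, 40928512136, 40945285256, 40945289352, 40945350792, 40945354871,
    40945354872, 40945354887, 40945354889, 40945354904, 40945354905, 40945358984, 38654705667,
    38654705669, 38654705666, 38654705668, 38654705670, 38654705671]
    [44952877192, 44953921416, 40658958200, 49265735543, 40927389559, 45222360968, 49517393784]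
    [[38654705664, 47244640257, 30064771076, 42949672967], [32086984840, 40928508040, 40945354871,
    28060453016, 45240326280, 49535355016], [32355354760, 28060448904, 40945354872, 28060453017,
    23782332552, 41213790344]]
    [[32355490200, 40946473096], [40945355160, 40945359240, 40945424793, 32356468872, 49553250440,
    45509871752], [32355424664, 32355490184, 28061567112, 41214908552], [32372267417, 41231681672],
    [32355420569, 40962201992, 32373311624, 45526653064], [40945355144, 40945359257, 32372267416,
    28078348424, 32624904328, 49821685896]]),
  (00100101, .separated
    [40946473352, 40962202009, 40963316120, 40963320200, 41214908824, 41231686024,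
    41232799880] [40945285256, 40945289352, 40945350792, 40945358984, 40945420424, 40945424520,
    38654705667, 38654705668, 40676919432, 40928508040, 40928512136, 40928577672, 40945354872,
    40962132104, 40962197640, 40962201736, 38654705666, 38654705669, 38654705671, 38654705665,
    38654705664]
    [40657909896]
    [[30064771072, 25769803779, 38654705670], [32086984840, 28060383368, 40945354904, 32355424392,
    40962132104], [45240318088, 32355420280, 40945424520, 32372263048, 41213790344]]
    [[32355424664, 40963250312], [28060453256, 40945424792, 32372267400, 40963315848, 45526648968],
    [45240322456, 40945359240, 40962202008, 45258213512, 41231685768], [32355490184, 41231751304]]),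
  (00100102, .separated
    [40945354889, 40963250584, 40963320200, 41214908808, 41231751576, 41232799880] [40928508040,
    40928512136, 40928577672, 40945285256, 40945289352, 40945350792, 40945358984, 40945420424,
    40945424520, 40962132104, 40962197640, 40962201736, 38654705665, 38654705667, 38654705668,
    38654705669, 38654705666, 38654705671, 40945354904]
    [40658958200, 40675800968, 40927389576, 40927459192]
    [[38654705664, 38654705665, 38654705668], [42949672962, 47244640259, 42949672964, 42949672965,
    42949672966, 38654705671], [32086984840, 40928508040, 40945420424], [40945285256, 32355420280,
    40962197640], [32355354760, 32372267144, 41213790344]]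
    [[40946469000], [40945355144, 40963246216], [32356468872, 40963315848, 41214904456],
    [32372267400, 41231681672], [41231685768], [32373315720, 32624904328, 41231751304]]),
  (00101000, .separated
    [40946473368, 40963250568, 40963316121, 41214908825, 41231686040, 41231751304] [38654705668,
    40945354632, 40945354904, 40945354905, 40945355144, 40945355160, 40945355161, 38654705669,
    40928512136, 40928577672, 40945289352, 40945354615, 40945354616, 40945354871, 40945354872,
    40945354887, 40945354889, 40945420424, 40962132104, 40962197640, 38654705666, 38654705670,
    38654705665, 38654705667]
    [49248893064, 40659023736, 44970768247, 40927393655, 49517393800, 45239203704]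
    [[30064771073, 30064771074, 30064771075, 25769803780, 30064771078, 30064771079], [30064771072,
    25769803779, 21474836485, 38654705671], [32086984840, 32338577544, 32355420023, 45240322185,
    49535289496, 45257099400], [32338643080, 32355420280, 28060452999, 49535289753, 45257164936,
    41213790344]]
    [[40963246216, 41214838920], [32356534408, 41231681672]]),
  (00101012, .separated
    [40945354889, 40945359256, 40946473352, 40963315848, 41231685768, 41231751560] [40928577672,
    40962132104, 38654705665, 38654705666, 38654705671, 40676919432, 40928512136, 40945289352,
    40945354632, 40945355144, 40945420424, 40962197640, 41213790344, 38654705668, 38654705664,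
    38654705667]
    [40658958216]
    [[30064771072, 42949672961, 38654705669], [51539607552, 21474836481, 47244640258, 51539607555,
    47244640260, 42949672966, 38654705671]]
    [[40945424520], [40945358984, 40945424776], [32355424648, 40962201736], [40962201992]]),
  (00101020, .separated
    [40945354905, 40945355160, 40946473352, 40963315848, 41214908552, 41231686024] [38654705666,
    40928512136, 40928577672, 40945289352, 40945354887, 40945354889, 40945420424, 38654705667,
    38654705668, 38654705671, 40676919432, 40962132104, 40962197640, 41213790344, 38654705665,
    38654705664]
    [40945354616, 40945354871]
    [[38654705665, 38654705666, 38654705667, 42949672964, 38654705669, 38654705670], [38654705664,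
    42949672963, 38654705669, 38654705671], [40676919432, 28043610248, 32355420040, 32355420295,
    40962132104], [45223544968, 32355420297, 32355420552, 32372263048, 41213790344]]
    [[40946403464], [40963246216, 41214838920], [41214904456], [32356534408, 41231681672]]),
  (01000000, .generated
    [41249651369, 41249716888, 41250765465, 41519201193]
    [38654705665, 40675800951, 40675800952, 40675800968, 40675805320, 40675870856, 40676919432,
    40944236407, 40944236424, 40944240776, 40944306312, 40945285000, 40945289352, 40945354615,
    40945354616, 40945354632, 40945354887, 40945354904, 40945354905, 40945358984, 40945359256,
    40945359257, 40945424520, 40945424792, 40946473096, 38654705664, 38654705666, 38654705667]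
    [[40962132104], [40962197640], [40962201992], [40962202009], [40963246216], [40963250568],
    [40963250584], [40962202008, 40963250585], [32372267416, 40963316104], [40963316120],
    [40963316121], [40963320472], [40963320473], [40963320489], [41231681672], [41231685768],
    [41231686024], [32373315720, 41231686040], [32372267144, 41231686041], [41231751304],
    [40962201736, 41231751560], [32373381256, 41231751576], [41231751577], [41231755656],
    [41231755673], [40963320200, 41231755928], [41231755929], [32373385625, 41231755945],
    [41232799880], [40963250312, 41232800136], [41232800152], [40963315848, 41232800153],
    [41232804232], [41232804248], [41231755672, 41232804249], [41232804504], [32373385608,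
    41232804505], [32373385624, 41232804521], [32641821080, 41232869768], [41232869784],
    [41232869785], [32373385624, 41232870040], [32373385625, 41232870041], [41232870057],
    [41232874136], [41232874137], [41232874153], [41232874409]]
    [[(0, 38), (0, 39), (0, 40), (0, 41), (0, 42), (0, 43), (0, 44), (0, 45), (0, 46), (0, 47), (1,
    44), (1, 45), (1, 46), (1, 47), (2, 46), (4, 44), (4, 45), (4, 46), (4, 47), (5, 46), (8, 46),
    (14, 44), (14, 45), (14, 46), (14, 47), (15, 47), (19, 47), (28, 47)], [(0, 20), (0, 26), (0,
    27), (1, 27), (2, 27), (3, 27), (6, 26), (15, 20)]]),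
  (01000010, .generated
    [40963250584, 40963250585, 41231755672, 41232870041, 41249646984]
    [40675800968, 40675801224, 40675805320, 40676919432, 40944236424, 40944240776, 40945285000,
    40945285256, 40945289352, 40945350792, 40945354632, 40945355144, 40945358984, 40946403464,
    40946469000, 40946473352, 38654705668, 40944306312, 40945354887, 40945354889, 40945420424,
    40945424520, 40945424776, 41213790344, 41214904456, 41214908552, 41214908808, 38654705664,
    38654705665, 38654705670, 38654705671]
    [[40962197640], [40962201992], [40963315848], [32355490200, 32355490201, 40962201736,
    40963316104], [40963320200], [41231681672], [41231686024], [40945354905, 40963246216,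
    41231751304], [32355420568, 40962132104, 41231751560], [40945359257, 32373315976, 41231755656],
    [41232799880], [41214908824, 41214908825, 32641751176, 41232800136], [41232804232],
    [40946473368, 40963250312, 41232869768]]
    [[(0, 9), (0, 12), (0, 13), (1, 13), (2, 9), (5, 9), (5, 13), (6, 13), (7, 12), (0, 11), (1,
    11), (2, 11), (3, 12), (7, 9), (8, 13), (3, 11)], [(0, 7), (0, 8), (1, 8), (2, 7), (0, 12), (3,
    5), (3, 6), (3, 7), (3, 8), (5, 12), (7, 3), (7, 7)], [(0, 7), (0, 8), (0, 11), (1, 8), (1,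
    11), (2, 7), (2, 11), (4, 11), (5, 7), (5, 8), (6, 8), (10, 7), (3, 11)], [(0, 7), (0, 10), (0,
    11), (1, 11), (2, 10), (5, 7)], [(7, 3), (8, 4)]]),
  (01000012, .separated
    [40945354889, 40962202008, 41232800152, 41232874136, 41249646984] [40675800968, 40675801224,
    40675805320, 40675870856, 40944236424, 40944236680, 40944240776, 40944306312, 40945285000,
    40945285256, 40945350536, 40945350792, 38654705666, 38654705668, 38654705665, 38654705670,
    38654705671]
    [40945354887]
    [[38654705664], [38654705667], [38654705669], [40676919432], [40945289352], [40945354632],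
    [40945355144], [32355350408, 40945358984], [40945285256, 40945359240], [40945420424],
    [40945350536, 40945424520], [32355416200, 40945424776], [40675805320, 40946403464],
    [32085936264, 40946469000], [40675800968, 40946473096], [32085866632, 40946473352],
    [41213790344], [32354306184, 41214838920], [40944306312, 41214904456], [32354301832,
    41214908552], [40944236680, 41214908808]]
    [[40963250312], [40963250568], [40963315848], [40963316104], [32373311624, 40963320200],
    [41231685768], [41231686024], [41231751304], [41231751560], [32641747080, 41231755656],
    [32372267144, 41232799880], [32372267400, 41232800136], [32372197512, 41232804232],
    [32372263048, 41232869768]]),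
  (10000000, .generated
    [41519205289, 41537162153]
    [38654705664, 40927393655, 40927393656, 40927393672, 40927393928, 40927463560, 40928512136,
    40944240776, 40945289352, 40945358984, 40945359240, 40945359256, 40945359257, 38654705667]
    [[41213790344], [41214838920], [41214904456], [41214908552], [41214908808], [41214908824],
    [41214908825], [41231681672], [41231685768], [41231686024], [41231686040], [41231686041],
    [41231751304], [41231751560], [41231751576], [41231751577], [41231755656], [41231755672],
    [41231755673], [41231755928], [41231755929], [41231755945], [41232799880], [41232800136],
    [41232800152], [41232800153], [41232804232], [41232804248], [41232804249], [41232804504],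
    [41232804505], [41232804521], [41232869768], [41232869784], [41232869785], [41232870040],
    [41232870041], [41232870057], [41232874136], [41232874137], [41232874153], [41232874409],
    [41249646984], [41249647000], [41249647001], [41249647256], [41249647257], [41249647273],
    [41249651352], [41249651353], [41249651369], [41249651625], [41249716888], [41249716889],
    [41249716905], [41249717161], [41249721257], [41250765464], [41250765465], [41250765481],
    [41250765737], [41250769833], [41250835369], [41267612585]]
    [[(0, 57), (0, 58), (0, 59), (0, 60), (0, 61), (0, 62), (0, 63), (1, 62), (1, 63), (2, 63), (3,
    63), (4, 63), (5, 63), (6, 63)]]),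
  (10000001, .generated
    [41232874409, 41249647001, 41519200920]
    [38654705664, 40927389304, 40927393928, 40927459464, 40927463560, 40928508040, 40928512136,
    40928577672, 40944236408, 40944236424, 40945284984, 40945285000, 40945350520, 40945350536,
    40945354616, 40945354632, 40945355144, 40945355160, 40945359240, 40945359256, 40945424776,
    40945424792, 40946473352, 40946473368, 40962132104, 40962197640, 40962201736, 40963246216,
    40963250312, 40963315848, 40963320472, 38654705665, 38654705671]
    [[41213790344], [41214838920], [41214904456], [41214908552], [32355420297, 41214908808],
    [40945354905, 41214908824], [32355420569, 41231681672], [40945359257, 41231685768],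
    [41231686024], [41231686040], [32355490201, 41231751304], [41231751560], [41231751576],
    [41231755656], [41231755672], [40962202009, 41231755928], [32356538777, 41232799880],
    [41232800136], [41232800152], [41232804232], [41232804248], [40963250585, 41232804504],
    [41232869768], [41232869784], [40963316121, 41232870040], [40963320217, 41232874136],
    [32373385881, 41249646984], [32373385897, 41249647000], [41249647256], [41249651352],
    [41249716888], [41250765464]]
    [[(0, 16), (0, 21), (0, 24), (0, 25), (0, 26), (0, 27), (0, 31), (1, 24), (1, 25), (1, 26), (1,
    27), (2, 25), (2, 26), (2, 27), (3, 26), (3, 27), (4, 28), (4, 29), (4, 30), (4, 31), (5, 28),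
    (5, 29), (5, 30), (5, 31), (6, 29), (6, 30), (6, 31), (7, 30), (7, 31), (10, 31), (15, 31), (4,
    27)], [(0, 19), (0, 23), (0, 26), (0, 28), (0, 29), (0, 30), (1, 29), (1, 30), (2, 30), (3,
    30), (4, 30), (5, 30)], [(4, 11)]]),
  (10000010, .generated
    [40963320489, 41231755928, 41232800153, 41232869784, 41249651353]
    [40927389576, 40927393928, 40927459208, 40927459464, 40927463560, 40928508040, 40928577672,
    40944236680, 40944306312, 40945285000, 40945285256, 40945289352, 40945350792, 40945354632,
    40945355144, 40945358984, 40945420424, 40945424520, 40945424776, 40946403464, 40946473096,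
    40962132104, 40962201736, 40963246216, 40963250312, 40963250568, 40963315848, 40963320200,
    38654705664, 38654705665, 38654705666, 38654705668, 38654705670]
    [[40945424793], [40963250584], [40945355160, 40963250585, 40963320216], [40945355161,
    32355490200, 40963320217], [32355420313, 41213790344], [32355424664, 41214838920],
    [32355424665, 41214908552], [40946473369, 41214908808], [40962202008, 41231681672],
    [40945354904, 41231685768], [32372267417, 41231751304], [40963316121, 41231751560],
    [40945355161, 32373385625, 41214904456, 32641821064], [32355420568, 40963320216, 41231686024,
    41232799880], [40963320472, 41232800136], [40946473368, 41232804232], [32373385881,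
    41232869768], [40963316120, 41249646984]]
    [[(0, 1), (0, 5), (0, 8), (0, 9), (0, 14), (0, 15), (0, 17), (1, 4), (1, 6), (1, 7), (1, 10),
    (1, 11), (1, 16), (0, 13), (1, 12), (2, 4), (2, 6), (2, 7), (2, 10), (2, 11), (2, 16), (4, 14),
    (6, 17)], [(0, 7), (0, 8), (0, 9), (0, 10), (0, 11), (0, 12), (1, 1), (1, 2), (1, 3), (1, 4),
    (1, 5), (1, 6), (0, 14), (1, 13), (4, 12), (4, 20)], [(0, 14), (1, 15), (4, 9), (4, 10), (4,
    11), (4, 13), (5, 5), (6, 11), (7, 11), (8, 5)], [(0, 1), (1, 0)]]),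
  (10000100, .separated
    [40963320472, 41214908825, 41231755656, 41232800152, 41249647001] [40927393928, 40927459464,
    40928512136, 40928577672, 40944240776, 40944306312, 40945285256, 40945350792, 40945354872,
    40945354904, 40945358984, 40945424520, 40946403464, 40946469000, 38654705665, 38654705666,
    38654705669, 40927463560, 40928508040, 40945354871, 40945354887, 40945354889, 40945354905,
    40962201736, 40963246216, 38654705664, 38654705671]
    [40657909624, 40927389304]
    [[38654705667], [38654705666, 38654705668], [30064771074, 38654705670], [40944236680],
    [40945289352], [40945420424], [40946473096], [32337459336, 40962132104], [40927459464,
    40962197640], [40928512136, 40963250312], [32338643080, 40963315848]]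
    [[32355420568, 32372267417, 41213790344], [32355424648, 32373315993, 41214838920],
    [40945424776, 32373381529, 41214904456], [40946473368, 40963320217, 41214908552], [32355420569,
    40962201992, 41231681672], [32355424665, 40963250584, 41231685768], [40945424793, 40963316120,
    41231751304], [32356538777, 40963320200, 41232799880]]),
  (10000101, .generated
    [40946473369, 40962202009, 40963320472, 41214908824, 41249646984]
    [38654705669, 40927393928, 40927459464, 40927463560, 40944236680, 40944240776, 40944306312,
    40945354872, 40945354904, 40946403464, 40946469000, 40946473096, 40963246216, 40963250312,
    40963315848, 38654705666, 38654705670, 40928508040, 40928512136, 40928577672, 40962132104,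
    40962197640, 40962201736, 38654705664, 38654705671]
    [[40945355144], [40945359240], [40945424776], [40963250584], [40963316120], [40963320216],
    [40945354889, 45241440648, 32372267400, 41213790344], [32355420313, 32356538776, 45257169304,
    41232799880]]
    [[(0, 5), (0, 7), (1, 7), (2, 7), (3, 6), (4, 6), (5, 6), (6, 7)], [(0, 6), (3, 3), (6, 4), (6,
    5), (6, 6), (7, 1), (7, 2), (7, 3)], [(0, 4), (0, 6), (0, 7), (1, 7), (3, 3), (3, 4), (3, 7),
    (4, 4), (6, 1)], [(0, 5), (0, 6), (0, 7), (1, 6), (1, 7), (2, 6), (6, 6), (6, 8)], [(0, 6), (1,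
    6), (2, 6), (3, 7), (4, 7), (5, 7), (6, 6)], [(0, 5), (3, 2)], [(6, 1)]]),
  (10000102, .separated
    [40945354889, 40963320472, 41214908824, 41249646984, 41249647000] [40962132104, 40962197640,
    40962201736, 40963246216, 40963250312, 40963315848, 38654705664, 38654705669, 40927393928,
    40927459464, 40927463560, 40928508040, 40928512136, 40928577672, 40945354872, 40945354904,
    38654705665, 38654705670, 38654705671]
    [40641062776]
    [[38654705666], [38654705667], [38654705668], [40944236680], [40944240776], [40944306312],
    [40945285256], [40945289352], [40945350792], [40945358984], [40945420424], [40945424520],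
    [40946403464], [40946469000], [40946473096]]
    [[32372267400, 41213790344], [40963250568, 41214838920], [40963316104, 41214904456],
    [40963320200, 41214908552], [40945355144, 41231681672], [32355424648, 41231685768],
    [40945424776, 41231751304], [40946473352, 41232799880]]),
  (10001000, .generated
    [40963320216, 40963320473, 41214908808, 41231686040, 41231751577, 41232799880]
    [40927463560, 40928512136, 40928577672, 40944240776, 40944306312, 40945289352, 40945354871,
    40945355160, 40945420424, 40946403464, 40962132104, 40963246216, 38654705665, 38654705666,
    38654705667, 38654705668, 40945354615, 40945354632, 40945354887, 40945354904, 38654705669,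
    38654705664]
    [[40945359240, 45240391816, 40962202009, 32373315720, 45508757640], [40945359256, 40945424793,
    32356538504, 28078348697, 45509806216], [28060522904, 32356538760, 40963250584, 32373381529,
    45509871752], [40945424776, 32372267416, 28078348680, 40963315848, 45526648968]]
    [[(0, 1), (0, 3), (1, 2), (2, 3), (0, 2), (1, 3)], [(0, 0), (0, 1), (1, 0), (1, 2), (2, 2), (2,
    3), (3, 1), (3, 3), (0, 4), (1, 4), (2, 4), (3, 4), (0, 2), (0, 3), (1, 1), (1, 3)], [(0, 14),
    (1, 12), (2, 15), (3, 13), (2, 12), (2, 13), (3, 14), (0, 10), (1, 11), (0, 9)], [(0, 4), (0,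
    5), (1, 5), (1, 6)], [(0, 0), (0, 1), (1, 2), (2, 1), (0, 2), (1, 1)], [(0, 2), (0, 3), (1, 1),
    (1, 3)]]),
  (10001010, .separated
    [40945359257, 40946473369, 40962202008, 40963316121, 40963320200, 41214908808,
    41232799880] [40928577672, 40945289352, 40945354632, 40945354889, 40945355144, 40945420424,
    40946403464, 38654705667, 38654705669, 40928512136, 40944306312, 40946469000, 40962132104,
    38654705665, 38654705668, 38654705670, 40944240776, 40945354887, 40962197640, 38654705664,
    38654705671]
    [40928507768]
    [[38654705665, 38654705666, 38654705669], [32337528968, 32355420040, 40945420424],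
    [32355354760, 40945355144, 40963246216]]
    [[40945424520], [40963250568], [32355424392, 40945424776, 40963315848], [32355424648,
    40963250312, 40963316104]]),
  (10001012, .separated
    [40945354889, 40946473368, 40962202008, 40963320200, 41214908808, 41232799880] [38654705668,
    40927463560, 40928512136, 40928577672, 40945355144, 40946403464, 40946469000, 38654705669,
    40944240776, 40944306312, 40962132104, 40962197640, 38654705664, 38654705665, 38654705671,
    38654705670]
    [40928507768]
    [[38654705667], [38654705665, 38654705666, 38654705669], [40945289352], [40927463560,
    40945354632], [40945420424], [40945355144, 40963246216]]
    [[40945358984], [40945424520], [32355424648, 40963250312], [40963250568], [40945424776,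
    40963315848], [40963316104]]),
  (10010000, .spurious
    [40963315848, 40963320472, 41214908825, 41231681672] [38654705667, 38654705668, 40928577672,
    40945350520, 40945350536, 40945354615, 40945354616, 40945354632, 40945354871, 40945354887,
    40945354889, 40945354905, 40945355161, 40945358984, 40962132104, 38654705665, 38654705669,
    40945359240, 40945359256, 40945359257]
    0
    [40927459191]),
  (10010001, .separated
    [40946473369, 40962202009, 40963315848, 40963320472, 41214908824, 41231686024] [40944306312,
    40945354872, 40945354904, 40945355144, 40945355160, 40945359240, 40945359256, 40946403464,
    38654705666, 38654705667, 38654705670, 40945350520, 40945350536, 40945354616, 40945354632,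
    38654705669, 38654705671, 38654705664]
    [40927393928]
    [[38654705668], [38654705665, 38654705666, 38654705670], [40945350792], [40928577672,
    32354371720, 40945354872], [40945358984], [40945354904, 32356468872, 40962132104]]
    [[40945424776], [32355490200, 32356538760, 40962201992], [32356538776, 40962202008,
    40963250568], [40963250584]]),
  (10010002, .separated
    [40945354889, 40963315848, 40963320200, 40963320472, 41214908824, 41231681672] [38654705667,
    40928577672, 40945350792, 40945354632, 40945354872, 40945358984, 40962132104, 38654705665,
    38654705668, 38654705669, 40945350536, 40945354616, 40945354904, 40945359240, 38654705670,
    38654705671, 40945355160, 40945359256]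
    [40927389576]
    [[38654705666], [38654705664, 42949672961, 47244640259, 47244640260, 42949672965, 42949672966,
    38654705671], [40944306312], [32355416200, 32355420552], [32338643080, 32355415928,
    40945355144], [40946403464]]
    [[40945420424], [40946469000]]),
  (10010010, .separated
    [40945424793, 40946473368, 40962202009, 40963320200, 41214908808, 41231681672] [38654705667,
    38654705669, 40944306312, 40945350792, 40945354632, 40945354889, 40945358984, 40945359240,
    38654705668, 40928577672, 40945350536, 40945354887, 40946403464, 38654705666, 38654705670,
    40962132104, 38654705664]
    [40659028104]
    [[38654705664, 38654705665, 38654705666, 42949672963, 42949672964, 38654705669, 38654705670],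
    [38654705666, 38654705671], [40945355144]]
    [[40945420424], [32355420568, 40962201992], [40945355161, 40946469000, 32356538760,
    40963246216], [40945355161, 40963250568]]),
  (10010100, .separated
    [40945424792, 40946473369, 40962202009, 40963250568, 40963315848, 41214908552,
    41231681672] [40945350792, 40945354872, 40945354889, 40945354904, 40945354905, 40945358984,
    38654705668, 38654705670, 40944306312, 40945354871, 40945354887, 40946403464, 38654705667,
    38654705669, 38654705671, 38654705666, 38654705664]
    [66428831880, 66445605000, 40927393928]
    [[38654705665, 38654705666, 38654705668, 42949672966], [32338643080, 32354371720, 32355416200,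
    32355420279, 45240322185], [32355420295, 45240322201, 40945358984, 40946403464, 40962132104]]
    [[40945355161, 40945359240, 40945424520, 49536403592, 28077295752, 41213790344], [40945355160,
    40945359257, 45241440392, 23782332552, 32373311624, 41214838920]]),
  (10010101, .separated
    [40945355161, 40945359257, 40946473368, 40962201992, 40963315848, 41214908552,
    41231681672] [40944306312, 40945354872, 40945354904, 40946403464, 38654705666, 38654705667,
    40928577672, 40945350792, 40945358984, 40962132104, 38654705671, 38654705664, 38654705665,
    38654705668, 38654705669]
    [32085866632, 32337459336]
    [[30064771074, 38654705670]]
    [[40945354905, 40945355160, 45240387720, 28060522632, 40962197640, 41213790344], [32355420297,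
    40945359240, 32356538504, 45258213512, 28078348424, 41214838920]]),
  (10010102, .separated
    [40945354889, 40945354905, 40946473352, 40962202008, 40963315848, 41214908552,
    41231681672] [38654705667, 40944306312, 40945350792, 40945358984, 40946403464, 38654705666,
    38654705668, 40928577672, 40945354872, 40945354904, 40962132104, 38654705671, 38654705664,
    38654705669, 38654705670]
    [40659028104]
    [[38654705665, 38654705666, 38654705668]]
    [[40945420424], [40963250312]]),
  (10010122, .separated
    [40945354889, 40945354904, 40946473352, 40962201992, 40963315848, 41214908552,
    41231681672] [38654705667, 40944306312, 40945350792, 40945358984, 40946403464, 38654705666,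
    38654705668, 38654705671, 38654705664, 38654705670, 38654705669]
    [40945354872]
    [[38654705665, 38654705666, 38654705668], [40928577672, 32354371720, 40945350792],
    [40945358984, 32356468872, 40962132104]]
    [[40945420424], [32355489928, 32356534408, 40962197640], [32356538504, 40962201736,
    40963246216], [40963250312]]),
  (20010102, .separated
    [40945354889, 40945424792, 40946473368, 40962201992, 40963250584, 40963315848,
    41214838920] [38654705669, 40928577672, 40945354904, 40946403464, 40962132104, 40944306312,
    40945354872, 38654705664, 38654705665, 38654705667, 38654705671, 38654705666, 38654705670]
    [40675870856]
    [[38654705668], [40945350792], [40945358984]]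
    [[40945355144, 40946469000], [32355424648, 40946473096]])]

end E8

namespace E8

open Filter Topology

theorem certificates_check : certificates.all (fun p => checkCode p.1 p.2) = true := by
  decide +kernel

theorem exists_certificate : ∀ n ∈ labels, n ∈ certificates.map Prod.fst := by decide +kernel

/-! ### Conjugacy of generic vectors -/

theorem lie_mem_wtSpace_two {v : Lat} {z x : Model} (hz : z ∈ wtSpace v 0)
    (hx : x ∈ wtSpace v 2) : ⁅z, x⁆ ∈ wtSpace v 2 := by
  have h := lie_mem_wtSpace hz hx
  rwa [zero_add] at h

/-- The orbit map of a vector of weight two on the weight zero part. -/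
noncomputable def orbitMap (v : Lat) : wtSpace v 2 →ₗ[ℂ] wtSpace v 0 →ₗ[ℂ] wtSpace v 2 :=
  LinearMap.mk₂ ℂ (fun x z => ⟨⁅(z : Model), (x : Model)⁆, lie_mem_wtSpace_two z.2 x.2⟩)
    (fun _ _ _ => Subtype.ext (lie_add _ _ _)) (fun _ _ _ => Subtype.ext (lie_smul _ _ _))
    (fun _ _ _ => Subtype.ext (add_lie _ _ _)) (fun _ _ _ => Subtype.ext (smul_lie _ _ _))

theorem isGeneric_iff {v : Lat} (x : wtSpace v 2) :
    IsGeneric v x ↔ Function.Surjective (orbitMap v x) := by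
  constructor
  · rintro ⟨-, h⟩ y
    obtain ⟨z, hz, h⟩ := h y y.2
    exact ⟨⟨z, hz⟩, Subtype.ext h⟩
  · refine fun h => ⟨x.2, fun y hy => ?_⟩
    obtain ⟨z, hz⟩ := h ⟨y, hy⟩
    exact ⟨z, z.2, congrArg Subtype.val hz⟩

theorem countable_not_isGeneric {v : Lat} {a b : Model} (ha : IsGeneric v a)
    (hb : IsGeneric v b) : {s : ℂ | ¬ IsGeneric v (a + s • (b - a))}.Countable := by
  lift a to wtSpace v 2 using ha.1
  lift b to wtSpace v 2 using hb.1
  obtain ⟨R, hR⟩ := (orbitMap v a).exists_rightInverse_of_surjective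
    (LinearMap.range_eq_top.2 ((isGeneric_iff a).1 ha))
  let K : Module.End ℂ (wtSpace v 2) := orbitMap v (b - a) ∘ₗ R
  refine ((K.finite_hasEigenvalue.image fun μ => -μ⁻¹).subset fun s hs => ?_).countable
  have h1 : ¬ Function.Surjective (orbitMap v (a + s • (b - a))) := fun h =>
    hs ((isGeneric_iff _).2 h)
  have h2 : orbitMap v (a + s • (b - a)) ∘ₗ R = LinearMap.id + s • K := by
    rw [map_add, map_smul, LinearMap.add_comp, hR, LinearMap.smul_comp]
  have h3 : ¬ Function.Injective (LinearMap.id + s • K : Module.End ℂ (wtSpace v 2)) := fun h => by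
    have h4 := LinearMap.injective_iff_surjective.1 h
    rw [← h2] at h4
    exact h1 (Function.Surjective.of_comp h4)
  rw [← LinearMap.ker_eq_bot, Submodule.eq_bot_iff] at h3
  push Not at h3
  obtain ⟨y, hy, hy0⟩ := h3
  have h5 : y + s • K y = 0 := hy
  have hs0 : s ≠ 0 := by
    rintro rfl
    exact hy0 (by simpa using h5)
  refine ⟨-s⁻¹, Module.End.hasEigenvalue_of_hasEigenvector (x := y)
    ⟨Module.End.mem_eigenspace_iff.2 ?_, hy0⟩, by simp⟩
  rw [← sub_eq_zero, neg_smul, sub_neg_eq_add, ← smul_right_injective _ hs0 |>.eq_iff, smul_add,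
    smul_inv_smul₀ hs0, smul_zero, add_comm, h5]

theorem IsGeneric.exists_conj {v : Lat} {a b : Model} (ha : IsGeneric v a) (hb : IsGeneric v b) :
    ∃ φ : Model ≃ₗ⁅ℂ⁆ Model, φ (coroot v) = coroot v ∧ φ a = b := by
  refine rel_of_locally (S := {x | IsGeneric v x})
    (P := fun a b => ∃ φ : Model ≃ₗ⁅ℂ⁆ Model, φ (coroot v) = coroot v ∧ φ a = b) ?_ ?_ ?_ ha hb
    (countable_not_isGeneric ha hb)
  · rintro a b ⟨φ, h1, rfl⟩
    exact ⟨φ.symm, by rw [LieEquiv.symm_apply_eq, h1], φ.symm_apply_apply a⟩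
  · rintro a b c ⟨φ, h1, rfl⟩ ⟨ψ, h2, rfl⟩
    exact ⟨φ.trans ψ, by rw [LieEquiv.trans_apply, h1, h2], rfl⟩
  · rintro x ⟨hx, hx'⟩
    filter_upwards [eventually_exists_expAd (L := ⊥) (Z := wtSpace v 0) (W := wtSpace v 2)
      (fun z hz w hw => lie_mem_wtSpace_two hz hw) bot_le hx fun w hw => by
        obtain ⟨z, hz, h⟩ := hx' w hw
        exact ⟨z, hz, 0, zero_mem _, by rw [zero_add, h]⟩] with y hy hyS
    obtain ⟨z, hz, l, hl, h⟩ := hy hyS.1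
    rw [(Submodule.mem_bot ℂ).1 hl, add_zero] at h
    refine ⟨expAd z, expAd_of_lie_eq_zero ?_, h⟩
    rw [← lie_skew, mem_wtSpace.1 hz, Int.cast_zero, zero_smul, neg_zero]

theorem IsTriple.isGeneric {v : Lat} {e f : Model} (T : IsTriple (coroot v) e f) :
    IsGeneric v e := by
  refine ⟨T.e_mem, fun y hy => ?_⟩
  obtain ⟨z, hz, h⟩ := T.exists_lie_eq two_pos hy
  rw [sub_self] at hz
  exact ⟨-z, neg_mem hz, by rw [neg_lie, lie_skew, h]⟩

/-! ### Transport along isomorphisms -/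

section Transport
variable {L L' : Type*} [LieRing L] [LieAlgebra ℂ L] [LieRing L'] [LieAlgebra ℂ L']

theorem map_mem_span_lie (φ : L ≃ₗ⁅ℂ⁆ L') {e : L}
    (h : e ∈ Submodule.span ℂ {z : L | ∃ x : L, ⁅e, x⁆ = 0 ∧ ∃ y : L, ⁅e, y⁆ = 0 ∧ ⁅x, y⁆ = z}) :
    φ e ∈ Submodule.span ℂ
      {z : L' | ∃ x : L', ⁅φ e, x⁆ = 0 ∧ ∃ y : L', ⁅φ e, y⁆ = 0 ∧ ⁅x, y⁆ = z} := by
  have h1 := Submodule.mem_map_of_mem (f := φ.toLinearEquiv.toLinearMap) h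
  rw [Submodule.map_span] at h1
  refine Submodule.span_mono ?_ h1
  rintro _ ⟨_, ⟨x, hx, y, hy, rfl⟩, rfl⟩
  exact ⟨φ x, by rw [← LieEquiv.map_lie, hx, map_zero], φ y,
    by rw [← LieEquiv.map_lie, hy, map_zero], (LieEquiv.map_lie φ x y).symm⟩

theorem mem_lieSpan_of_map_mem (φ : L ≃ₗ⁅ℂ⁆ L') {h e x : L}
    (hx : φ x ∈ LieSubalgebra.lieSpan ℂ L' {x | ⁅φ e, x⁆ = 0 ∧ ⁅φ h, x⁆ = x}) :
    x ∈ LieSubalgebra.lieSpan ℂ L {x | ⁅e, x⁆ = 0 ∧ ⁅h, x⁆ = x} := by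
  have h1 : LieSubalgebra.lieSpan ℂ L' {x | ⁅φ e, x⁆ = 0 ∧ ⁅φ h, x⁆ = x} ≤
      (LieSubalgebra.lieSpan ℂ L {x | ⁅e, x⁆ = 0 ∧ ⁅h, x⁆ = x}).comap φ.symm.toLieHom := by
    refine LieSubalgebra.lieSpan_le.2 fun y hy => LieSubalgebra.subset_lieSpan ?_
    obtain ⟨y, rfl⟩ : ∃ z, φ z = y := ⟨φ.symm y, φ.apply_symm_apply y⟩
    rw [Set.mem_ofPred_eq, ← LieEquiv.map_lie, ← LieEquiv.map_lie] at hy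
    have hi : Function.Injective φ := φ.injective
    have h2 : φ.symm (φ y) = y := φ.symm_apply_apply y
    change φ.symm (φ y) ∈ _
    rw [h2]
    exact ⟨hi (hy.1.trans (map_zero φ).symm), hi hy.2⟩
  have h2 : φ.symm (φ x) = x := φ.symm_apply_apply x
  rw [← h2]
  exact h1 hx

theorem mem_span_lie_of_mem_lieSpan {h e : L} (he : ⁅h, e⁆ = (2 : ℂ) • e)
    (hm : e ∈ LieSubalgebra.lieSpan ℂ L {x | ⁅e, x⁆ = 0 ∧ ⁅h, x⁆ = x}) :
    e ∈ Submodule.span ℂ {z : L | ∃ x : L, ⁅e, x⁆ = 0 ∧ ∃ y : L, ⁅e, y⁆ = 0 ∧ ⁅x, y⁆ = z} := by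
  set D := Submodule.span ℂ {z : L | ∃ x : L, ⁅e, x⁆ = 0 ∧ ∃ y : L, ⁅e, y⁆ = 0 ∧ ⁅x, y⁆ = z}
    with hD
  have hDc : ∀ x ∈ D, ⁅e, x⁆ = 0 := fun x hx => by
    induction hx using Submodule.span_induction with
    | mem x hx =>
      obtain ⟨x, hx, y, hy, rfl⟩ := hx
      rw [leibniz_lie, hx, hy, zero_lie, lie_zero, add_zero]
    | zero => exact lie_zero e
    | add a b _ _ ha hb => rw [lie_add, ha, hb, add_zero]
    | smul c a _ ha => rw [lie_smul, ha, smul_zero]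
  have hh : ∀ x : L, ⁅e, x⁆ = 0 → ⁅e, ⁅h, x⁆⁆ = 0 := fun x hx => by
    rw [leibniz_lie, hx, lie_zero, add_zero, ← lie_skew e h, he, neg_lie, smul_lie, hx, smul_zero,
      neg_zero]
  have hDh : ∀ x ∈ D, ⁅h, x⁆ ∈ D := fun x hx => by
    induction hx using Submodule.span_induction with
    | mem x hx =>
      obtain ⟨x, hx, y, hy, rfl⟩ := hx
      rw [leibniz_lie]
      exact add_mem (Submodule.subset_span ⟨_, hh x hx, y, hy, rfl⟩)
        (Submodule.subset_span ⟨x, hx, _, hh y hy, rfl⟩)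
    | zero => rw [lie_zero]; exact zero_mem D
    | add a b _ _ ha hb => rw [lie_add]; exact add_mem ha hb
    | smul c a _ ha => rw [lie_smul]; exact D.smul_mem c ha
  let K : LieSubalgebra ℂ L :=
    { carrier := {x | ⁅e, x⁆ = 0 ∧ ∃ y ∈ D, ⁅h, x - y⁆ = x - y}
      add_mem' := by
        rintro a b ⟨ha, y, hy, ha'⟩ ⟨hb, z, hz, hb'⟩
        exact ⟨by rw [lie_add, ha, hb, add_zero], y + z, add_mem hy hz,
          by rw [add_sub_add_comm, lie_add, ha', hb']⟩
      zero_mem' := ⟨lie_zero e, 0, zero_mem D, by rw [sub_zero, lie_zero]⟩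
      smul_mem' := by
        rintro c a ⟨ha, y, hy, ha'⟩
        exact ⟨by rw [lie_smul, ha, smul_zero], c • y, D.smul_mem c hy,
          by rw [← smul_sub, lie_smul, ha']⟩
      lie_mem' := by
        rintro a b ⟨ha, -⟩ ⟨hb, -⟩
        exact ⟨by rw [leibniz_lie, ha, hb, zero_lie, lie_zero, add_zero], ⁅a, b⁆,
          Submodule.subset_span ⟨a, ha, b, hb, rfl⟩, by rw [sub_self, lie_zero]⟩ }
  have hK : LieSubalgebra.lieSpan ℂ L {x | ⁅e, x⁆ = 0 ∧ ⁅h, x⁆ = x} ≤ K :=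
    LieSubalgebra.lieSpan_le.2 fun x hx => ⟨hx.1, 0, zero_mem D, by rw [sub_zero, hx.2]⟩
  obtain ⟨-, y, hy, hy'⟩ := hK hm
  have h1 : e = ⁅h, y⁆ - y := by
    rw [lie_sub, he, two_smul] at hy'
    rw [sub_eq_sub_iff_add_eq_add] at hy'
    rw [eq_sub_iff_add_eq, ← add_right_inj e, ← add_assoc, hy', add_comm]
  rw [h1]
  exact sub_mem (hDh y hy) hy

end Transport

/-! ### The main theorem -/

theorem IsTriple.cent_le {v : Lat} {e f : Model} (T : IsTriple (coroot v) e f)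
    (hd : ∀ i, 0 ≤ ip v (Pi.single i 1)) (he : Reach e) (m : ℕ) (hm : 1 ≤ m) :
    cent v e m ≤ (genByOne v e).toSubmodule := by
  rcases eq_or_ne v 0 with rfl | hv
  · intro x hx
    have h1 := mem_wtSpace.1 (mem_cent.1 hx).1
    have h2 : coroot (0 : Lat) = 0 := by simp [coroot]
    rw [h2, zero_lie, eq_comm, smul_eq_zero, Int.cast_eq_zero] at h1
    rw [h1.resolve_left (by omega)]
    exact zero_mem _
  · obtain ⟨a, ha, ha', hl⟩ := T.mem_labels hv hd he
    obtain ⟨⟨n, C⟩, hC, hn⟩ := List.mem_map.1 (exists_certificate _ hl)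
    obtain ⟨e₀, hg, h⟩ := exists_isGeneric_of_checkCode ha ha' hn.symm
      (List.all_eq_true.1 certificates_check _ hC)
    obtain ⟨φ, h1, rfl⟩ := T.isGeneric.exists_conj hg
    have T' := T.map φ
    rw [h1] at T'
    intro x hx
    obtain ⟨hx, hx'⟩ := mem_cent.1 hx
    refine mem_lieSpan_of_map_mem φ ?_
    rw [h1]
    refine h _ T' (map_mem_span_lie φ he) m hm (mem_cent.2 ⟨?_, ?_⟩)
    · rw [mem_wtSpace, ← h1, ← LieEquiv.map_lie, mem_wtSpace.1 hx, map_smul]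
    · rw [← LieEquiv.map_lie, hx', map_zero]

theorem mem_lieSpan_of_reach {h e f : Model} (T : IsTriple h e f) (he : Reach e) {k : ℤ}
    (hk : 1 ≤ k) {x : Model} (hx : ⁅e, x⁆ = 0) (hx' : ⁅h, x⁆ = (k : ℂ) • x) :
    x ∈ LieSubalgebra.lieSpan ℂ Model {x | ⁅e, x⁆ = 0 ∧ ⁅h, x⁆ = x} := by
  obtain ⟨φ, v, hv, hd⟩ := T.exists_conj_dominant
  have T' := T.map φ
  rw [hv] at T'
  lift k to ℕ using by omega
  refine mem_lieSpan_of_map_mem φ ?_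
  rw [hv]
  refine T'.cent_le hd (map_mem_span_lie φ he) k (by omega) (mem_cent.2 ⟨?_, ?_⟩)
  · rw [mem_wtSpace, ← hv, ← LieEquiv.map_lie, hx', map_smul]
  · rw [← LieEquiv.map_lie, hx, map_zero]

end E8

/-- Panyushev property for the simple Lie algebra of type E8:
`e` is reachable iff the Lie subalgebra generated by `g(1)_e` contains every `g(k)_e`, `k ≥ 1`. -/
theorem panyushev_property_E8 (h e f : LieAlgebra.e₈ ℂ)
    (hhe : ⁅h, e⁆ = (2 : ℂ) • e) (hhf : ⁅h, f⁆ = (-2 : ℂ) • f) (hef : ⁅e, f⁆ = h) :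
    e ∈ derived e ↔
      ∀ k : ℤ, 1 ≤ k → ∀ x : LieAlgebra.e₈ ℂ, ⁅e, x⁆ = 0 → ⁅h, x⁆ = (k : ℂ) • x →
        x ∈ LieSubalgebra.lieSpan ℂ (LieAlgebra.e₈ ℂ)
            {x : LieAlgebra.e₈ ℂ | ⁅e, x⁆ = 0 ∧ ⁅h, x⁆ = x} := by
  constructor
  · intro he k hk x hx hx'
    have T : E8.IsTriple (E8.equivModel h) (E8.equivModel e) (E8.equivModel f) :=
      ⟨by rw [← LieEquiv.map_lie, hhe, map_smul], by rw [← LieEquiv.map_lie, hhf, map_smul],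
        by rw [← LieEquiv.map_lie, hef]⟩
    exact E8.mem_lieSpan_of_map_mem E8.equivModel (E8.mem_lieSpan_of_reach T
      (E8.map_mem_span_lie E8.equivModel he) hk (by rw [← LieEquiv.map_lie, hx, map_zero])
      (by rw [← LieEquiv.map_lie, hx', map_smul]))
  · intro H
    exact E8.mem_span_lie_of_mem_lieSpan hhe (H 2 (by norm_num) e (lie_self e)
      (by rw [hhe]; norm_num))
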